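/- Let k ≥ 1, n = 2k−1, and let p and q be distinct primes with p ≥ k and q ≥ k. Then for every choice of parameters ℓ₁,…,ℓ_k (each coprime to p) and ℓ'₁,…,ℓ'_k (each coprime to q), the Lusternik–Schnirelmann category of the product of lens spaces satisfies cat(L^n_p(ℓ₁,…,ℓ_k) × L^n_q(ℓ'₁,…,ℓ'_k)) = n + 1. -/

import Mathlib

open scoped Topology

/-- The Lusternik–Schnirelmann category of a space (normalized so that contractible spaces
have category 0): the least `k` such that `X` admits an open cover by `k+1` sets, each of
which has nullhomotopic inclusion into `X` (i.e. is contractible in `X`). -/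
noncomputable def lsCat (X : Type*) [TopologicalSpace X] : ℕ :=
  sInf {k : ℕ | ∃ U : Fin (k + 1) → Set X,
    (∀ i, IsOpen (U i)) ∧ (⋃ i, U i) = Set.univ ∧
    ∀ i, ContinuousMap.Nullhomotopic
      (⟨Subtype.val, continuous_subtype_val⟩ : C(U i, X))}

/-- The orbit relation on the unit sphere of `ℂ^k` defining the lens space
`L^{2k-1}_p(ℓ₁,…,ℓ_k)`: a fixed generator of `ℤ/p` acts coordinatewise by
`z_j ↦ exp(2πiℓ_j/p) z_j`, and `m` ranges over the powers of this generator. -/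
def lensRel (p k : ℕ) (ℓ : Fin k → ℤ) :
    Metric.sphere (0 : EuclideanSpace ℂ (Fin k)) 1 →
      Metric.sphere (0 : EuclideanSpace ℂ (Fin k)) 1 → Prop :=
  fun x y => ∃ m : ℤ, ∀ j : Fin k,
    (y.1 j) = Complex.exp (2 * Real.pi * Complex.I * m * ℓ j / p) * (x.1 j)

/-- The lens space `L^{2k-1}_p(ℓ₁,…,ℓ_k)`: the orbit space of the free linear action of `ℤ/p`
on the unit sphere `S^{2k-1} ⊆ ℂ^k` determined by the parameters `ℓ`, with the quotient
topology. -/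
noncomputable def LensSpace (p k : ℕ) (ℓ : Fin k → ℤ) : Type :=
  Quot (lensRel p k ℓ)

noncomputable instance (p k : ℕ) (ℓ : Fin k → ℤ) : TopologicalSpace (LensSpace p k ℓ) :=
  inferInstanceAs (TopologicalSpace (Quot (lensRel p k ℓ)))


namespace LS

/-- chains on lists -/
abbrev Ch (T : Type*) := FreeAbelianGroup (List T)

open FreeAbelianGroup

section chains
variable {T T' T'' : Type*}

def cn (v : T) : Ch T →+ Ch T := FreeAbelianGroup.map (List.cons v)

def bd0 : List T → Ch T
  | [] => 0
  | v :: s => of s - cn v (bd0 s)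

def bd : Ch T →+ Ch T := lift bd0

@[simp] lemma cn_of (v : T) (l : List T) : cn v (of l) = of (v :: l) := by simp [cn]

@[simp] lemma bd_nil : bd (of ([] : List T)) = 0 := by simp [bd, bd0]

lemma bd_of_cons (v : T) (s : List T) : bd (of (v :: s)) = of s - cn v (bd (of s)) := by
  simp [bd, bd0]

lemma bd_cn (v : T) (c : Ch T) : bd (cn v c) = c - cn v (bd c) := by
  induction c using FreeAbelianGroup.induction_on with
  | zero => simp
  | of l => simp [bd_of_cons]
  | neg l h => simp only [map_neg, h]; abel
  | add a b ha hb => simp only [map_add, ha, hb]; abel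

lemma bd_bd (c : Ch T) : bd (bd c) = 0 := by
  induction c using FreeAbelianGroup.induction_on with
  | zero => simp
  | of l =>
    induction l with
    | nil => simp
    | cons v s ih => rw [bd_of_cons, map_sub, bd_cn, ih]; simp
  | neg l h => simp only [map_neg, h]; simp
  | add a b ha hb => simp only [map_add, ha, hb]; simp

/-- push forward -/
def psh (f : T → T') : Ch T →+ Ch T' := FreeAbelianGroup.map (List.map f)

@[simp] lemma psh_of (f : T → T') (l : List T) : psh f (of l) = of (l.map f) := by simp [psh]

lemma psh_cn (f : T → T') (v : T) (c : Ch T) : psh f (cn v c) = cn (f v) (psh f c) := by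
  induction c using FreeAbelianGroup.induction_on with
  | zero => simp
  | of l => simp
  | neg l h => simp only [map_neg, h]
  | add a b ha hb => simp only [map_add, ha, hb]

lemma bd_psh (f : T → T') (c : Ch T) : bd (psh f c) = psh f (bd c) := by
  induction c using FreeAbelianGroup.induction_on with
  | zero => simp
  | of l =>
    induction l with
    | nil => simp
    | cons v s ih =>
      rw [psh_of, List.map_cons, bd_of_cons, bd_of_cons, map_sub, psh_cn, ← ih]; simp
  | neg l h => simp only [map_neg, h]
  | add a b ha hb => simp only [map_add, ha, hb]

lemma psh_psh (f : T → T') (g : T' → T'') (c : Ch T) : psh g (psh f c) = psh (g ∘ f) c := by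
  induction c using FreeAbelianGroup.induction_on with
  | zero => simp
  | of l => simp
  | neg l h => simp only [map_neg, h]
  | add a b ha hb => simp only [map_add, ha, hb]

lemma psh_id (c : Ch T) : psh id c = c := by
  induction c using FreeAbelianGroup.induction_on with
  | zero => simp
  | of l => simp
  | neg l h => simp only [map_neg, h]
  | add a b ha hb => simp only [map_add, ha, hb]

/-- prism -/
def pr0 (f g : T → T') : List T → Ch T'
  | [] => 0
  | v :: s => of (f v :: g v :: s.map g) - cn (f v) (pr0 f g s)

def pr (f g : T → T') : Ch T →+ Ch T' := lift (pr0 f g)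

@[simp] lemma pr_nil (f g : T → T') : pr f g (of ([] : List T)) = 0 := by simp [pr, pr0]

lemma pr_of_cons (f g : T → T') (v : T) (s : List T) :
    pr f g (of (v :: s)) = of (f v :: g v :: s.map g) - cn (f v) (pr f g (of s)) := by
  simp [pr, pr0]

lemma pr_cn (f g : T → T') (v : T) (c : Ch T) :
    pr f g (cn v c) = cn (f v) (cn (g v) (psh g c)) - cn (f v) (pr f g c) := by
  induction c using FreeAbelianGroup.induction_on with
  | zero => simp
  | of l => simp [pr_of_cons]
  | neg l h => simp only [map_neg, h]; abel
  | add a b ha hb => simp only [map_add, ha, hb]; abel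

lemma bd_pr (f g : T → T') (c : Ch T) :
    bd (pr f g c) = psh g c - psh f c - pr f g (bd c) := by
  induction c using FreeAbelianGroup.induction_on with
  | zero => simp
  | of l =>
    induction l with
    | nil => simp
    | cons v s ih =>
      have h2 : psh g (bd (of s)) = bd (of (s.map g)) := by rw [← bd_psh]; simp
      rw [pr_of_cons, map_sub, bd_of_cons, bd_of_cons, bd_cn, ih, bd_of_cons, map_sub, map_sub (pr f g), pr_cn, h2]
      simp only [map_sub, cn_of, psh_of, List.map_cons]
      abel
  | neg l h => simp only [map_neg, h]; abel
  | add a b ha hb => simp only [map_add, ha, hb]; abel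

lemma psh_pr (f g : T → T') (h : T' → T'') (c : Ch T) :
    psh h (pr f g c) = pr (h ∘ f) (h ∘ g) c := by
  induction c using FreeAbelianGroup.induction_on with
  | zero => simp
  | of l =>
    induction l with
    | nil => simp
    | cons v s ih => rw [pr_of_cons, pr_of_cons, map_sub, psh_cn, ih]; simp
  | neg l h => simp only [map_neg, h]
  | add a b ha hb => simp only [map_add, ha, hb]

lemma pr_psh (h : T → T') (f g : T' → T'') (c : Ch T) :
    pr f g (psh h c) = pr (f ∘ h) (g ∘ h) c := by
  induction c using FreeAbelianGroup.induction_on with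
  | zero => simp
  | of l =>
    induction l with
    | nil => simp
    | cons v s ih =>
      simp only [psh_of] at ih
      rw [psh_of, List.map_cons, pr_of_cons, pr_of_cons, ih]; simp
  | neg l h => simp only [map_neg, h]
  | add a b ha hb => simp only [map_add, ha, hb]

/-- degenerate lists -/
def Dgl (l : List T) : Prop := ∃ a v b, l = a ++ v :: v :: b

def Dg (T : Type*) : AddSubgroup (Ch T) := AddSubgroup.closure (of '' {l | Dgl l})

lemma Dgl.cons {l : List T} (h : Dgl l) (v : T) : Dgl (v :: l) := by
  obtain ⟨a, w, b, rfl⟩ := h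
  exact ⟨v :: a, w, b, rfl⟩

lemma Dgl.map {l : List T} (h : Dgl l) (f : T → T') : Dgl (l.map f) := by
  obtain ⟨a, w, b, rfl⟩ := h
  exact ⟨a.map f, f w, b.map f, by simp⟩

lemma dgl_two (v : T) (s : List T) : Dgl (v :: v :: s) := ⟨[], v, s, rfl⟩

lemma dgl_cons_iff {v : T} {s : List T} :
    Dgl (v :: s) ↔ (∃ t, s = v :: t) ∨ Dgl s := by
  constructor
  · rintro ⟨a, w, b, h⟩
    cases a with
    | nil => simp at h; left; exact ⟨b, by rw [h.1]; exact h.2⟩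
    | cons x a => simp at h; right; exact ⟨a, w, b, h.2⟩
  · rintro (⟨t, rfl⟩ | h)
    · exact dgl_two v t
    · exact h.cons v

lemma of_mem_Dg {l : List T} (h : Dgl l) : of l ∈ Dg T := AddSubgroup.subset_closure ⟨l, h, rfl⟩

/-- supports -/
def Sup (P : List T → Prop) : AddSubgroup (Ch T) := AddSubgroup.closure (of '' {l | P l})

lemma of_mem_Sup {P : List T → Prop} {l : List T} (h : P l) : of l ∈ Sup P :=
  AddSubgroup.subset_closure ⟨l, h, rfl⟩

lemma Sup_map {A : Type*} [AddCommGroup A] {P : List T → Prop} (φ : Ch T →+ A) (B : AddSubgroup A)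
    (h : ∀ l, P l → φ (of l) ∈ B) {c : Ch T} (hc : c ∈ Sup P) : φ c ∈ B := by
  have : Sup P ≤ B.comap φ := by
    rw [Sup, AddSubgroup.closure_le]
    rintro _ ⟨l, hl, rfl⟩
    exact h l hl
  exact this hc

lemma Sup_congr {A : Type*} [AddCommGroup A] {P : List T → Prop} (φ ψ : Ch T →+ A)
    (h : ∀ l, P l → φ (of l) = ψ (of l)) {c : Ch T} (hc : c ∈ Sup P) : φ c = ψ c := by
  have := Sup_map (φ - ψ) ⊥ (fun l hl => by simp [h l hl]) hc
  simpa [sub_eq_zero] using this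

lemma Dg_map {A : Type*} [AddCommGroup A] (φ : Ch T →+ A) (B : AddSubgroup A)
    (h : ∀ l, Dgl l → φ (of l) ∈ B) {c : Ch T} (hc : c ∈ Dg T) : φ c ∈ B :=
  Sup_map (P := Dgl) φ B h hc

lemma cn_Dg (v : T) {c : Ch T} (hc : c ∈ Dg T) : cn v c ∈ Dg T :=
  Dg_map (cn v) _ (fun l hl => by simpa using of_mem_Dg (hl.cons v)) hc

lemma psh_Dg (f : T → T') {c : Ch T} (hc : c ∈ Dg T) : psh f c ∈ Dg T' :=
  Dg_map (psh f) _ (fun l hl => by simpa using of_mem_Dg (hl.map f)) hc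

lemma cn_cn_Dg (v : T) (c : Ch T) : cn v (cn v c) ∈ Dg T := by
  induction c using FreeAbelianGroup.induction_on with
  | zero => simp
  | of l => simpa using of_mem_Dg (dgl_two v l)
  | neg l h => simpa only [map_neg] using neg_mem h
  | add a b ha hb => simpa only [map_add] using add_mem ha hb

lemma pr_Dg (f g : T → T') {c : Ch T} (hc : c ∈ Dg T) : pr f g c ∈ Dg T' := by
  refine Dg_map (pr f g) _ (fun l hl => ?_) hc
  induction l with
  | nil => simp
  | cons v s ih =>
    rw [pr_of_cons]
    rcases dgl_cons_iff.1 hl with ⟨t, rfl⟩ | h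
    · rw [pr_of_cons, map_sub, cn_of]
      refine sub_mem (of_mem_Dg ?_) (sub_mem (of_mem_Dg ?_) (cn_cn_Dg _ _))
      · exact (dgl_two (g v) (t.map g)).cons _
      · exact dgl_two _ _
    · refine sub_mem (of_mem_Dg ?_) (cn_Dg _ (ih h))
      exact (by simpa using (hl.map g).cons (f v) : Dgl (f v :: g v :: s.map g))

lemma pr_eq_Dg (f g : T → T') (l : List T) (h : ∀ v ∈ l, f v = g v) : pr f g (of l) ∈ Dg T' := by
  induction l with
  | nil => simp
  | cons v s ih =>
    rw [pr_of_cons, h v (by simp)]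
    exact sub_mem (of_mem_Dg (dgl_two _ _)) (cn_Dg _ (ih fun w hw => h w (by simp [hw])))

/-- cylinder -/
def cyl (F : ℕ → T → T') (M : ℕ) : Ch T →+ Ch T' := ∑ j ∈ Finset.range M, pr (F j) (F (j + 1))

lemma cyl_apply (F : ℕ → T → T') (M : ℕ) (c : Ch T) :
    cyl F M c = ∑ j ∈ Finset.range M, pr (F j) (F (j + 1)) c := by
  simp [cyl]

lemma bd_cyl (F : ℕ → T → T') (M : ℕ) (c : Ch T) :
    bd (cyl F M c) = psh (F M) c - psh (F 0) c - cyl F M (bd c) := by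
  rw [cyl_apply, cyl_apply, map_sum]
  simp only [bd_pr]
  rw [Finset.sum_sub_distrib, Finset.sum_range_sub (fun j => psh (F j) c)]

lemma cyl_Dg (F : ℕ → T → T') (M : ℕ) {c : Ch T} (hc : c ∈ Dg T) : cyl F M c ∈ Dg T' := by
  rw [cyl_apply]
  exact sum_mem fun j _ => pr_Dg _ _ hc

lemma psh_cyl (F : ℕ → T → T') (M : ℕ) (h : T' → T'') (c : Ch T) :
    psh h (cyl F M c) = cyl (fun j => h ∘ F j) M c := by
  simp [cyl_apply, psh_pr]

lemma cyl_psh (h : T → T') (F : ℕ → T' → T'') (M : ℕ) (c : Ch T) :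
    cyl F M (psh h c) = cyl (fun j => F j ∘ h) M c := by
  simp [cyl_apply, pr_psh]

lemma pr_congr (f g f' g' : T → T') (l : List T) (h : ∀ v ∈ l, f v = f' v)
    (h' : ∀ v ∈ l, g v = g' v) : pr f g (of l) = pr f' g' (of l) := by
  induction l with
  | nil => simp
  | cons v s ih =>
    rw [pr_of_cons, pr_of_cons, h v (by simp), h' v (by simp),
      ih (fun w hw => h w (by simp [hw])) (fun w hw => h' w (by simp [hw])),
      List.map_congr_left (fun w hw => h' w (by simp [hw]))]

/-- good lists: vertices in `Q`, pairwise distance at most `ε`, length `d` -/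
def Gd [PseudoMetricSpace T] (Q : T → Prop) (ε : ℝ) (d : ℕ) (l : List T) : Prop :=
  l.length = d ∧ (∀ a ∈ l, Q a) ∧ ∀ a ∈ l, ∀ b ∈ l, dist a b ≤ ε

lemma psh_Gd [PseudoMetricSpace T] [PseudoMetricSpace T'] (f : T → T') {Q : T → Prop}
    {Q' : T' → Prop} {ε : ℝ} {d : ℕ} (hQ : ∀ a, Q a → Q' (f a))
    (hd : ∀ a b, Q a → Q b → dist (f a) (f b) ≤ dist a b) {c : Ch T} (hc : c ∈ Sup (Gd Q ε d)) :
    psh f c ∈ Sup (Gd Q' ε d) := by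
  refine Sup_map _ _ (fun l hl => ?_) hc
  rw [psh_of]
  refine of_mem_Sup ⟨by simpa using hl.1, ?_, ?_⟩
  · simp only [List.mem_map]; rintro _ ⟨a, ha, rfl⟩; exact hQ a (hl.2.1 a ha)
  · simp only [List.mem_map]; rintro _ ⟨a, ha, rfl⟩ _ ⟨b, hb, rfl⟩
    exact (hd a b (hl.2.1 a ha) (hl.2.1 b hb)).trans (hl.2.2 a ha b hb)

lemma pr_sup (f g : T → T') (l : List T) :
    pr f g (of l) ∈ Sup (fun m : List T' => m.length = l.length + 1 ∧
      ∀ x ∈ m, ∃ a ∈ l, x = f a ∨ x = g a) := by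
  induction l with
  | nil => simp
  | cons v s ih =>
    rw [pr_of_cons]
    refine sub_mem (of_mem_Sup ⟨by simp, ?_⟩) (Sup_map _ _ (fun m hm => ?_) ih)
    · intro x hx
      simp only [List.mem_cons, List.mem_map] at hx
      rcases hx with rfl | rfl | ⟨a, ha, rfl⟩
      · exact ⟨v, by simp, Or.inl rfl⟩
      · exact ⟨v, by simp, Or.inr rfl⟩
      · exact ⟨a, by simp [ha], Or.inr rfl⟩
    · rw [cn_of]
      refine of_mem_Sup ⟨by simp [hm.1], ?_⟩
      intro x hx
      rcases List.mem_cons.1 hx with rfl | hx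
      · exact ⟨v, by simp, Or.inl rfl⟩
      · obtain ⟨a, ha, h⟩ := hm.2 x hx
        exact ⟨a, by simp [ha], h⟩

lemma Sup_mono {P P' : List T → Prop} (h : ∀ l, P l → P' l) : Sup P ≤ Sup P' :=
  AddSubgroup.closure_mono (Set.image_mono h)

lemma pr_Gd [PseudoMetricSpace T] [PseudoMetricSpace T'] (f g : T → T') {Q : T → Prop}
    {Q' : T' → Prop} {ε η : ℝ} (hη : 0 ≤ η) {d : ℕ}
    (hQf : ∀ a, Q a → Q' (f a)) (hQg : ∀ a, Q a → Q' (g a))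
    (hf : ∀ a b, Q a → Q b → dist (f a) (f b) ≤ dist a b)
    (hg : ∀ a b, Q a → Q b → dist (g a) (g b) ≤ dist a b)
    (hfg : ∀ a, Q a → dist (f a) (g a) ≤ η)
    {c : Ch T} (hc : c ∈ Sup (Gd Q ε d)) : pr f g c ∈ Sup (Gd Q' (ε + η) (d + 1)) := by
  refine Sup_map _ _ (fun l hl => ?_) hc
  refine Sup_mono (fun m hm => ⟨by rw [hm.1, hl.1], ?_, ?_⟩) (pr_sup f g l)
  · intro x hx
    obtain ⟨a, ha, rfl | rfl⟩ := hm.2 x hx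
    exacts [hQf a (hl.2.1 a ha), hQg a (hl.2.1 a ha)]
  · intro x hx y hy
    obtain ⟨a, ha, hxa⟩ := hm.2 x hx
    obtain ⟨b, hb, hyb⟩ := hm.2 y hy
    have h1 := hf a b (hl.2.1 a ha) (hl.2.1 b hb)
    have h2 := hg a b (hl.2.1 a ha) (hl.2.1 b hb)
    have h3 := hfg a (hl.2.1 a ha)
    have h5 := hl.2.2 a ha b hb
    rcases hxa with rfl | rfl <;> rcases hyb with rfl | rfl
    · linarith
    · have := dist_triangle (f a) (g a) (g b); linarith
    · have := dist_triangle (g a) (f a) (f b); rw [dist_comm (g a) (f a)] at this; linarith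
    · linarith

lemma cyl_Gd [PseudoMetricSpace T] [PseudoMetricSpace T'] (F : ℕ → T → T') (M : ℕ) {Q : T → Prop}
    {Q' : T' → Prop} {ε η : ℝ} (hη : 0 ≤ η) {d : ℕ}
    (hQf : ∀ j ≤ M, ∀ a, Q a → Q' (F j a))
    (hf : ∀ j ≤ M, ∀ a b, Q a → Q b → dist (F j a) (F j b) ≤ dist a b)
    (hfg : ∀ j < M, ∀ a, Q a → dist (F j a) (F (j + 1) a) ≤ η)
    {c : Ch T} (hc : c ∈ Sup (Gd Q ε d)) : cyl F M c ∈ Sup (Gd Q' (ε + η) (d + 1)) := by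
  rw [cyl_apply]
  refine sum_mem fun j hj => ?_
  have hj' := Finset.mem_range.1 hj
  exact pr_Gd _ _ hη (hQf j hj'.le) (hQf (j + 1) hj') (hf j hj'.le) (hf (j + 1) hj') (hfg j hj') hc

/-! ### cochains -/

/-- evaluation of a cochain -/
def ev {A : Type*} [AddCommGroup A] (f : List T → A) : Ch T →+ A := lift f

section coch
variable {A : Type*} [AddCommGroup A]

@[simp] lemma ev_of (f : List T → A) (l : List T) : ev f (of l) = f l := by simp [ev]

def cob (f : List T → A) (l : List T) : A := ev f (bd (of l))

lemma ev_cob (f : List T → A) (c : Ch T) : ev (cob f) c = ev f (bd c) := by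
  induction c using FreeAbelianGroup.induction_on with
  | zero => simp
  | of l => simp [cob]
  | neg l h => simp only [map_neg, h]
  | add a b ha hb => simp only [map_add, ha, hb]

lemma cob_cob (f : List T → A) (l : List T) : cob (cob f) l = 0 := by
  rw [cob, ev_cob, bd_bd, map_zero]

lemma ev_cn (f : List T → A) (v : T) (c : Ch T) : ev f (cn v c) = ev (fun l => f (v :: l)) c := by
  induction c using FreeAbelianGroup.induction_on with
  | zero => simp
  | of l => simp
  | neg l h => simp only [map_neg, h]
  | add a b ha hb => simp only [map_add, ha, hb]

lemma ev_psh (f : List T' → A) (g : T → T') (c : Ch T) :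
    ev f (psh g c) = ev (fun l => f (l.map g)) c := by
  induction c using FreeAbelianGroup.induction_on with
  | zero => simp
  | of l => simp
  | neg l h => simp only [map_neg, h]
  | add a b ha hb => simp only [map_add, ha, hb]

@[simp] lemma cob_nil (f : List T → A) : cob f [] = 0 := by simp [cob]

lemma cob_cons (f : List T → A) (v : T) (s : List T) :
    cob f (v :: s) = f s - cob (fun l => f (v :: l)) s := by
  rw [cob, bd_of_cons, map_sub, ev_cn, ev_of, cob]

lemma ev_add (f g : List T → A) (c : Ch T) :
    ev (fun l => f l + g l) c = ev f c + ev g c := by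
  induction c using FreeAbelianGroup.induction_on with
  | zero => simp
  | of l => simp
  | neg l h => simp only [map_neg, h]; abel
  | add a b ha hb => simp only [map_add, ha, hb]; abel

lemma ev_hom {B : Type*} [AddCommGroup B] (φ : A →+ B) (f : List T → A) (c : Ch T) :
    ev (fun l => φ (f l)) c = φ (ev f c) := by
  induction c using FreeAbelianGroup.induction_on with
  | zero => simp
  | of l => simp
  | neg l h => simp only [map_neg, h]
  | add a b ha hb => simp only [map_add, ha, hb]

lemma cob_hom {B : Type*} [AddCommGroup B] (φ : A →+ B) (f : List T → A) (l : List T) :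
    cob (fun l => φ (f l)) l = φ (cob f l) := ev_hom φ f _

lemma ev_zero (c : Ch T) : ev (fun _ : List T => (0 : A)) c = 0 := by
  simpa using ev_hom (0 : A →+ A) (fun _ => 0) c

lemma ev_sub (f g : List T → A) (c : Ch T) :
    ev (fun l => f l - g l) c = ev f c - ev g c := by
  induction c using FreeAbelianGroup.induction_on with
  | zero => simp
  | of l => simp
  | neg l h => simp only [map_neg, h]; abel
  | add a b ha hb => simp only [map_add, ha, hb]; abel

lemma cob_sub (f g : List T → A) (l : List T) :
    cob (fun l => f l - g l) l = cob f l - cob g l := ev_sub f g _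

lemma ev_Dg (f : List T → A) (hf : ∀ l, Dgl l → f l = 0) {c : Ch T} (hc : c ∈ Dg T) :
    ev f c = 0 := by
  have := Dg_map (ev f) ⊥ (fun l hl => by simp [hf l hl]) hc
  simpa using this

lemma ev_congr_sup {P : List T → Prop} (f g : List T → A) (h : ∀ l, P l → f l = g l) {c : Ch T}
    (hc : c ∈ Sup P) : ev f c = ev g c :=
  Sup_congr _ _ (fun l hl => by simpa using h l hl) hc

/-- faces are sublists -/
lemma bd_sup (l : List T) :
    bd (of l) ∈ Sup (fun m : List T => m.length + 1 = l.length ∧ ∀ x ∈ m, x ∈ l) := by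
  induction l with
  | nil => simp
  | cons v s ih =>
    rw [bd_of_cons]
    refine sub_mem (of_mem_Sup ⟨by simp, fun x hx => by simp [hx]⟩) (Sup_map _ _ (fun m hm => ?_) ih)
    rw [cn_of]
    refine of_mem_Sup ⟨by simp [hm.1], fun x hx => ?_⟩
    rcases List.mem_cons.1 hx with rfl | hx
    · simp
    · simp [hm.2 x hx]

end coch
end chains

end LS


namespace LS
open FreeAbelianGroup

section cups
variable {T : Type*} {A : Type*} [CommRing A]

def cup0 (X : T → A) (G : List T → A) : List T → A
  | [] => 0
  | v :: s => X v * G (v :: s)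

def cup1 (y : T → T → A) (G : List T → A) : List T → A
  | v0 :: v1 :: s => y v0 v1 * G (v1 :: s)
  | _ => 0

def cup2 (y : T → T → T → A) (G : List T → A) : List T → A
  | v0 :: v1 :: v2 :: s => y v0 v1 v2 * G (v2 :: s)
  | _ => 0

lemma cob_mul_left (a : A) (G : List T → A) (l : List T) :
    cob (fun l => a * G l) l = a * cob G l :=
  cob_hom (AddMonoidHom.mulLeft a) G l

lemma cob_cup0 (X : T → A) (G : List T → A) (v0 v1 : T) (s : List T) :
    cob (cup0 X G) (v0 :: v1 :: s) = (X v1 - X v0) * G (v1 :: s) + X v0 * cob G (v0 :: v1 :: s) := by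
  rw [cob_cons, cob_cons G v0]
  have : (fun l => cup0 X G (v0 :: l)) = fun l => X v0 * G (v0 :: l) := rfl
  rw [this, cob_mul_left, cup0]; ring

lemma cob_cup1 (y : T → T → A) (G : List T → A) (v0 v1 v2 : T) (s : List T) :
    cob (cup1 y G) (v0 :: v1 :: v2 :: s) = (y v1 v2 - y v0 v2 + y v0 v1) * G (v2 :: s)
      - y v0 v1 * cob G (v1 :: v2 :: s) := by
  rw [cob_cons, cob_cons _ v1, cob_cons G v1]
  have : (fun l => cup1 y G (v0 :: v1 :: l)) = fun l => y v0 v1 * G (v1 :: l) := rfl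
  rw [this, cob_mul_left]; simp only [cup1]; ring

end cups

section absn
variable {T : Type*}

/-- good integral cochains -/
structure GoodC (g : T → T) (Sm : List T → Prop) (G : List T → ℤ) : Prop where
  nrm : ∀ l, Dgl l → G l = 0
  nil : G [] = 0
  coc : ∀ l, Sm l → cob G l = 0
  inv : ∀ l, Sm l → G (l.map g) = G l

lemma cup0_Dgl {A : Type*} [CommRing A] (X : T → A) (G : List T → A)
    (h : ∀ l, Dgl l → G l = 0) (l : List T) (hl : Dgl l) : cup0 X G l = 0 := by
  cases l with
  | nil => rfl
  | cons v s => rw [cup0, h _ hl, mul_zero]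

lemma cup1_Dgl {A : Type*} [CommRing A] (y : T → T → A) (hy : ∀ v, y v v = 0) (G : List T → A)
    (h : ∀ l, Dgl l → G l = 0) (l : List T) (hl : Dgl l) : cup1 y G l = 0 := by
  match l, hl with
  | [], _ => rfl
  | [v], _ => rfl
  | v0 :: v1 :: s, hl =>
    rw [cup1]
    rcases dgl_cons_iff.1 hl with ⟨t, ht⟩ | h'
    · simp at ht; rw [ht.1, hy, zero_mul]
    · rw [h _ h', mul_zero]

lemma cup2_Dgl {A : Type*} [CommRing A] (y : T → T → T → A) (hy : ∀ v w, y v v w = 0)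
    (hy' : ∀ v w, y v w w = 0) (G : List T → A)
    (h : ∀ l, Dgl l → G l = 0) (l : List T) (hl : Dgl l) : cup2 y G l = 0 := by
  match l, hl with
  | [], _ => rfl
  | [v], _ => rfl
  | [v, w], _ => rfl
  | v0 :: v1 :: v2 :: s, hl =>
    rw [cup2]
    rcases dgl_cons_iff.1 hl with ⟨t, ht⟩ | h'
    · simp at ht; rw [ht.1, hy, zero_mul]
    · rcases dgl_cons_iff.1 h' with ⟨t, ht⟩ | h''
      · simp at ht; rw [ht.1, hy', zero_mul]
      · rw [h _ h'', mul_zero]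

variable (g : T → T) (Sm : List T → Prop)
  (hsub : ∀ l m, Sm l → (∀ x ∈ m, x ∈ l) → Sm m) (hg : ∀ l, Sm l → Sm (l.map g))

include hsub in
lemma sm_bd {l : List T} (h : Sm l) : bd (of l) ∈ Sup Sm :=
  Sup_mono (fun m hm => hsub l m h hm.2) (bd_sup l)

include hsub hg in
/-- first descent -/
lemma descent1 {A : Type*} [CommRing A] (X : T → A) (G : List T → A)
    (hn : ∀ l, Dgl l → G l = 0) (hnil : G [] = 0) (hcoc : ∀ l, Sm l → cob G l = 0)
    (hinv : ∀ l, Sm l → G (l.map g) = G l) (hX : ∀ v, Sm [v] → X (g v) = X v + 1)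
    (y : T → T → A) (hy : ∀ v w, y v w = X w - X v)
    (z z' : Ch T) (hz : z ∈ Sup Sm) (hz' : z' ∈ Sup Sm) (σ : ℤ)
    (hb : bd z - σ • (psh g z' - z') ∈ Dg T) :
    ev (cup1 y G) z = σ • ev G z' := by
  have h1 : ev (cup1 y G) z = ev (cob (cup0 X G)) z := by
    refine ev_congr_sup _ _ (fun l hl => ?_) hz
    match l, hl with
    | [], _ => simp [cup1]
    | [v], _ => rw [cob_cons]; simp [cup1, cup0]
    | v0 :: v1 :: s, hl => rw [cob_cup0, hcoc _ hl, cup1, hy]; ring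
  rw [h1, ev_cob]
  have h2 := ev_Dg (cup0 X G) (cup0_Dgl X G hn) hb
  rw [map_sub, sub_eq_zero] at h2
  rw [h2, map_zsmul, map_sub, ev_psh, ← ev_sub]
  congr 1
  refine ev_congr_sup _ _ (fun l hl => ?_) hz'
  cases l with
  | nil => simp [cup0, hnil]
  | cons v s =>
    have h3 := hinv _ hl
    rw [List.map_cons] at h3 ⊢
    rw [cup0, cup0, h3, hX v (hsub _ _ hl (by simp))]; ring

include hsub hg in
lemma hinv_iter {A : Type*} (G : List T → A) (hinv : ∀ l, Sm l → G (l.map g) = G l) (m : ℕ)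
    (l : List T) (hl : Sm l) : G (l.map (g^[m])) = G l := by
  induction m generalizing l with
  | zero => simp
  | succ m ih =>
    have := ih (l.map g) (hg l hl)
    rw [List.map_map] at this
    rw [Function.iterate_succ, this, hinv l hl]

variable (p : ℕ)

/-- integral lift -/
def yh (lab : T → ZMod p) (typ : T → ℕ) (v w : T) : ℤ :=
  if typ v ≤ typ w then ((lab w - lab v).val : ℤ) else -((lab v - lab w).val : ℤ)

def yc (lab : T → ZMod p) (typ : T → ℕ) (u v w : T) : ℤ :=
  yh p lab typ v w - yh p lab typ u w + yh p lab typ u v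

def yy (lab : T → ZMod p) (typ : T → ℕ) (u v w : T) : ℤ := yc p lab typ u v w / p

variable {p} [NeZero p] (lab : T → ZMod p) (typ : T → ℕ)

lemma yh_cast (v w : T) : ((yh p lab typ v w : ℤ) : ZMod p) = lab w - lab v := by
  unfold yh; split_ifs <;> simp

lemma yh_self (v : T) : yh p lab typ v v = 0 := by simp [yh]

lemma yy_mul (u v w : T) : (p : ℤ) * yy p lab typ u v w = yc p lab typ u v w := by
  rw [yy, Int.mul_ediv_cancel']
  rw [← ZMod.intCast_zmod_eq_zero_iff_dvd]
  simp [yc, yh_cast]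

variable {g Sm}

include hsub hg in
/-- second descent -/
lemma descent2 (G : List T → ℤ) (hG : GoodC g Sm G)
    (hlab : ∀ v, Sm [v] → lab (g v) = lab v + 1) (htyp : ∀ v, Sm [v] → typ (g v) = typ v)
    (z z' z'' : Ch T) (hz : z ∈ Sup Sm) (hz' : z' ∈ Sup Sm) (hz'' : z'' ∈ Sup Sm) (σ : ℤ)
    (hb : bd z + σ • (∑ m ∈ Finset.range p, psh (g^[m]) z') ∈ Dg T)
    (hb' : bd z' - σ • (psh g z'' - z'') ∈ Dg T) :
    GoodC g Sm (cup2 (yy p lab typ) G) ∧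
    ((ev (cup2 (yy p lab typ) G) z : ℤ) : ZMod p) = - σ * σ * (ev G z'' : ℤ) := by
  have hp0 : (p : ℤ) ≠ 0 := by exact_mod_cast NeZero.ne p
  have yhg : ∀ l, Sm l → ∀ v ∈ l, ∀ w ∈ l, yh p lab typ (g v) (g w) = yh p lab typ v w := by
    intro l hl v hv w hw
    have h1 : Sm [v] := hsub l _ hl (by simpa using hv)
    have h2 : Sm [w] := hsub l _ hl (by simpa using hw)
    simp [yh, hlab v h1, hlab w h2, htyp v h1, htyp w h2]
  have key : ∀ l, Sm l → (p : ℤ) * cup2 (yy p lab typ) G l = cob (cup1 (yh p lab typ) G) l := by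
    intro l hl
    match l, hl with
    | [], _ => simp [cup2]
    | [v], _ => rw [cob_cons]; simp [cup2, cup1]
    | [v, w], _ => rw [cob_cons, cob_cons]; simp [cup2, cup1]
    | v0 :: v1 :: v2 :: s, hl =>
      rw [cob_cup1, hG.coc _ (hsub _ _ hl (by simp; tauto)), cup2, ← mul_assoc, yy_mul, yc]; ring
  have inv1 : ∀ l, Sm l → cup1 (yh p lab typ) G (l.map g) = cup1 (yh p lab typ) G l := by
    intro l hl
    match l, hl with
    | [], _ => simp [cup1]
    | [v], _ => simp [cup1]
    | v0 :: v1 :: s, hl =>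
      have := hG.inv (v1 :: s) (hsub _ _ hl (by simp; tauto))
      simp only [List.map_cons] at this
      simp only [List.map_cons, cup1, this, yhg _ hl v0 (by simp) v1 (by simp)]
  refine ⟨⟨?_, rfl, ?_, ?_⟩, ?_⟩
  · refine cup2_Dgl _ (fun v w => ?_) (fun v w => ?_) _ hG.nrm <;> simp [yy, yc, yh_self]
  · intro l hl
    have h1 : (p : ℤ) * cob (cup2 (yy p lab typ) G) l = 0 := by
      rw [← cob_mul_left, ← cob_cob (cup1 (yh p lab typ) G) l]
      exact ev_congr_sup _ _ key (sm_bd Sm hsub hl)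
    exact (mul_eq_zero.1 h1).resolve_left hp0
  · intro l hl
    match l, hl with
    | [], _ => simp [cup2]
    | [v], _ => simp [cup2]
    | [v, w], _ => simp [cup2]
    | v0 :: v1 :: v2 :: s, hl =>
      have := hG.inv (v2 :: s) (hsub _ _ hl (by simp; tauto))
      simp only [List.map_cons] at this
      simp only [List.map_cons, cup2, this, yy, yc, yhg _ hl v0 (by simp) v1 (by simp),
        yhg _ hl v1 (by simp) v2 (by simp), yhg _ hl v0 (by simp) v2 (by simp)]
  · have h1 : (p : ℤ) * ev (cup2 (yy p lab typ) G) z = ev (cup1 (yh p lab typ) G) (bd z) := by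
      rw [← ev_cob, ← ev_congr_sup _ _ key hz]
      exact (ev_hom (AddMonoidHom.mulLeft (p : ℤ)) _ _).symm
    have h2 := ev_Dg (cup1 (yh p lab typ) G) (cup1_Dgl _ (yh_self lab typ) G hG.nrm) hb
    rw [map_add, map_zsmul, map_sum] at h2
    have h3 : ∀ m, ev (cup1 (yh p lab typ) G) (psh (g^[m]) z') = ev (cup1 (yh p lab typ) G) z' := by
      intro m
      rw [ev_psh]
      exact ev_congr_sup _ _ (fun l hl => hinv_iter g Sm hsub hg _ inv1 m l hl) hz'
    simp only [h3, Finset.sum_const, Finset.card_range, smul_eq_mul, nsmul_eq_mul] at h2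
    have h4 : ev (cup2 (yy p lab typ) G) z = - σ * ev (cup1 (yh p lab typ) G) z' := by
      apply mul_left_cancel₀ hp0
      rw [h1]; linarith
    have h5 := descent1 g Sm hsub hg lab (fun l => ((G l : ℤ) : ZMod p))
      (fun l hl => by simp [hG.nrm l hl]) (by simp [hG.nil])
      (fun l hl => by
        have := cob_hom (Int.castAddHom (ZMod p)) G l
        simp only [Int.coe_castAddHom] at this
        rw [this, hG.coc l hl]; simp)
      (fun l hl => by simp [hG.inv l hl]) hlab (fun v w => lab w - lab v) (fun v w => rfl)
      z' z'' hz' hz'' σ hb'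
    have h6 : ((ev (cup1 (yh p lab typ) G) z' : ℤ) : ZMod p)
        = ev (cup1 (fun v w => lab w - lab v) (fun l => ((G l : ℤ) : ZMod p))) z' := by
      have h60 := ev_hom (Int.castAddHom (ZMod p)) (cup1 (yh p lab typ) G) z'
      simp only [Int.coe_castAddHom] at h60
      rw [← h60]
      congr 2
      funext l
      match l with
      | [] => simp [cup1]
      | [v] => simp [cup1]
      | v0 :: v1 :: s => simp [cup1, yh_cast]
    have h7 := ev_hom (Int.castAddHom (ZMod p)) G z''
    simp only [Int.coe_castAddHom] at h7
    rw [h4]; push_cast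
    rw [h6, h5, h7, zsmul_eq_mul]; ring

include hsub hg in
/-- The abstract contradiction. -/
theorem abs_contra (hp : 1 < p) (K : ℕ) (z : ℕ → Ch T) (hz : ∀ j ≤ 2 * K + 1, z j ∈ Sup Sm) (σ : ℤ)
    (hσ : σ * σ = 1)
    (hodd : ∀ i ≤ K, bd (z (2 * i + 1)) - σ • (psh g (z (2 * i)) - z (2 * i)) ∈ Dg T)
    (heven : ∀ i < K, bd (z (2 * i + 2)) + σ • (∑ m ∈ Finset.range p, psh (g^[m]) (z (2 * i + 1))) ∈ Dg T)
    (B0 : List T → ℤ) (hB : GoodC g Sm B0) (hB1 : ev B0 (z 0) = 1)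
    (lab : ℕ → T → ZMod p) (typ : ℕ → T → ℕ)
    (hlab : ∀ j ≤ K, ∀ v, Sm [v] → lab j (g v) = lab j v + 1)
    (htyp : ∀ j < K, ∀ v, Sm [v] → typ j (g v) = typ j v)
    (hcov : ∀ l, Sm l → (∀ a ∈ l, ∀ b ∈ l, lab K a = lab K b) ∨
      (∃ j < K, ∀ a ∈ l, ∀ b ∈ l, ∀ c ∈ l, yc p (lab j) (typ j) a b c = 0) ∨
      (∀ m, (∀ x ∈ m, x ∈ l) → B0 m = 0)) : False := by
  obtain ⟨B, hBz, hBs⟩ : ∃ B : ℕ → List T → ℤ, B 0 = B0 ∧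
      ∀ j, B (j + 1) = cup2 (yy p (lab j) (typ j)) (B j) :=
    ⟨fun j => Nat.rec B0 (fun j G => cup2 (yy p (lab j) (typ j)) G) j, rfl, fun j => rfl⟩
  have h1 : ∀ j ≤ K, GoodC g Sm (B j) ∧ ((ev (B j) (z (2 * j)) : ℤ) : ZMod p) = (-1) ^ j := by
    intro j
    induction j with
    | zero => intro _; rw [hBz]; refine ⟨hB, ?_⟩; simp [hB1]
    | succ j ih =>
      intro hj
      obtain ⟨i1, i2⟩ := ih (by omega)
      obtain ⟨j1, j2⟩ := descent2 hsub hg (lab j) (typ j) (B j) i1 (hlab j (by omega))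
        (htyp j (by omega)) (z (2 * j + 2)) (z (2 * j + 1)) (z (2 * j)) (hz _ (by omega))
        (hz _ (by omega)) (hz _ (by omega)) σ (heven j (by omega)) (hodd j (by omega))
      rw [hBs]
      refine ⟨j1, ?_⟩
      rw [show 2 * (j + 1) = 2 * j + 2 by ring, j2, i2]
      have : (σ : ZMod p) * σ = 1 := by exact_mod_cast congrArg (Int.cast : ℤ → ZMod p) hσ
      rw [neg_mul, this]; ring
  obtain ⟨g1, g2⟩ := h1 K le_rfl
  have h5 := descent1 (A := ZMod p) g Sm hsub hg (lab K) (fun l => ((B K l : ℤ) : ZMod p))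
      (fun l hl => by simp [g1.nrm l hl]) (by simp [g1.nil])
      (fun l hl => by
        have := cob_hom (Int.castAddHom (ZMod p)) (B K) l
        simp only [Int.coe_castAddHom] at this
        rw [this, g1.coc l hl]; simp)
      (fun l hl => by simp [g1.inv l hl]) (hlab K le_rfl) (fun v w => lab K w - lab K v)
      (fun v w => rfl) (z (2 * K + 1)) (z (2 * K)) (hz _ (by omega)) (hz _ (by omega)) σ
      (hodd K le_rfl)
  have h7 := ev_hom (Int.castAddHom (ZMod p)) (B K) (z (2 * K))
  simp only [Int.coe_castAddHom] at h7
  have hB0 : ∀ l : List T, (∀ m : List T, (∀ x ∈ m, x ∈ l) → B0 m = 0) → ∀ j, ∀ m : List T, (∀ x ∈ m, x ∈ l) → B j m = 0 := by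
    intro l hl j
    induction j with
    | zero => rw [hBz]; exact hl
    | succ j ih =>
      intro m hm
      rw [hBs]
      match m, hm with
      | [], _ => rfl
      | [v], _ => rfl
      | [v, w], _ => rfl
      | v0 :: v1 :: v2 :: s, hm =>
        rw [cup2, ih (v2 :: s) (fun x hx => hm x (by simp at hx ⊢; tauto)), mul_zero]
  have hBj : ∀ (l : List T) j, (∀ a ∈ l, ∀ b ∈ l, ∀ c ∈ l, yc p (lab j) (typ j) a b c = 0) →
      ∀ i, ∀ m : List T, (∀ x ∈ m, x ∈ l) → B (j + 1 + i) m = 0 := by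
    intro l j hl i
    induction i with
    | zero =>
      intro m hm
      rw [add_zero, hBs]
      match m, hm with
      | [], _ => rfl
      | [v], _ => rfl
      | [v, w], _ => rfl
      | v0 :: v1 :: v2 :: s, hm =>
        rw [cup2, yy, hl v0 (hm _ (by simp)) v1 (hm _ (by simp)) v2 (hm _ (by simp))]
        simp
    | succ i ih =>
      intro m hm
      rw [← add_assoc, hBs]
      match m, hm with
      | [], _ => rfl
      | [v], _ => rfl
      | [v, w], _ => rfl
      | v0 :: v1 :: v2 :: s, hm =>
        rw [cup2, ih (v2 :: s) (fun x hx => hm x (by simp at hx ⊢; tauto)), mul_zero]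
  have h8 : ev (cup1 (fun v w => lab K w - lab K v) (fun l => ((B K l : ℤ) : ZMod p)))
      (z (2 * K + 1)) = 0 := by
    rw [← ev_zero (z (2 * K + 1))]
    refine ev_congr_sup _ _ (fun l hl => ?_) (hz _ (by omega))
    match l, hl with
    | [], _ => rfl
    | [v], _ => rfl
    | v0 :: v1 :: s, hl =>
      rw [cup1]
      rcases hcov _ hl with h | ⟨j, hj, h⟩ | h
      · rw [h v0 (by simp) v1 (by simp)]; simp
      · have := hBj _ j h (K - (j + 1)) (v1 :: s) (by simp; tauto)
        rw [show j + 1 + (K - (j + 1)) = K by omega] at this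
        simp [this]
      · simp [hB0 _ h K (v1 :: s) (by simp; tauto)]
  rw [h8, h7, g2, zsmul_eq_mul] at h5
  have hs : (σ : ZMod p) * σ = 1 := by exact_mod_cast congrArg (Int.cast : ℤ → ZMod p) hσ
  have h9 : (1 : ZMod p) = 0 := by
    calc (1 : ZMod p) = ((σ : ZMod p) * σ) * ((-1) ^ K * (-1) ^ K) := by
            rw [hs, ← mul_pow]; simp
      _ = σ * (-1) ^ K * ((σ : ZMod p) * (-1) ^ K) := by ring
      _ = 0 := by rw [← h5]; simp
  haveI : Fact (1 < p) := ⟨hp⟩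
  exact one_ne_zero h9

end absn
end LS


namespace LS
open FreeAbelianGroup

section bet
variable {T T' : Type*}

/-- the sign cocycle -/
def bet (s : ℕ → T → ℤ) : ℕ → List T → ℤ
  | 0 => fun l => match l with
    | [v] => s 0 v
    | _ => 0
  | m + 1 => cup1 (fun v w => s (m + 1) w - s (m + 1) v) (bet s m)

lemma bet_nil (s : ℕ → T → ℤ) (m : ℕ) : bet s m [] = 0 := by
  cases m <;> rfl

lemma bet_Dgl (s : ℕ → T → ℤ) (m : ℕ) (l : List T) (hl : Dgl l) : bet s m l = 0 := by
  induction m generalizing l with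
  | zero =>
    obtain ⟨a, v, b, rfl⟩ := hl
    cases a with
    | nil => rfl
    | cons x a => cases a <;> rfl
  | succ m ih => exact cup1_Dgl _ (fun v => by simp) _ ih l hl

lemma bet_map (s : ℕ → T' → ℤ) (s' : ℕ → T → ℤ) (f : T → T') (m : ℕ) (l : List T)
    (h : ∀ i ≤ m, ∀ v ∈ l, s i (f v) = s' i v) : bet s m (l.map f) = bet s' m l := by
  induction m generalizing l with
  | zero =>
    match l, h with
    | [], _ => rfl
    | [v], h => exact h 0 le_rfl v (by simp)
    | v :: w :: t, _ => rfl
  | succ m ih =>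
    match l, h with
    | [], _ => rfl
    | [v], h => rfl
    | v :: w :: t, h =>
      have := ih (w :: t) (fun i hi v hv => h i (by omega) v (by simp at hv ⊢; tauto))
      simp only [List.map_cons] at this ⊢
      simp only [bet, cup1, this]
      rw [h (m + 1) le_rfl v (by simp), h (m + 1) le_rfl w (by simp)]

lemma bet_cob (s : ℕ → T → ℤ) (n : ℕ) (l : List T) (h : cob (bet s n) l ≠ 0) :
    ∀ m ≤ n, ∃ a ∈ l, ∃ b ∈ l, s m a ≠ s m b := by
  induction n generalizing l with
  | zero =>
    intro m hm
    obtain rfl : m = 0 := by omega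
    match l, h with
    | [], h => simp at h
    | [v], h => rw [cob_cons] at h; simp [bet] at h
    | [v, w], h =>
      rw [cob_cons, cob_cons] at h
      simp only [bet, cob_nil, sub_zero, ne_eq, sub_eq_zero] at h
      exact ⟨w, by simp, v, by simp, h⟩
    | v0 :: v1 :: v2 :: t, h =>
      exfalso; apply h
      rw [cob_cons, cob_cons]
      have : (fun l => bet s 0 (v0 :: v1 :: l)) = fun _ => 0 := rfl
      rw [this, cob, ev_zero]
      cases t <;> simp [bet]
  | succ n ih =>
    match l, h with
    | [], h => simp at h
    | [v], h => rw [cob_cons] at h; simp [bet, cup1] at h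
    | [v, w], h => rw [cob_cons, cob_cons] at h; simp [bet, cup1] at h
    | v0 :: v1 :: v2 :: t, h =>
      rw [bet, cob_cup1] at h
      have h' : (s (n + 1) v1 - s (n + 1) v0) * cob (bet s n) (v1 :: v2 :: t) ≠ 0 := by
        intro h0; apply h; rw [h0]; ring
      intro m hm
      rcases Nat.lt_or_ge n m with hm' | hm'
      · obtain rfl : m = n + 1 := by omega
        exact ⟨v1, by simp, v0, by simp, fun h0 => h' (by rw [h0]; ring)⟩
      · obtain ⟨a, ha, b, hb, hab⟩ := ih _ (right_ne_zero_of_mul h') m hm'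
        exact ⟨a, List.mem_cons_of_mem _ ha, b, List.mem_cons_of_mem _ hb, hab⟩

lemma pr_head (f g : T → T') (l : List T) :
    pr f g (of l) ∈ Sup (fun m : List T' => ∃ a ∈ l, ∃ t, m = f a :: t) := by
  cases l with
  | nil => simp
  | cons v s =>
    rw [pr_of_cons]
    refine sub_mem (of_mem_Sup ⟨v, by simp, _, rfl⟩) ?_
    have h0 : pr f g (of s) ∈ Sup (fun _ => True) := Sup_mono (fun _ _ => trivial) (pr_sup f g s)
    refine Sup_map (cn (f v)) _ (fun m _ => ?_) h0
    rw [cn_of]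
    exact of_mem_Sup ⟨v, by simp, m, rfl⟩

lemma ev_bet_pr (s : ℕ → T' → ℤ) (f g : T → T') (m : ℕ) (l : List T) (α α' : ℤ)
    (hf : ∀ a ∈ l, s (m + 1) (f a) = α) (hg : ∀ a ∈ l, s (m + 1) (g a) = α') :
    ev (bet s (m + 1)) (pr f g (of l)) = (α' - α) * bet s m (l.map g) := by
  cases l with
  | nil => simp [bet_nil]
  | cons v t =>
    rw [pr_of_cons, map_sub, ev_of, ev_cn]
    have h0 : ev (fun l => bet s (m + 1) (f v :: l)) (pr f g (of t)) = 0 := by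
      rw [← ev_zero (pr f g (of t))]
      refine ev_congr_sup _ _ (fun l hl => ?_) (pr_head f g t)
      obtain ⟨a, ha, t', rfl⟩ := hl
      rw [bet, cup1, hf v (by simp), hf a (by simp [ha])]; ring
    rw [h0, bet, cup1, hf v (by simp), hg v (by simp)]; simp

end bet

section cells
variable {k : ℕ}

/-- ℓ¹-sphere vectors with support in coordinates `< i` -/
def VA (i : ℕ) (z : Fin k → ℂ) : Prop := (∑ j, ‖z j‖ = 1) ∧ ∀ j, i ≤ j.val → z j = 0

def cone (i : ℕ) (w : ℂ) (t : ℝ) (z : Fin k → ℂ) : Fin k → ℂ :=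
  fun j => (1 - t) * z j + if j.val = i then t * w else 0

noncomputable def rot (i : ℕ) (a : ℝ) (z : Fin k → ℂ) : Fin k → ℂ :=
  fun j => if j.val = i then Complex.exp (a * Complex.I) * z j else z j

noncomputable def gA (θ : ℕ → ℝ) (z : Fin k → ℂ) : Fin k → ℂ :=
  fun j => Complex.exp (θ j * Complex.I) * z j

lemma VA.mono {i i' : ℕ} (h : i ≤ i') {z : Fin k → ℂ} (hz : VA i z) : VA i' z :=
  ⟨hz.1, fun j hj => hz.2 j (h.trans hj)⟩

lemma VA.le {i : ℕ} {z : Fin k → ℂ} (hz : VA i z) (j : Fin k) : ‖z j‖ ≤ 1 := by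
  rw [← hz.1]
  exact Finset.single_le_sum (f := fun j => ‖z j‖) (fun j _ => norm_nonneg _) (Finset.mem_univ j)

lemma gA_VA {θ : ℕ → ℝ} {i : ℕ} {z : Fin k → ℂ} (hz : VA i z) : VA i (gA θ z) := by
  refine ⟨?_, fun j hj => by simp [gA, hz.2 j hj]⟩
  rw [← hz.1]
  refine Finset.sum_congr rfl fun j _ => ?_
  simp [gA, Complex.norm_exp_ofReal_mul_I]

lemma gA_dist (θ : ℕ → ℝ) (z w : Fin k → ℂ) : dist (gA θ z) (gA θ w) ≤ dist z w := by
  refine (dist_pi_le_iff dist_nonneg).2 fun j => ?_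
  have := dist_le_pi_dist z w j
  rw [dist_eq_norm] at this ⊢
  simpa [gA, ← mul_sub, Complex.norm_exp_ofReal_mul_I] using this

lemma rot_VA {a : ℝ} {i i' : ℕ} {z : Fin k → ℂ} (hz : VA i z) : VA i (rot i' a z) := by
  refine ⟨?_, fun j hj => by simp [rot, hz.2 j hj]⟩
  rw [← hz.1]
  refine Finset.sum_congr rfl fun j _ => ?_
  unfold rot; split_ifs <;> simp [Complex.norm_exp_ofReal_mul_I]

lemma rot_dist (i : ℕ) (a : ℝ) (z w : Fin k → ℂ) : dist (rot i a z) (rot i a w) ≤ dist z w := by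
  refine (dist_pi_le_iff dist_nonneg).2 fun j => ?_
  have := dist_le_pi_dist z w j
  rw [dist_eq_norm] at this ⊢
  unfold rot
  split_ifs
  · simpa [← mul_sub, Complex.norm_exp_ofReal_mul_I] using this
  · exact this

lemma rot_dist2 (i i' : ℕ) (a b : ℝ) (z : Fin k → ℂ) (hz : VA i' z) :
    dist (rot i a z) (rot i b z) ≤ |a - b| := by
  refine (dist_pi_le_iff (abs_nonneg _)).2 fun j => ?_
  rw [dist_eq_norm]
  unfold rot
  split_ifs
  · rw [← sub_mul, norm_mul]
    have h1 : ‖Complex.exp (a * Complex.I) - Complex.exp (b * Complex.I)‖ ≤ |a - b| := by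
      have : Complex.exp (a * Complex.I) - Complex.exp (b * Complex.I)
          = Complex.exp (b * Complex.I) * (Complex.exp (Complex.I * ((a - b : ℝ) : ℂ)) - 1) := by
        rw [mul_sub, ← Complex.exp_add]; congr 2
        · push_cast; ring
        · ring
      rw [this, norm_mul, Complex.norm_exp_ofReal_mul_I, one_mul]
      exact Real.norm_exp_I_mul_ofReal_sub_one_le
    calc _ ≤ |a - b| * 1 := mul_le_mul h1 (hz.le j) (norm_nonneg _) (abs_nonneg _)
      _ = _ := mul_one _
  · simp

lemma cone_VA {i : ℕ} (hi : i < k) {t : ℝ} (h0 : 0 ≤ t) (h1 : t ≤ 1) {z : Fin k → ℂ} (hz : VA i z) :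
    VA (i + 1) (cone i 1 t z) := by
  refine ⟨?_, fun j hj => ?_⟩
  · have : ∀ j : Fin k, ‖cone i 1 t z j‖ = (1 - t) * ‖z j‖ + if j = ⟨i, hi⟩ then t else 0 := by
      intro j
      unfold cone
      by_cases h : j.val = i
      · rw [hz.2 j h.ge, if_pos h, if_pos (Fin.ext h)]; simp [abs_of_nonneg h0]
      · rw [if_neg h, if_neg (fun h' => h (by rw [h']))]
        rw [add_zero, add_zero, norm_mul]
        congr 1
        rw [← Complex.ofReal_one, ← Complex.ofReal_sub, Complex.norm_real, Real.norm_eq_abs,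
          abs_of_nonneg (by linarith)]
    simp only [this, Finset.sum_add_distrib, ← Finset.mul_sum, hz.1]
    simp
  · unfold cone
    rw [hz.2 j (by omega), if_neg (by omega)]; simp

lemma cone_dist (i : ℕ) (w : ℂ) {t : ℝ} (h0 : 0 ≤ t) (h1 : t ≤ 1) (x y : Fin k → ℂ) :
    dist (cone i w t x) (cone i w t y) ≤ dist x y := by
  refine (dist_pi_le_iff dist_nonneg).2 fun j => ?_
  have := dist_le_pi_dist x y j
  rw [dist_eq_norm] at this ⊢
  unfold cone
  rw [add_sub_add_right_eq_sub, ← mul_sub, norm_mul, ← Complex.ofReal_one, ← Complex.ofReal_sub,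
    Complex.norm_real, Real.norm_eq_abs, abs_of_nonneg (by linarith)]
  refine le_trans ?_ this
  exact mul_le_of_le_one_left (norm_nonneg _) (by linarith)

lemma cone_dist2 (i i' : ℕ) (a b : ℝ) (z : Fin k → ℂ) (hz : VA i' z) :
    dist (cone i 1 a z) (cone i 1 b z) ≤ |a - b| * 2 := by
  refine (dist_pi_le_iff (by positivity)).2 fun j => ?_
  rw [dist_eq_norm]
  unfold cone
  have : (1 - (a : ℂ)) * z j + (if j.val = i then (a : ℂ) * 1 else 0)
      - ((1 - b) * z j + if j.val = i then (b : ℂ) * 1 else 0)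
      = ((a - b : ℝ) : ℂ) * ((if j.val = i then 1 else 0) - z j) := by
    split_ifs <;> push_cast <;> ring
  rw [this, norm_mul, Complex.norm_real, Real.norm_eq_abs]
  refine mul_le_mul_of_nonneg_left ?_ (abs_nonneg _)
  refine (norm_sub_le _ _).trans ?_
  have := hz.le j
  split_ifs <;> simp <;> linarith

/-- norm operator -/
def Nm {T : Type*} (g : T → T) (p : ℕ) (c : Ch T) : Ch T := ∑ m ∈ Finset.range p, psh (g^[m]) c

lemma psh_Nm {T : Type*} (g : T → T) (p : ℕ) (hg : g^[p] = id) (c : Ch T) :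
    psh g (Nm g p c) = Nm g p c := by
  unfold Nm
  rw [map_sum]
  have : ∀ m, psh g (psh (g^[m]) c) = psh (g^[m + 1]) c := fun m => by
    rw [psh_psh, Function.iterate_succ']
  simp only [this]
  have h1 := Finset.sum_range_succ (fun m => psh (g^[m]) c) p
  have h2 := Finset.sum_range_succ' (fun m => psh (g^[m]) c) p
  rw [h1] at h2
  simp only [hg, Function.iterate_zero] at h2
  exact (add_right_cancel h2).symm

lemma Nm_sub {T : Type*} (g : T → T) (p : ℕ) (hg : g^[p] = id) (c : Ch T) :
    Nm g p (psh g c - c) = 0 := by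
  have h : Nm g p (psh g c) = psh g (Nm g p c) := by
    unfold Nm
    rw [map_sum]
    refine Finset.sum_congr rfl fun m _ => ?_
    rw [psh_psh, psh_psh, ← Function.iterate_succ, ← Function.iterate_succ']
  have h2 : Nm g p (psh g c - c) = Nm g p (psh g c) - Nm g p c := by
    unfold Nm; simp [Finset.sum_sub_distrib]
  rw [h2, h, psh_Nm g p hg, sub_self]

lemma Nm_Dg {T : Type*} (g : T → T) (p : ℕ) {c : Ch T} (h : c ∈ Dg T) : Nm g p c ∈ Dg T :=
  sum_mem fun _ _ => psh_Dg _ h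

lemma Nm_sub' {T : Type*} (g : T → T) (p : ℕ) (c d : Ch T) :
    Nm g p (c - d) = Nm g p c - Nm g p d := by
  unfold Nm; simp [Finset.sum_sub_distrib]

lemma Nm_Gd {T : Type*} [PseudoMetricSpace T] (g : T → T) (p : ℕ) {Q : T → Prop} {ε : ℝ} {d : ℕ}
    (hQ : ∀ a, Q a → Q (g a)) (hd : ∀ a b, dist (g a) (g b) ≤ dist a b) {c : Ch T}
    (hc : c ∈ Sup (Gd Q ε d)) : Nm g p c ∈ Sup (Gd Q ε d) := by
  refine sum_mem fun m hm => ?_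
  clear hm
  induction m with
  | zero => simpa [psh_id] using hc
  | succ m ih =>
    rw [Function.iterate_succ', ← psh_psh]
    exact psh_Gd _ hQ (fun a b _ _ => hd a b) ih

lemma bd_Nm {T : Type*} (g : T → T) (p : ℕ) (c : Ch T) : bd (Nm g p c) = Nm g p (bd c) := by
  unfold Nm; rw [map_sum]; simp only [bd_psh]

/-- even cells -/
noncomputable def ee (k : ℕ) (θ : ℕ → ℝ) (p M : ℕ) : ℕ → Ch (Fin k → ℂ)
  | 0 => of [fun j => if j.val = 0 then 1 else 0]
  | i + 1 => cyl (fun j => cone (i + 1) 1 (j / M)) M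
      (Nm (gA θ) p (cyl (fun j => rot i (j / M * θ i)) M (ee k θ p M i)))

noncomputable def eo (k : ℕ) (θ : ℕ → ℝ) (p M : ℕ) (i : ℕ) : Ch (Fin k → ℂ) :=
  cyl (fun j => rot i (j / M * θ i)) M (ee k θ p M i)

lemma ee_succ (θ : ℕ → ℝ) (p M i : ℕ) : ee k θ p M (i + 1) =
    cyl (fun j => cone (i + 1) 1 (j / M)) M (Nm (gA θ) p (eo k θ p M i)) := rfl

lemma ee_Gd (θ : ℕ → ℝ) (p M : ℕ) (hM : 0 < M) (η : ℝ) (hη : ∀ i < k, |θ i| / M ≤ η) (hη2 : 2 / M ≤ η)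
    (i : ℕ) (hi : i < k) :
    ee k θ p M i ∈ Sup (Gd (VA (i + 1)) (2 * i * η) (2 * i + 1)) ∧
    eo k θ p M i ∈ Sup (Gd (VA (i + 1)) ((2 * i + 1) * η) (2 * i + 2)) := by
  have hM' : (0 : ℝ) < M := by exact_mod_cast hM
  have hη0 : 0 ≤ η := le_trans (by positivity) hη2
  have ho : ∀ i < k, ee k θ p M i ∈ Sup (Gd (VA (i + 1)) (2 * i * η) (2 * i + 1)) →
      eo k θ p M i ∈ Sup (Gd (VA (i + 1)) ((2 * i + 1) * η) (2 * i + 2)) := by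
    intro i hi h
    have := cyl_Gd (fun j => rot i (j / M * θ i)) M (Q' := VA (i + 1)) hη0
      (fun j _ a ha => rot_VA ha) (fun j _ a b _ _ => rot_dist _ _ _ _)
      (fun j _ a ha => (rot_dist2 i (i + 1) _ _ a ha).trans (le_trans (le_of_eq ?_) (hη i hi))) h
    · rwa [show (2 * i * η + η : ℝ) = (2 * i + 1) * η by ring] at this
    · push_cast
      rw [show (j / M * θ i - (j + 1) / M * θ i : ℝ) = - (θ i / M) by ring, abs_neg, abs_div,
        abs_of_pos hM']
  induction i with
  | zero =>
    have h0 : ee k θ p M 0 ∈ Sup (Gd (VA (0 + 1)) (2 * (0 : ℕ) * η) (2 * 0 + 1)) := by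
      refine of_mem_Sup ⟨rfl, ?_, ?_⟩
      · simp only [List.mem_singleton, forall_eq]
        refine ⟨?_, fun j hj => if_neg (by omega)⟩
        rw [Finset.sum_eq_single ⟨0, hi⟩]
        · simp
        · intro b _ hb
          have : ¬ (b.val = 0) := fun h => hb (Fin.ext h)
          simp [this]
        · simp
      · simp
    exact ⟨h0, ho 0 hi h0⟩
  | succ i ih =>
    obtain ⟨h1, h2⟩ := ih (by omega)
    have h3 := Nm_Gd (gA θ) p (fun a ha => gA_VA ha) (gA_dist θ) h2
    have h4 := cyl_Gd (fun j => cone (i + 1) 1 (j / M)) M (Q' := VA (i + 1 + 1)) hη0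
      (fun j hj a ha => cone_VA hi (by positivity)
        ((div_le_one hM').2 (by exact_mod_cast hj)) ha)
      (fun j hj a b _ _ => cone_dist _ _ (by positivity)
        ((div_le_one hM').2 (by exact_mod_cast hj)) _ _)
      (fun j _ a ha => (cone_dist2 (i + 1) (i + 1) _ _ a ha).trans (le_trans (le_of_eq ?_) hη2)) h3
    · rw [show ((2 * i + 1) * η + η : ℝ) = 2 * (i + 1 : ℕ) * η by push_cast; ring] at h4
      exact ⟨h4, ho _ hi h4⟩
    · push_cast
      rw [show (j / M - (j + 1) / M : ℝ) = - (1 / M) by ring, abs_neg, abs_of_pos (by positivity)]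
      ring

lemma rot_zero (i : ℕ) : (rot i 0 : (Fin k → ℂ) → _) = id := by
  funext z j; simp [rot]

lemma rot_VA_self {i : ℕ} (a : ℝ) {z : Fin k → ℂ} (hz : VA i z) : rot i a z = z := by
  funext j; unfold rot; split_ifs with h
  · rw [hz.2 j h.ge]; simp
  · rfl

lemma gA_iter (θ : ℕ → ℝ) (p : ℕ) (hθ : ∀ j, Complex.exp (θ j * Complex.I) ^ p = 1) :
    (gA θ : (Fin k → ℂ) → _)^[p] = id := by
  have : ∀ m (z : Fin k → ℂ) j, (gA θ)^[m] z j = Complex.exp (θ j * Complex.I) ^ m * z j := by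
    intro m
    induction m with
    | zero => simp
    | succ m ih => intro z j; rw [Function.iterate_succ_apply', gA, ih]; ring
  funext z j; rw [this, hθ]; simp

lemma ee_rel (θ : ℕ → ℝ) (p M : ℕ) (hM : 0 < M)
    (hθ : ∀ j, Complex.exp (θ j * Complex.I) ^ p = 1) (i : ℕ) (hi : i < k) :
    bd (eo k θ p M i) - (psh (gA θ) (ee k θ p M i) - ee k θ p M i) ∈ Dg _ ∧
    (i + 1 < k → bd (ee k θ p M (i + 1)) + Nm (gA θ) p (eo k θ p M i) ∈ Dg _) := by
  have hM' : (0 : ℝ) < M := by exact_mod_cast hM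
  obtain ⟨η, hη, hη2⟩ : ∃ η : ℝ, (∀ i < k, |θ i| / M ≤ η) ∧ 2 / M ≤ η := by
    refine ⟨2 / M + ∑ i ∈ Finset.range k, |θ i| / M, fun i hi => ?_, ?_⟩
    · have := Finset.single_le_sum (f := fun i => |θ i| / M) (fun i _ => by positivity)
        (Finset.mem_range.2 hi)
      have h2 : 0 ≤ 2 / (M : ℝ) := by positivity
      linarith
    · have : 0 ≤ ∑ i ∈ Finset.range k, |θ i| / (M : ℝ) := by positivity
      linarith
  have hG := ee_Gd (k := k) θ p M hM η hη hη2
  have hit := gA_iter (k := k) θ p hθ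
  -- second relation from first
  have h2 : ∀ i, i + 1 < k →
      bd (eo k θ p M i) - (psh (gA θ) (ee k θ p M i) - ee k θ p M i) ∈ Dg _ →
      bd (ee k θ p M (i + 1)) + Nm (gA θ) p (eo k θ p M i) ∈ Dg _ := by
    intro i hi h
    have h3 := Nm_Gd (gA θ) p (fun a ha => gA_VA ha) (gA_dist θ) (hG i (by omega)).2
    rw [ee_succ, bd_cyl, bd_Nm]
    have h4 : Nm (gA θ) p (bd (eo k θ p M i)) ∈ Dg _ := by
      have := Nm_Dg (gA θ) p h
      rwa [Nm_sub', Nm_sub _ _ hit, sub_zero] at this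
    have h5 : psh (cone (i + 1) 1 ((M : ℕ) / M)) (Nm (gA θ) p (eo k θ p M i)) ∈ Dg (Fin k → ℂ) := by
      refine Sup_map _ _ (fun l hl => ?_) h3
      rw [psh_of]
      refine of_mem_Dg ?_
      match l, hl with
      | [], hl => exact absurd hl.1 (by simp)
      | [v], hl => exact absurd hl.1 (by simp)
      | v :: w :: t, hl =>
        have : cone (i + 1) 1 ((M : ℕ) / M) v = cone (i + 1) 1 ((M : ℕ) / M) w := by
          funext j; simp [cone, hM'.ne']
        rw [List.map_cons, List.map_cons, this]
        exact dgl_two _ _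
    have h6 : psh (cone (i + 1) 1 ((0 : ℕ) / M)) (Nm (gA θ) p (eo k θ p M i))
        = Nm (gA θ) p (eo k θ p M i) := by
      have : (cone (i + 1) 1 ((0 : ℕ) / M) : (Fin k → ℂ) → _) = id := by
        funext z j; simp [cone]
      rw [this, psh_id]
    rw [h6]
    have := sub_mem h5 (cyl_Dg (fun j => cone (i + 1) 1 (j / M)) M h4)
    convert this using 1
    abel
  -- first relation given cylinder of boundary degenerate and psh equality
  have h1 : ∀ i, cyl (fun j => rot i (j / M * θ i)) M (bd (ee k θ p M i)) ∈ Dg (Fin k → ℂ) →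
      psh (rot i (θ i)) (ee k θ p M i) = psh (gA θ) (ee k θ p M i) →
      bd (eo k θ p M i) - (psh (gA θ) (ee k θ p M i) - ee k θ p M i) ∈ Dg _ := by
    intro i ha hb
    rw [eo, bd_cyl]
    have e1 : ((M : ℕ) : ℝ) / M * θ i = θ i := by rw [div_self hM'.ne', one_mul]
    have e2 : ((0 : ℕ) : ℝ) / M * θ i = 0 := by simp
    rw [e1, e2, hb, rot_zero, psh_id]
    have := neg_mem ha
    convert this using 1
    abel
  suffices h : ∀ i < k, bd (eo k θ p M i) - (psh (gA θ) (ee k θ p M i) - ee k θ p M i) ∈ Dg _ from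
    ⟨h i hi, fun h' => h2 i h' (h i hi)⟩
  intro i hi
  induction i with
  | zero =>
    refine h1 0 ?_ ?_
    · rw [ee, bd_of_cons]; simp [cyl_apply]
    · rw [ee, psh_of, psh_of]
      congr 1
      rw [List.map_singleton, List.map_singleton, List.cons.injEq]
      refine ⟨?_, rfl⟩
      funext j
      simp only [rot, gA]
      split_ifs with h
      · rw [h]
      · simp
  | succ i ih =>
    have hr := h2 i hi (ih (by omega))
    have h3 := Nm_Gd (gA θ) p (fun a ha => gA_VA ha) (gA_dist θ) (hG i (by omega)).2
    refine h1 (i + 1) ?_ ?_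
    · have h4 : cyl (fun j => rot (i + 1) (j / M * θ (i + 1))) M (Nm (gA θ) p (eo k θ p M i))
          ∈ Dg (Fin k → ℂ) := by
        rw [cyl_apply]
        refine sum_mem fun j _ => Sup_map _ _ (fun l hl => pr_eq_Dg _ _ _ fun v hv => ?_) h3
        rw [rot_VA_self _ (hl.2.1 v hv), rot_VA_self _ (hl.2.1 v hv)]
      have h5 := cyl_Dg (fun j => rot (i + 1) (j / M * θ (i + 1))) M hr
      rw [map_add] at h5
      have := sub_mem h5 h4
      rwa [add_sub_cancel_right] at this
    · rw [ee_succ, psh_cyl, psh_cyl]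
      have e1 : cyl (fun j => gA θ ∘ cone (i + 1) 1 (j / M)) M (Nm (gA θ) p (eo k θ p M i))
          = cyl (fun j => cone (i + 1) (Complex.exp (θ (i + 1 : ℕ) * Complex.I)) (j / M)) M
            (Nm (gA θ) p (eo k θ p M i)) := by
        conv_rhs => rw [← psh_Nm _ _ hit, cyl_psh]
        congr 2
        funext j z l
        simp only [Function.comp, gA, cone]
        split_ifs with h
        · rw [h]; ring
        · ring
      rw [e1, cyl_apply, cyl_apply]
      refine Finset.sum_congr rfl fun j _ => Sup_congr _ _ (fun l hl => ?_) h3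
      have : ∀ t : ℝ, ∀ v ∈ l, (rot (i + 1) (θ (i + 1)) ∘ cone (i + 1) 1 t) v
          = cone (i + 1) (Complex.exp (θ (i + 1 : ℕ) * Complex.I)) t v := by
        intro t v hv
        funext j
        simp only [Function.comp, rot, cone]
        split_ifs with h
        · rw [(hl.2.1 v hv).2 j h.ge]; ring
        · rfl
      exact pr_congr _ _ _ _ _ (this _) (this _)

end cells
end LS


namespace LS
open FreeAbelianGroup

section susp
variable {A : Type*} {r : ℕ}

def VB (i : ℕ) (y : Fin r → ℝ) : Prop := (∑ j, |y j| = 1) ∧ ∀ j, i ≤ j.val → y j = 0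

lemma VB.le {i : ℕ} {y : Fin r → ℝ} (hz : VB i y) (j : Fin r) : |y j| ≤ 1 := by
  rw [← hz.1]
  exact Finset.single_le_sum (f := fun j => |y j|) (fun j _ => abs_nonneg _) (Finset.mem_univ j)

/-- suspension map -/
def sus (m : ℕ) (t : ℝ) (v : A × (Fin r → ℝ)) : A × (Fin r → ℝ) :=
  (v.1, fun i => (1 - |t|) * v.2 i + if i.val = m then t else 0)

def pt (a : ℝ) (x : A) : A × (Fin r → ℝ) := (x, fun i => if i.val = 0 then a else 0)

noncomputable def J (M : ℕ) : ℕ → (Ch A →+ Ch (A × (Fin r → ℝ)))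
  | 0 => psh (pt 1) - psh (pt (-1))
  | m + 1 => (cyl (fun j => sus (m + 1) (-1 + j / M)) (2 * M)).comp (J M m)

lemma J_zero (M : ℕ) (c : Ch A) : J (r := r) M 0 c = psh (pt 1) c - psh (pt (-1)) c := rfl

lemma J_succ (M m : ℕ) (c : Ch A) : J (r := r) M (m + 1) c =
    cyl (fun j => sus (m + 1) (-1 + j / M)) (2 * M) (J M m c) := rfl

lemma pr_self_Dg {T T' : Type*} (f : T → T') (c : Ch T) : pr f f c ∈ Dg T' := by
  have h0 : c ∈ Sup (fun _ : List T => True) := by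
    induction c using FreeAbelianGroup.induction_on with
    | zero => simp
    | of l => exact of_mem_Sup trivial
    | neg l h => exact neg_mem h
    | add a b ha hb => exact add_mem ha hb
  exact Sup_map _ _ (fun l _ => pr_eq_Dg _ _ _ fun _ _ => rfl) h0

lemma J_Dg (M m : ℕ) {c : Ch A} (h : c ∈ Dg A) : J (r := r) M m c ∈ Dg _ := by
  induction m with
  | zero => exact sub_mem (psh_Dg _ h) (psh_Dg _ h)
  | succ m ih => rw [J_succ]; exact cyl_Dg _ _ ih

lemma J_psh (M m : ℕ) (g : A → A) (c : Ch A) :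
    J (r := r) M m (psh g c) = psh (Prod.map g id) (J M m c) := by
  induction m with
  | zero =>
    rw [J_zero, J_zero, map_sub, psh_psh, psh_psh, psh_psh, psh_psh]; rfl
  | succ m ih => rw [J_succ, J_succ, ih, psh_cyl, cyl_psh]; rfl

lemma J_collapse (M m : ℕ) (hM : 0 < M) (i : ℕ) (t : ℝ) (ht : |t| = 1) (c : Ch A) :
    psh (sus i t) (J (r := r) M m c) ∈ Dg _ := by
  have h : ∀ v w : A × (Fin r → ℝ), v.1 = w.1 → sus i t v = sus i t w := by
    intro v w hvw
    simp [sus, hvw, ht]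
  cases m with
  | zero =>
    have : psh (sus i t) (J (r := r) M 0 c) = 0 := by
      rw [J_zero, map_sub, psh_psh, psh_psh]
      have : (sus i t ∘ pt 1 : A → A × (Fin r → ℝ)) = sus i t ∘ pt (-1) := by
        funext x; exact h _ _ rfl
      rw [this, sub_self]
    rw [this]; exact zero_mem _
  | succ m =>
    rw [J_succ, psh_cyl, cyl_apply]
    refine sum_mem fun j _ => ?_
    have : (sus i t ∘ sus (m + 1) (-1 + (j : ℕ) / M) : A × (Fin r → ℝ) → A × (Fin r → ℝ))
        = sus i t ∘ sus (m + 1) (-1 + (j + 1 : ℕ) / M) := by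
      funext x; exact h _ _ rfl
    rw [this]
    exact pr_self_Dg _ _

lemma bd_J (M m : ℕ) (hM : 0 < M) (c : Ch A) :
    bd (J (r := r) M m c) - (-1 : ℤ) ^ m • J M m (bd c) ∈ Dg _ := by
  have hM' : (0 : ℝ) < M := by exact_mod_cast hM
  induction m with
  | zero =>
    have : bd (J (r := r) M 0 c) = J M 0 (bd c) := by
      rw [J_zero, J_zero, map_sub, bd_psh, bd_psh]
    rw [this]; simp
  | succ m ih =>
    rw [J_succ, bd_cyl, J_succ]
    have h1 := J_collapse (r := r) M m hM (m + 1) (-1 + (2 * M : ℕ) / M) (by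
      push_cast; rw [mul_div_assoc, div_self hM'.ne']; norm_num) c
    have h2 := J_collapse (r := r) M m hM (m + 1) (-1 + (0 : ℕ) / M) (by simp) c
    have h3 := cyl_Dg (fun j => sus (m + 1) (-1 + j / M)) (2 * M) ih
    rw [map_sub, map_zsmul] at h3
    have := sub_mem (sub_mem h1 h2) h3
    convert this using 1
    rw [pow_succ]
    simp only [mul_neg, mul_one, neg_smul]
    abel

lemma sus_VB {m : ℕ} (hm : m < r) {t : ℝ} (ht : |t| ≤ 1) {v : A × (Fin r → ℝ)} (hv : VB m v.2) :
    VB (m + 1) (sus m t v).2 := by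
  refine ⟨?_, fun j hj => ?_⟩
  · have : ∀ j : Fin r, |(sus m t v).2 j| = (1 - |t|) * |v.2 j| + if j = ⟨m, hm⟩ then |t| else 0 := by
      intro j
      unfold sus
      by_cases h : j.val = m
      · simp only
        rw [hv.2 j h.ge, if_pos h, if_pos (Fin.ext h)]; simp
      · simp only
        rw [if_neg h, if_neg (fun h' => h (by rw [h']))]
        rw [add_zero, add_zero, abs_mul, abs_of_nonneg (by linarith : 0 ≤ 1 - |t|)]
    simp only [this, Finset.sum_add_distrib, ← Finset.mul_sum, hv.1]
    simp
  · simp only [sus]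
    rw [hv.2 j (by omega), if_neg (by omega)]; simp

variable [PseudoMetricSpace A]

lemma sus_dist (m : ℕ) {t : ℝ} (ht : |t| ≤ 1) (v w : A × (Fin r → ℝ)) :
    dist (sus m t v) (sus m t w) ≤ dist v w := by
  rw [Prod.dist_eq, Prod.dist_eq]
  refine max_le_max le_rfl ?_
  refine (dist_pi_le_iff dist_nonneg).2 fun j => ?_
  have := dist_le_pi_dist v.2 w.2 j
  rw [Real.dist_eq] at this ⊢
  simp only [sus]
  rw [add_sub_add_right_eq_sub, ← mul_sub, abs_mul, abs_of_nonneg (by linarith : 0 ≤ 1 - |t|)]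
  refine le_trans ?_ this
  have := abs_nonneg t
  exact mul_le_of_le_one_left (abs_nonneg _) (by linarith)

lemma sus_dist2 (m i : ℕ) (s t : ℝ) {v : A × (Fin r → ℝ)} (hv : VB i v.2) :
    dist (sus m s v) (sus m t v) ≤ |s - t| * 2 := by
  rw [Prod.dist_eq]
  refine max_le (by simp [sus]) ?_
  refine (dist_pi_le_iff (by positivity)).2 fun j => ?_
  rw [Real.dist_eq]
  simp only [sus]
  have h1 := hv.le j
  have h2 : |(1 - |s|) * v.2 j - (1 - |t|) * v.2 j| ≤ |s - t| := by
    rw [← sub_mul, abs_mul]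
    have : |1 - |s| - (1 - |t|)| ≤ |s - t| := by
      rw [show 1 - |s| - (1 - |t|) = -(|s| - |t|) by ring, abs_neg]
      exact abs_abs_sub_abs_le_abs_sub _ _
    calc _ ≤ |s - t| * 1 := mul_le_mul this h1 (abs_nonneg _) (abs_nonneg _)
      _ = _ := mul_one _
  have h3 : |(if j.val = m then s else 0) - (if j.val = m then t else 0)| ≤ |s - t| := by
    split_ifs <;> simp
  rw [add_sub_add_comm]
  exact (abs_add_le _ _).trans (by linarith)

lemma J_Gd (M : ℕ) (hM : 0 < M) (η : ℝ) (hη : 2 / M ≤ η) (Q : A → Prop) (ε : ℝ) (d : ℕ) (c : Ch A)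
    (hc : c ∈ Sup (Gd Q ε d)) (m : ℕ) (hm : m < r) :
    J (r := r) M m c ∈ Sup (Gd (fun v => Q v.1 ∧ VB (m + 1) v.2) (ε + m * η) (d + m)) := by
  have hM' : (0 : ℝ) < M := by exact_mod_cast hM
  have hη0 : 0 ≤ η := le_trans (by positivity) hη
  induction m with
  | zero =>
    have h0 : ∀ a : ℝ, |a| = 1 → psh (pt a) c ∈
        Sup (Gd (fun v : A × (Fin r → ℝ) => Q v.1 ∧ VB (0 + 1) v.2) (ε + (0 : ℕ) * η) (d + 0)) := by
      intro a ha
      rw [Nat.cast_zero, zero_mul, add_zero, add_zero]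
      refine psh_Gd _ (fun x hx => ⟨hx, ?_, ?_⟩) (fun x y _ _ => ?_) hc
      rotate_left
      · rw [Finset.sum_eq_single ⟨0, hm⟩]
        · simp [pt, ha]
        · intro b _ hb
          have : ¬ (b.val = 0) := fun h => hb (Fin.ext h)
          simp [pt, this]
        · simp
      · intro j hj; exact if_neg (by omega)
      · rw [Prod.dist_eq]; simp [pt]
    exact sub_mem (h0 1 (by simp)) (h0 (-1) (by simp))
  | succ m ih =>
    have ht : ∀ j ≤ 2 * M, |(-1 + (j : ℝ) / M)| ≤ 1 := by
      intro j hj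
      have h1 : (j : ℝ) / M ≤ 2 := (div_le_iff₀ hM').2 (by exact_mod_cast hj)
      have h2 : 0 ≤ (j : ℝ) / M := by positivity
      rw [abs_le]; constructor <;> linarith
    have := cyl_Gd (fun j => sus (m + 1) (-1 + j / M)) (2 * M)
      (Q' := fun v : A × (Fin r → ℝ) => Q v.1 ∧ VB (m + 1 + 1) v.2) hη0
      (fun j hj a ha => ⟨ha.1, sus_VB hm (ht j hj) ha.2⟩)
      (fun j hj a b _ _ => sus_dist _ (ht j hj) _ _)
      (fun j _ a ha => (sus_dist2 (m + 1) (m + 1) _ _ ha.2).trans (le_trans (le_of_eq ?_) hη))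
      (ih (by omega))
    · rw [J_succ]
      rw [show (ε + (m + 1 : ℕ) * η : ℝ) = ε + m * η + η by push_cast; ring, ← add_assoc d m 1]
      exact this
    · push_cast
      rw [show (-1 + j / M - (-1 + (j + 1) / M) : ℝ) = - (1 / M) by ring, abs_neg,
        abs_of_pos (by positivity)]
      ring

/-- sign functions -/
noncomputable def sg (m : ℕ) (y : Fin r → ℝ) : ℤ :=
  if h : m < r then (if 0 < y ⟨m, h⟩ then 1 else 0) else 0

lemma ev_J (M : ℕ) (hM : 1 < M) (a : A) (m : ℕ) (hm : m < r) :
    ev (bet (fun i (v : A × (Fin r → ℝ)) => sg i v.2) m) (J M m (of [a])) = 1 := by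
  have hM' : (1 : ℝ) < M := by exact_mod_cast hM
  induction m with
  | zero =>
    rw [J_zero]
    simp [bet, sg, hm, pt]
  | succ m ih =>
    have ih' := ih (by omega)
    set s : ℕ → A × (Fin r → ℝ) → ℤ := fun i v => sg i v.2 with hs
    have hG := J_Gd (r := r) M (by omega) (2 / M) le_rfl (fun _ : A => True) 0 1 (of [a])
      (of_mem_Sup ⟨rfl, fun _ _ => trivial, by simp⟩) m (by omega)
    rw [J_succ, cyl_apply, map_sum, ← ih']
    let α : ℕ → ℤ := fun j => if 0 < (-1 + (j : ℝ) / M) then 1 else 0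
    have key : ∀ j ∈ Finset.range (2 * M), ev (bet s (m + 1))
        (pr (sus (m + 1) (-1 + (j : ℕ) / M)) (sus (m + 1) (-1 + (j + 1 : ℕ) / M)) (J M m (of [a])))
        = (α (j + 1) - α j) * ev (bet s m) (J M m (of [a])) := by
      intro j hj
      refine Sup_congr ((ev (bet s (m + 1))).comp (pr _ _))
        ((AddMonoidHom.mulLeft (α (j + 1) - α j)).comp (ev (bet s m))) (fun l hl => ?_) hG
      show ev (bet s (m + 1)) (pr _ _ (of l)) = (α (j + 1) - α j) * ev (bet s m) (of l)
      have hsm : ∀ t : ℝ, ∀ v ∈ l, s (m + 1) (sus (m + 1) t v) = if 0 < t then 1 else 0 := by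
        intro t v hv
        simp [hs, sg, hm, sus, (hl.2.1 v hv).2.2 ⟨m + 1, hm⟩ le_rfl]
      rw [ev_bet_pr s _ _ m l (α j) (α (j + 1)) (fun v hv => hsm _ v hv) (fun v hv => hsm _ v hv),
        ev_of]
      by_cases h : α (j + 1) = α j
      · rw [h]; ring
      · congr 1
        refine bet_map _ _ _ _ _ fun i hi v hv => ?_
        -- the crossing step
        have hlt : |(-1 + (j + 1 : ℕ) / M : ℝ)| < 1 := by
          have hM0 : (0 : ℝ) < M := by linarith
          have h2 : 0 < (-1 + (j + 1 : ℕ) / M : ℝ) ∧ ¬ 0 < (-1 + (j : ℕ) / M : ℝ) := by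
            have hmono : (-1 + (j : ℕ) / M : ℝ) ≤ -1 + (j + 1 : ℕ) / M := by
              have : (j : ℝ) / M ≤ (j + 1 : ℕ) / M := by gcongr; simp
              linarith
            by_cases h3 : 0 < (-1 + (j : ℕ) / M : ℝ)
            · exfalso; apply h; simp only [α]; rw [if_pos h3, if_pos (lt_of_lt_of_le h3 hmono)]
            · refine ⟨?_, h3⟩
              by_contra h4; apply h; simp only [α]; rw [if_neg h3, if_neg h4]
          rw [abs_of_pos h2.1]
          have h5 := h2.2
          push_cast
          rw [add_div]
          have h6 : 1 / (M : ℝ) < 1 := (div_lt_one hM0).2 hM'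
          linarith
        simp only [hs, sg]
        rw [dif_pos (by omega), dif_pos (by omega)]
        have : (sus (m + 1) (-1 + (j + 1 : ℕ) / M : ℝ) v).2 ⟨i, by omega⟩
            = (1 - |(-1 + (j + 1 : ℕ) / M : ℝ)|) * v.2 ⟨i, by omega⟩ := by
          simp only [sus]; rw [if_neg (by omega), add_zero]
        refine if_congr ?_ rfl rfl
        rw [this, mul_pos_iff_of_pos_left (by linarith)]
    rw [Finset.sum_congr rfl key, ← Finset.sum_mul, Finset.sum_range_sub]
    have h0 : α 0 = 0 := by simp [α]
    have h1 : α (2 * M) = 1 := by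
      simp only [α]
      rw [if_pos]
      push_cast; rw [mul_div_assoc, div_self (by linarith)]; norm_num
    rw [h0, h1]; simp

end susp

section final
variable {k : ℕ}

/-- vertex set -/
def VV (v : (Fin k → ℂ) × (Fin (2 * k) → ℝ)) : Prop := (∑ j, ‖v.1 j‖ = 1) ∧ (∑ j, |v.2 j| = 1)

theorem cells (hk : 1 ≤ k) (p : ℕ) (θ : ℕ → ℝ) (hθ : ∀ j, Complex.exp (θ j * Complex.I) ^ p = 1)
    (ε : ℝ) (hε : 0 < ε) : ∃ z : ℕ → Ch ((Fin k → ℂ) × (Fin (2 * k) → ℝ)),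
      (∀ j ≤ 2 * (k - 1) + 1, z j ∈ Sup (Gd VV ε (j + 2 * k))) ∧
      (∀ i ≤ k - 1, bd (z (2 * i + 1)) - (-1 : ℤ) • (psh (Prod.map (gA θ) id) (z (2 * i)) - z (2 * i)) ∈ Dg _) ∧
      (∀ i < k - 1, bd (z (2 * i + 2)) + (-1 : ℤ) •
        (∑ m ∈ Finset.range p, psh ((Prod.map (gA θ) id)^[m]) (z (2 * i + 1))) ∈ Dg _) ∧
      bd (z 0) ∈ Dg _ ∧
      ev (bet (fun i (v : (Fin k → ℂ) × (Fin (2 * k) → ℝ)) => sg i v.2) (2 * k - 1)) (z 0) = 1 := by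
  obtain ⟨S, hS⟩ : ∃ S : ℝ, S = 2 + ∑ i ∈ Finset.range k, |θ i| := ⟨_, rfl⟩
  have hS0 : 0 ≤ ∑ i ∈ Finset.range k, |θ i| := by positivity
  obtain ⟨M, hM⟩ := exists_nat_gt (max 1 (S * (4 * k) / ε))
  have hM1 : (1 : ℝ) < M := lt_of_le_of_lt (le_max_left _ _) hM
  have hM2 := lt_of_le_of_lt (le_max_right _ _) hM
  have hM1' : 1 < M := by exact_mod_cast hM1
  have hM0 : 0 < M := by omega
  have hM0' : (0 : ℝ) < M := by linarith
  have hη2 : 2 / (M : ℝ) ≤ S / M := by gcongr; linarith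
  have hη : ∀ i < k, |θ i| / (M : ℝ) ≤ S / M := by
    intro i hi
    gcongr
    have := Finset.single_le_sum (f := fun i => |θ i|) (fun i _ => by positivity)
        (Finset.mem_range.2 hi)
    linarith
  have hηε : (4 * k) * (S / M) ≤ ε := by
    rw [div_lt_iff₀ hε] at hM2
    rw [← mul_div_assoc, div_le_iff₀ hM0']
    linarith
  have hη0 : 0 ≤ S / M := le_trans (by positivity) hη2
  have hG := ee_Gd (k := k) θ p M hM0 (S / M) hη hη2
  have hR := ee_rel (k := k) θ p M hM0 hθ
  let e : ℕ → Ch (Fin k → ℂ) := fun j => if j % 2 = 0 then ee k θ p M (j / 2) else eo k θ p M (j / 2)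
  have he0 : ∀ i, e (2 * i) = ee k θ p M i := fun i => by simp [e]
  have he1 : ∀ i, e (2 * i + 1) = eo k θ p M i := fun i => by
    simp only [e]
    rw [if_neg (by omega), show (2 * i + 1) / 2 = i by omega]
  have hr : 2 * k - 1 < 2 * k := by omega
  have hJb := bd_J (A := Fin k → ℂ) (r := 2 * k) M (2 * k - 1) hM0
  have hsgn : (-1 : ℤ) ^ (2 * k - 1) = -1 := Odd.neg_one_pow ⟨k - 1, by omega⟩
  rw [hsgn] at hJb
  have hGe : ∀ j ≤ 2 * (k - 1) + 1, e j ∈ Sup (Gd (VA k) (j * (S / M)) (j + 1)) := by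
    intro j hj
    rcases Nat.even_or_odd' j with ⟨i, rfl | rfl⟩
    · rw [he0]
      refine Sup_mono (fun l hl => ⟨hl.1, fun a ha => (hl.2.1 a ha).mono (by omega), ?_⟩)
        (hG i (by omega)).1
      simpa using hl.2.2
    · rw [he1]
      refine Sup_mono (fun l hl => ⟨hl.1, fun a ha => (hl.2.1 a ha).mono (by omega), ?_⟩)
        (hG i (by omega)).2
      simpa using hl.2.2
  refine ⟨fun j => J M (2 * k - 1) (e j), ?_, ?_, ?_, ?_, ?_⟩
  · intro j hj
    refine Sup_mono (fun l hl => ⟨by rw [hl.1]; omega, ?_, ?_⟩)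
      (J_Gd (r := 2 * k) M hM0 (S / M) hη2 _ _ _ _ (hGe j hj) (2 * k - 1) hr)
    · intro a ha
      exact ⟨(hl.2.1 a ha).1.1, (hl.2.1 a ha).2.1⟩
    · intro a ha b hb
      refine (hl.2.2 a ha b hb).trans (le_trans ?_ hηε)
      rw [← add_mul]
      refine mul_le_mul_of_nonneg_right ?_ hη0
      have : (j : ℝ) + ((2 * k - 1 : ℕ) : ℝ) ≤ ((4 * k : ℕ) : ℝ) := by exact_mod_cast (by omega)
      simpa using this
  · intro i hi
    have h1 := hJb (e (2 * i + 1))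
    have h2 := J_Dg (r := 2 * k) M (2 * k - 1) (hR i (by omega)).1
    simp only
    rw [he1] at h1 ⊢
    rw [he0, ← J_psh]
    rw [map_sub, map_sub] at h2
    have := sub_mem h1 h2
    convert this using 1
    simp only [neg_smul, one_smul]; abel
  · intro i hi
    have h1 := hJb (e (2 * i + 2))
    have h2 := J_Dg (r := 2 * k) M (2 * k - 1) ((hR i (by omega)).2 (by omega))
    simp only
    have : e (2 * i + 2) = ee k θ p M (i + 1) := by rw [← he0]; congr 1
    rw [this] at h1 ⊢
    rw [he1]
    have h3 : (∑ m ∈ Finset.range p, psh ((Prod.map (gA θ) id)^[m]) (J M (2 * k - 1) (eo k θ p M i)))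
        = J (r := 2 * k) M (2 * k - 1) (Nm (gA θ) p (eo k θ p M i)) := by
      rw [Nm, map_sum]
      refine Finset.sum_congr rfl fun m _ => ?_
      rw [J_psh]
      congr 2
      rw [Prod.map_iterate]; simp
    rw [h3]
    rw [map_add] at h2
    have := sub_mem h1 h2
    convert this using 1
    simp only [neg_smul, one_smul]; abel
  · have h1 := hJb (e 0)
    have h0 : e 0 = ee k θ p M 0 := he0 0
    have h2 : J (r := 2 * k) M (2 * k - 1) (bd (e 0)) = 0 := by
      rw [h0, ee, bd_of_cons]
      simp only [bd_nil, map_zero, sub_zero]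
      generalize 2 * k - 1 = m
      induction m with
      | zero => rw [J_zero]; simp
      | succ m ih => rw [J_succ, ih, map_zero]
    rw [h2, smul_zero, sub_zero] at h1
    exact h1
  · have h0 : e 0 = ee k θ p M 0 := he0 0
    simp only
    rw [h0, ee]
    exact ev_J M hM1' _ _ hr

end final
end LS


namespace LS
open FreeAbelianGroup

lemma bd_Dgl {T : Type*} (l : List T) (hl : Dgl l) : bd (of l) ∈ Dg T := by
  induction l with
  | nil => simp
  | cons v s ih =>
    rcases dgl_cons_iff.1 hl with ⟨t, rfl⟩ | h
    · rw [bd_of_cons, bd_of_cons, map_sub, cn_of, sub_sub_cancel]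
      exact cn_cn_Dg _ _
    · rw [bd_of_cons]
      exact sub_mem (of_mem_Dg h) (cn_Dg _ (ih h))

lemma bet_length {T : Type*} (s : ℕ → T → ℤ) (n : ℕ) (l : List T) (h : l.length ≠ n + 1) :
    bet s n l = 0 := by
  induction n generalizing l with
  | zero =>
    match l, h with
    | [], _ => rfl
    | [v], h => simp at h
    | v :: w :: t, _ => rfl
  | succ n ih =>
    match l, h with
    | [], _ => rfl
    | [v], h => rfl
    | v :: w :: t, h =>
      rw [bet, cup1, ih _ (by simpa using h), mul_zero]

lemma bet_const {T : Type*} (s : ℕ → T → ℤ) (n : ℕ) (hn : 1 ≤ n) (l : List T)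
    (h : ∀ a ∈ l, ∀ b ∈ l, a = b) : bet s n l = 0 := by
  match l, h with
  | [], _ => exact bet_nil _ _
  | [v], h => exact bet_length _ _ _ (by simp; omega)
  | v :: w :: t, h =>
    have := h v (by simp) w (by simp)
    subst this
    exact bet_Dgl _ _ _ (dgl_two _ _)

/-- if all points are close to a point with a big coordinate, the sign cochain is closed -/
lemma bet_close {R r : ℕ} (hR : R ≤ r + 1) (l : List (Fin R → ℝ)) (c : ℝ)
    (h : ∀ a ∈ l, ∃ m, c ≤ |a m|) (h' : ∀ a ∈ l, ∀ b ∈ l, dist a b < c) :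
    cob (bet sg r) l = 0 := by
  by_contra hne
  have hb := bet_cob _ _ _ hne
  have hl : ∃ a, a ∈ l := by
    obtain ⟨a, ha, _⟩ := hb 0 (by omega); exact ⟨a, ha⟩
  obtain ⟨a, ha⟩ := hl
  obtain ⟨m, hm⟩ := h a ha
  obtain ⟨b, hb1, d, hd, hne'⟩ := hb m (by omega)
  have key : ∀ x ∈ l, sg m x = sg m a := by
    intro x hx
    have h1 := lt_of_le_of_lt (dist_le_pi_dist x a m) (h' x hx a ha)
    rw [Real.dist_eq] at h1
    have h1 := abs_lt.1 h1
    simp only [sg]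
    rw [dif_pos m.2, dif_pos m.2]
    simp only [Fin.eta]
    refine if_congr ?_ rfl rfl
    rcases le_total 0 (a m) with h2 | h2
    · rw [abs_of_nonneg h2] at hm
      constructor <;> intro <;> linarith
    · rw [abs_of_nonpos h2] at hm
      constructor <;> intro <;> linarith
  exact hne' (by rw [key b hb1, key d hd])

section B
variable {T : Type*} {R : ℕ} (r : ℕ) (π : T → (Fin R → ℝ)) (H : ℕ → T → (Fin R → ℝ)) (M : ℕ)
  (Kn : T → Prop)

open Classical in
noncomputable def kap (l : List T) : ℤ :=
  if ∀ v ∈ l, Kn v then - ev (bet sg r) (cyl H M (of l)) else 0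

noncomputable def BB (l : List T) : ℤ := bet (fun i v => sg i (π v)) r l - cob (kap r H M Kn) l

lemma kap_Dgl (l : List T) (hl : Dgl l) : kap r H M Kn l = 0 := by
  unfold kap
  split_ifs with h
  · rw [ev_Dg _ (bet_Dgl _ _) (cyl_Dg _ _ (of_mem_Dg hl)), neg_zero]
  · rfl

lemma BB_ev (c : Ch T) (hc : bd c ∈ Dg T) :
    ev (BB r π H M Kn) c = ev (bet (fun i v => sg i (π v)) r) c := by
  unfold BB
  rw [ev_sub, ev_cob, ev_Dg _ (kap_Dgl _ _ _ _) hc, sub_zero]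

lemma BB_zero (hR : R ≤ r + 1) (hr : 1 ≤ r) (l : List T) (hl : ∀ v ∈ l, Kn v) (h0 : ∀ v ∈ l, H 0 v = π v) (c : ℝ)
    (hc : ∀ j ≤ M, ∀ v ∈ l, ∃ m, c ≤ |H j v m|)
    (hd : ∀ j < M, ∀ v ∈ l, ∀ w ∈ l, dist (H j v) (H j w) < c ∧ dist (H j v) (H (j + 1) w) < c ∧
      dist (H (j + 1) v) (H (j + 1) w) < c)
    (he : ∀ v ∈ l, ∀ w ∈ l, H M v = H M w) : BB r π H M Kn l = 0 := by
  unfold BB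
  have h1 : cob (kap r H M Kn) l = - ev (bet sg r) (cyl H M (bd (of l))) := by
    unfold cob
    have := Sup_congr (ev (kap r H M Kn)) (-((ev (bet sg r)).comp (cyl H M))) (fun m hm => ?_) (bd_sup l)
    · rw [this]; rfl
    · rw [ev_of]; unfold kap; rw [if_pos fun v hv => hl v (hm.2 v hv)]; rfl
  have h2 : ev (bet sg r) (bd (cyl H M (of l))) = 0 := by
    rw [← ev_cob, cyl_apply, map_sum]
    refine Finset.sum_eq_zero fun j hj => ?_
    have hj' := Finset.mem_range.1 hj
    rw [ev_congr_sup _ (fun _ => 0) _ (pr_sup _ _ l), ev_zero]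
    intro m hm
    refine bet_close hR _ c (fun a ha => ?_) fun a ha b hb => ?_
    · obtain ⟨v, hv, rfl | rfl⟩ := hm.2 a ha
      · exact hc _ hj'.le v hv
      · exact hc _ hj' v hv
    · obtain ⟨v, hv, rfl | rfl⟩ := hm.2 a ha <;> obtain ⟨w, hw, rfl | rfl⟩ := hm.2 b hb
      · exact (hd j hj' v hv w hw).1
      · exact (hd j hj' v hv w hw).2.1
      · rw [dist_comm]; exact (hd j hj' w hw v hv).2.1
      · exact (hd j hj' v hv w hw).2.2
  rw [bd_cyl, map_sub, map_sub] at h2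
  have h3 : ev (bet sg r) (psh (H M) (of l)) = 0 := by
    rw [psh_of, ev_of]
    refine bet_const _ _ hr _ ?_
    simpa using he
  have h4 : ev (bet sg r) (psh (H 0) (of l)) = bet (fun i v => sg i (π v)) r l := by
    rw [psh_of, ev_of]
    exact bet_map _ _ _ _ _ fun i _ v hv => by rw [h0 v hv]
  rw [h3, h4] at h2
  rw [h1]
  linarith

lemma BB_good (hR : R ≤ r + 1) (g : T → T) (Sm : List T → Prop)
    (hsub : ∀ l m, Sm l → (∀ x ∈ m, x ∈ l) → Sm m)
    (hπ : ∀ v, π (g v) = π v) (hK : ∀ v, Sm [v] → (Kn (g v) ↔ Kn v))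
    (hH : ∀ j ≤ M, ∀ v, Sm [v] → Kn v → H j (g v) = H j v) (c : ℝ)
    (hc : ∀ l, Sm l → ∀ a ∈ l, ∃ m, c ≤ |π a m|)
    (hd : ∀ l, Sm l → ∀ a ∈ l, ∀ b ∈ l, dist (π a) (π b) < c) : GoodC g Sm (BB r π H M Kn) where
  nrm l hl := by
    unfold BB
    rw [bet_Dgl _ _ _ hl, cob, ev_Dg _ (kap_Dgl _ _ _ _) (bd_Dgl l hl), sub_zero]
  nil := by simp [BB, bet_nil, cob]
  coc l hl := by
    unfold BB
    rw [cob_sub, cob_cob, sub_zero]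
    have h1 : cob (bet (fun i v => sg i (π v)) r) l = cob (bet sg r) (l.map π) := by
      unfold cob
      rw [← psh_of, bd_psh, ev_psh]
      refine ev_congr_sup _ _ (fun m _ => ?_) (bd_sup l)
      exact (bet_map _ _ _ _ _ fun i _ v _ => rfl).symm
    rw [h1]
    refine bet_close hR _ c ?_ ?_
    · simpa using hc l hl
    · simpa using hd l hl
  inv l hl := by
    unfold BB
    congr 1
    · exact bet_map _ _ _ _ _ fun i _ v _ => by rw [hπ]
    · unfold cob
      rw [← psh_of, bd_psh, ev_psh]
      refine ev_congr_sup _ _ (fun m hm => ?_) (bd_sup l)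
      have hS : ∀ v ∈ m, Sm [v] := fun v hv => hsub l [v] hl (by simpa using hm.2 v hv)
      unfold kap
      have : (∀ v ∈ m.map g, Kn v) ↔ ∀ v ∈ m, Kn v := by
        simp only [List.forall_mem_map]
        exact forall₂_congr fun v hv => hK v (hS v hv)
      by_cases hm' : ∀ v ∈ m, Kn v
      · rw [if_pos (this.2 hm'), if_pos hm', ← psh_of, cyl_psh]
        congr 2
        rw [cyl_apply, cyl_apply]
        refine Finset.sum_congr rfl fun j hj => ?_
        have hj := Finset.mem_range.1 hj
        exact pr_congr _ _ _ _ _ (fun v hv => hH j hj.le v (hS v hv) (hm' v hv))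
          (fun v hv => hH (j + 1) hj v (hS v hv) (hm' v hv))
      · rw [if_neg (fun h => hm' (this.1 h)), if_neg hm']

end B

section geo
variable {k : ℕ}

theorem geo_contra (hk : 1 ≤ k) (p : ℕ) (hp : 1 < p) (θ : ℕ → ℝ)
    (hθ : ∀ j, Complex.exp (θ j * Complex.I) ^ p = 1)
    (ε : ℝ) (hε : 0 < ε) (hεk : ε < 1 / (2 * k))
    (K : ℕ → (Fin k → ℂ) × (Fin (2 * k) → ℝ) → Prop)
    (u : ℕ → (Fin k → ℂ) × (Fin (2 * k) → ℝ) → ZMod p)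
    (hKg : ∀ i v, VV v → (K i (Prod.map (gA θ) id v) ↔ K i v))
    (hug : ∀ i v, VV v → K i v → u i (Prod.map (gA θ) id v) = u i v + 1)
    (huc : ∀ i v w, VV v → VV w → K i v → K i w → dist v w ≤ ε → u i v = u i w)
    (hcov : ∀ l : List ((Fin k → ℂ) × (Fin (2 * k) → ℝ)), (∀ a ∈ l, VV a) →
      (∀ a ∈ l, ∀ b ∈ l, dist a b ≤ ε) → ∃ i < 2 * k, ∀ a ∈ l, K i a)
    (H : ℕ → (Fin k → ℂ) × (Fin (2 * k) → ℝ) → (Fin (2 * k) → ℝ)) (M : ℕ) (c : ℝ)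
    (h0 : ∀ v, VV v → K (2 * k - 1) v → H 0 v = v.2)
    (hHg : ∀ j ≤ M, ∀ v, VV v → K (2 * k - 1) v → H j (Prod.map (gA θ) id v) = H j v)
    (hc : ∀ j ≤ M, ∀ v, VV v → K (2 * k - 1) v → ∃ m, c ≤ |H j v m|)
    (hd : ∀ j < M, ∀ v w, VV v → VV w → K (2 * k - 1) v → K (2 * k - 1) w → dist v w ≤ ε →
      dist (H j v) (H j w) < c ∧ dist (H j v) (H (j + 1) w) < c ∧
      dist (H (j + 1) v) (H (j + 1) w) < c)
    (he : ∀ v w, VV v → VV w → K (2 * k - 1) v → K (2 * k - 1) w → dist v w ≤ ε → H M v = H M w) :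
    False := by
  classical
  obtain ⟨r, hr⟩ : ∃ r, 2 * k = r + 1 := ⟨2 * k - 1, by omega⟩
  have hr' : 2 * k - 1 = r := by omega
  haveI : NeZero p := ⟨by omega⟩
  obtain ⟨z, hz, hodd, heven, hz0, hz1⟩ := cells hk p θ hθ ε hε
  let T := (Fin k → ℂ) × (Fin (2 * k) → ℝ)
  let g : T → T := Prod.map (gA θ) id
  let Sm : List T → Prop := fun l => (∀ a ∈ l, VV a) ∧ ∀ a ∈ l, ∀ b ∈ l, dist a b ≤ ε
  have hsub : ∀ l m, Sm l → (∀ x ∈ m, x ∈ l) → Sm m := fun l m h hm =>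
    ⟨fun a ha => h.1 a (hm a ha), fun a ha b hb => h.2 a (hm a ha) b (hm b hb)⟩
  have hVg : ∀ v : T, VV v → VV (g v) := by
    intro v hv
    refine ⟨?_, hv.2⟩
    rw [← hv.1]
    refine Finset.sum_congr rfl fun j _ => ?_
    simp [g, gA, Complex.norm_exp_ofReal_mul_I]
  have hSg : ∀ l, Sm l → Sm (l.map g) := by
    intro l hl
    refine ⟨by simpa using fun v hv => hVg v (hl.1 v hv), ?_⟩
    simp only [List.forall_mem_map]
    intro a ha b hb
    refine le_trans ?_ (hl.2 a ha b hb)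
    rw [Prod.dist_eq, Prod.dist_eq]
    exact max_le_max (gA_dist _ _ _) le_rfl
  have hS1 : ∀ v, Sm [v] → VV v := fun v h => h.1 v (by simp)
  have hS1' : ∀ v : T, VV v → Sm [v] := fun v h => ⟨by simpa using h, by simp [hε.le]⟩
  -- a default label
  have hex : ∀ v : T, VV v → ∃ i, K i v := by
    intro v hv
    obtain ⟨i, -, hi⟩ := hcov [v] (by simpa using hv) (by simp [hε.le])
    exact ⟨i, hi v (by simp)⟩
  let dl : T → ZMod p := fun v => if h : ∃ i, K i v then u (Nat.find h) v else 0
  have hdl : ∀ v, VV v → dl (g v) = dl v + 1 := by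
    intro v hv
    have h1 := hex v hv
    have h2 := hex (g v) (hVg v hv)
    simp only [dl]
    rw [dif_pos h1, dif_pos h2]
    have : Nat.find h2 = Nat.find h1 := Nat.find_congr' (fun {n} => hKg n v hv)
    rw [this]
    exact hug _ v hv (Nat.find_spec h1)
  let lab : ℕ → T → ZMod p := fun j v =>
    if j = k - 1 then (if K 0 v then u 0 v else dl v) else
    if K (2 * j + 1) v then u (2 * j + 1) v else if K (2 * j + 2) v then u (2 * j + 2) v else dl v
  let typ : ℕ → T → ℕ := fun j v =>
    if K (2 * j + 1) v then 0 else if K (2 * j + 2) v then 1 else 2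
  let π : T → (Fin (2 * k) → ℝ) := fun v => v.2
  obtain ⟨B0, hB, hB1, hB0⟩ : ∃ B0 : List T → ℤ, GoodC g Sm B0 ∧ ev B0 (z 0) = 1 ∧
      ∀ l, Sm l → (∀ v ∈ l, K (2 * k - 1) v) → B0 l = 0 := by
    have hcc : ∀ v : T, VV v → ∃ m, 1 / (2 * k : ℝ) ≤ |v.2 m| := by
      intro v hv
      by_contra hcon
      push Not at hcon
      have : ∑ j, |v.2 j| < ∑ j : Fin (2 * k), 1 / (2 * k : ℝ) :=
        Finset.sum_lt_sum_of_nonempty ⟨⟨0, by omega⟩, by simp⟩ fun i _ => hcon i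
      rw [hv.2] at this
      have hk' : (k : ℝ) ≠ 0 := by positivity
      simp at this
      field_simp at this
      norm_num at this
    have hdd : ∀ l, Sm l → ∀ a ∈ l, ∀ b ∈ l, dist (π a) (π b) < 1 / (2 * k : ℝ) := by
      intro l hl a ha b hb
      refine lt_of_le_of_lt (le_trans ?_ (hl.2 a ha b hb)) hεk
      rw [Prod.dist_eq]; exact le_max_right _ _
    have hR : 2 * k ≤ (2 * k - 1) + 1 := by omega
    refine ⟨BB (2 * k - 1) π H M (K (2 * k - 1)), BB_good (2 * k - 1) π H M _ hR g Sm hsub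
      (fun v => rfl) (fun v hv => hKg _ v (hS1 v hv)) (fun j hj v hv hK => hHg j hj v (hS1 v hv) hK)
      (1 / (2 * k)) (fun l hl a ha => hcc a (hl.1 a ha)) hdd, ?_, fun l hl hK => ?_⟩
    · rw [BB_ev _ _ _ _ _ _ hz0]; exact hz1
    · exact BB_zero _ _ _ _ _ hR (by omega) l hK (fun v hv => h0 v (hl.1 v hv) (hK v hv)) c
        (fun j hj v hv => hc j hj v (hl.1 v hv) (hK v hv))
        (fun j hj v hv w hw => hd j hj v w (hl.1 v hv) (hl.1 w hw) (hK v hv) (hK w hw) (hl.2 v hv w hw))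
        (fun v hv w hw => he v w (hl.1 v hv) (hl.1 w hw) (hK v hv) (hK w hw) (hl.2 v hv w hw))
  have hk1 : 2 * (k - 1) + 1 + 1 = 2 * k := by omega
  refine abs_contra hsub hSg hp (k - 1) z (fun j hj => ?_) (-1) (by norm_num) hodd heven B0 hB hB1
    lab typ ?_ ?_ ?_
  · exact Sup_mono (fun l hl => ⟨hl.2.1, hl.2.2⟩) (hz j hj)
  · intro j hj v hv
    have hv' := hS1 v hv
    have e0 := hKg 0 v hv'
    have e1 := hKg (2 * j + 1) v hv'
    have e2 := hKg (2 * j + 2) v hv'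
    simp only [lab]
    split_ifs with h1 h2 h3 h4 <;> first
      | exact hug _ v hv' (by assumption)
      | exact hdl v hv'
      | (exfalso; tauto)
  · intro j hj v hv
    have hv' := hS1 v hv
    have e1 := hKg (2 * j + 1) v hv'
    have e2 := hKg (2 * j + 2) v hv'
    simp only [typ]
    split_ifs <;> first | rfl | (exfalso; tauto)
  · intro l hl
    obtain ⟨i, hi, hil⟩ := hcov l hl.1 hl.2
    rcases Nat.eq_zero_or_pos i with rfl | hi0
    · left
      intro a ha b hb
      simp only [lab]
      rw [if_pos trivial, if_pos trivial, if_pos (hil a ha), if_pos (hil b hb)]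
      exact huc _ _ _ (hl.1 a ha) (hl.1 b hb) (hil a ha) (hil b hb) (hl.2 a ha b hb)
    by_cases hin : i = 2 * k - 1
    · right; right
      intro m hm
      exact hB0 m (hsub l m hl hm) fun v hv => hin ▸ hil v (hm v hv)
    right; left
    refine ⟨(i - 1) / 2, by omega, ?_⟩
    generalize hj : (i - 1) / 2 = j
    have hjk : j ≠ k - 1 := by omega
    by_cases hodd' : i = 2 * j + 1
    · intro a ha b hb d hd'
      have hlab : ∀ a ∈ l, ∀ b ∈ l, lab j a = lab j b := by
        intro a ha b hb
        simp only [lab]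
        rw [if_neg hjk, if_neg hjk, if_pos (hodd' ▸ hil a ha), if_pos (hodd' ▸ hil b hb)]
        exact huc _ _ _ (hl.1 a ha) (hl.1 b hb) (hodd' ▸ hil a ha) (hodd' ▸ hil b hb) (hl.2 a ha b hb)
      have hy : ∀ a ∈ l, ∀ b ∈ l, yh p (lab j) (typ j) a b = 0 := by
        intro a ha b hb
        simp [yh, hlab a ha b hb]
      simp [yc, hy a ha b hb, hy b hb d hd', hy a ha d hd']
    · have hieq : i = 2 * j + 2 := by omega
      subst hieq
      -- labels of the two types
      have hty : ∀ a ∈ l, typ j a = if K (2 * j + 1) a then 0 else 1 := by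
        intro a ha
        simp only [typ]
        rw [if_pos (hil a ha)]
      obtain ⟨D, hD⟩ : ∃ D : ZMod p, ∀ a ∈ l, ∀ b ∈ l, K (2 * j + 1) a → ¬ K (2 * j + 1) b →
          lab j b - lab j a = D := by
        by_cases hne : ∃ a ∈ l, ∃ b ∈ l, K (2 * j + 1) a ∧ ¬ K (2 * j + 1) b
        · obtain ⟨a, ha, b, hb, hKa, hKb⟩ := hne
          refine ⟨lab j b - lab j a, fun a' ha' b' hb' hKa' hKb' => ?_⟩
          simp only [lab]
          rw [if_neg hjk, if_neg hjk, if_neg hjk, if_neg hjk, if_pos hKa, if_pos hKa', if_neg hKb,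
            if_neg hKb', if_pos (hil b hb), if_pos (hil b' hb')]
          rw [huc _ _ _ (hl.1 a ha) (hl.1 a' ha') hKa hKa' (hl.2 a ha a' ha'),
            huc _ _ _ (hl.1 b hb) (hl.1 b' hb') (hil b hb) (hil b' hb') (hl.2 b hb b' hb')]
        · push Not at hne
          exact ⟨0, fun a ha b hb h1 h2 => absurd (hne a ha b hb h1) h2⟩
      have hsame : ∀ a ∈ l, ∀ b ∈ l, (K (2 * j + 1) a ↔ K (2 * j + 1) b) → lab j a = lab j b := by
        intro a ha b hb hab
        simp only [lab]
        rw [if_neg hjk, if_neg hjk, if_pos (hil a ha), if_pos (hil b hb)]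
        by_cases h : K (2 * j + 1) a
        · rw [if_pos h, if_pos (hab.1 h)]
          exact huc _ _ _ (hl.1 a ha) (hl.1 b hb) h (hab.1 h) (hl.2 a ha b hb)
        · rw [if_neg h, if_neg (fun h' => h (hab.2 h'))]
          exact huc _ _ _ (hl.1 a ha) (hl.1 b hb) (hil a ha) (hil b hb) (hl.2 a ha b hb)
      let hh : T → ℤ := fun a => if K (2 * j + 1) a then 0 else (D.val : ℤ)
      have hy : ∀ a ∈ l, ∀ b ∈ l, yh p (lab j) (typ j) a b = hh b - hh a := by
        intro a ha b hb
        simp only [yh, hty a ha, hty b hb, hh]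
        by_cases h1 : K (2 * j + 1) a <;> by_cases h2 : K (2 * j + 1) b
        · simp [h1, h2, hsame a ha b hb (by tauto)]
        · simp [h1, h2, hD a ha b hb h1 h2]
        · simp [h1, h2, hD b hb a ha h2 h1]
        · simp [h1, h2, hsame a ha b hb (by tauto)]
      intro a ha b hb d hd'
      rw [yc, hy a ha b hb, hy b hb d hd', hy a ha d hd']
      ring

end geo
end LS


namespace LS
open Complex Topology

/-- the unit sphere of `ℂ^k` -/
abbrev Sp (k : ℕ) : Type := Metric.sphere (0 : EuclideanSpace ℂ (Fin k)) 1

lemma Sp.sq {k : ℕ} (x : Sp k) : ∑ j, ‖x.1 j‖ ^ 2 = 1 := by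
  have := x.2
  rw [mem_sphere_zero_iff_norm] at this
  rw [← EuclideanSpace.norm_sq_eq, this, one_pow]

lemma Sp.mem_iff {k : ℕ} (x : EuclideanSpace ℂ (Fin k)) :
    x ∈ Metric.sphere (0 : EuclideanSpace ℂ (Fin k)) 1 ↔ ∑ j, ‖x j‖ ^ 2 = 1 := by
  rw [mem_sphere_zero_iff_norm, ← EuclideanSpace.norm_sq_eq]
  constructor
  · intro h; rw [h, one_pow]
  · intro h; exact (pow_eq_one_iff_of_nonneg (norm_nonneg _) two_ne_zero).1 h

lemma Sp.exists_ne {k : ℕ} (x : Sp k) : ∃ j, x.1 j ≠ 0 := by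
  by_contra h
  push Not at h
  have := x.sq
  simp [h] at this

/-- coordinatewise multiplication by unit complex numbers -/
def cmul {k : ℕ} (c : Fin k → Circle) (x : Sp k) : Sp k :=
  ⟨WithLp.toLp 2 fun j => (c j : ℂ) * x.1 j, (Sp.mem_iff _).2 (by simpa [Circle.norm_coe] using x.sq)⟩

@[simp] lemma cmul_apply {k : ℕ} (c : Fin k → Circle) (x : Sp k) (j : Fin k) :
    (cmul c x).1 j = (c j : ℂ) * x.1 j := rfl

lemma Sp.ext' {k : ℕ} {x y : Sp k} (h : ∀ j, x.1 j = y.1 j) : x = y :=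
  Subtype.ext (PiLp.ext h)

lemma continuous_Sp {Y : Type*} [TopologicalSpace Y] {k : ℕ} {f : Y → Sp k}
    (h : ∀ j, Continuous fun y => (f y).1 j) : Continuous f :=
  continuous_induced_rng.2 ((PiLp.continuous_toLp 2 _).comp (continuous_pi h))

lemma continuous_coord {k : ℕ} (j : Fin k) : Continuous fun x : Sp k => x.1 j := by fun_prop

lemma cmul_cont {k : ℕ} (c : Fin k → Circle) : Continuous (cmul c) :=
  continuous_Sp fun j => by
    simp only [cmul_apply]; exact continuous_const.mul (continuous_coord j)

section act
variable {p k : ℕ} [NeZero p] (ℓ : Fin k → ℤ)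

noncomputable def la (a : ZMod p) (x : Sp k) : Sp k := cmul (fun j => ZMod.toCircle (a * (ℓ j : ZMod p))) x

@[simp] lemma la_apply (a : ZMod p) (x : Sp k) (j : Fin k) :
    (la ℓ a x).1 j = (ZMod.toCircle (a * (ℓ j : ZMod p)) : ℂ) * x.1 j := rfl

lemma la_zero (x : Sp k) : la ℓ (0 : ZMod p) x = x := Sp.ext' fun j => by simp

lemma la_add (a b : ZMod p) (x : Sp k) : la ℓ (a + b) x = la ℓ a (la ℓ b x) := Sp.ext' fun j => by
  simp [add_mul, AddChar.map_add_eq_mul, mul_assoc]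

lemma la_cont (a : ZMod p) : Continuous (la (k := k) ℓ a) := cmul_cont _

lemma la_free (hℓ : ∀ j, IsCoprime (ℓ j) (p : ℤ)) (a : ZMod p) (x : Sp k) (h : la ℓ a x = x) :
    a = 0 := by
  obtain ⟨j, hj⟩ := x.exists_ne
  have h1 : (la ℓ a x).1 j = x.1 j := by rw [h]
  rw [la_apply] at h1
  have h2 : ZMod.toCircle (a * (ℓ j : ZMod p)) = 1 := by
    apply Circle.ext
    simpa [hj] using h1
  rw [← AddChar.map_zero_eq_one (ZMod.toCircle (N := p))] at h2
  have h3 := ZMod.injective_toCircle h2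
  obtain ⟨u, v, huv⟩ := hℓ j
  have : ((ℓ j : ℤ) : ZMod p) * (u : ZMod p) = 1 := by
    have := congrArg (fun t : ℤ => (t : ZMod p)) huv
    simp at this
    rw [mul_comm]; exact this
  calc a = a * (ℓ j * u) := by rw [this, mul_one]
    _ = (a * ℓ j) * u := by ring
    _ = 0 := by rw [h3, zero_mul]

lemma lensRel_iff (x y : Sp k) : lensRel p k ℓ x y ↔ ∃ a : ZMod p, y = la ℓ a x := by
  have key : ∀ m : ℤ, ∀ j, (la ℓ (m : ZMod p) x).1 j =
      exp (2 * Real.pi * I * m * ℓ j / p) * x.1 j := by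
    intro m j
    rw [la_apply, ← Int.cast_mul, ZMod.toCircle_intCast]
    push_cast
    ring_nf
  constructor
  · rintro ⟨m, hm⟩
    exact ⟨m, Sp.ext' fun j => by rw [key, hm]⟩
  · rintro ⟨a, rfl⟩
    refine ⟨a.val, fun j => ?_⟩
    rw [← key]
    simp

def mkL (p : ℕ) (ℓ : Fin k → ℤ) : Sp k → LensSpace p k ℓ := Quot.mk _

lemma mkL_quot : IsQuotientMap (mkL p ℓ) := isQuotientMap_quot_mk

lemma mkL_eq_iff (x y : Sp k) : mkL p ℓ x = mkL p ℓ y ↔ ∃ a : ZMod p, y = la ℓ a x := by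
  have heq : Equivalence (lensRel p k ℓ) := by
    refine ⟨fun x => (lensRel_iff ℓ x x).2 ⟨0, (la_zero ℓ x).symm⟩, fun {x y} h => ?_, fun {x y z} h h' => ?_⟩
    · obtain ⟨a, rfl⟩ := (lensRel_iff ℓ _ _).1 h
      exact (lensRel_iff ℓ _ _).2 ⟨-a, by rw [← la_add, neg_add_cancel, la_zero]⟩
    · obtain ⟨a, rfl⟩ := (lensRel_iff ℓ _ _).1 h
      obtain ⟨b, rfl⟩ := (lensRel_iff ℓ _ _).1 h'
      exact (lensRel_iff ℓ _ _).2 ⟨b + a, by rw [← la_add]⟩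
  rw [← lensRel_iff]
  exact heq.quot_mk_eq_iff x y

@[reducible] noncomputable def lAct (p : ℕ) [NeZero p] (ℓ : Fin k → ℤ) : AddAction (ZMod p) (Sp k) where
  vadd a x := la ℓ a x
  zero_vadd := la_zero ℓ
  add_vadd := la_add ℓ

lemma mkL_cov' (hℓ : ∀ j, IsCoprime (ℓ j) (p : ℤ)) :
    letI := lAct p ℓ
    IsAddQuotientCoveringMap (mkL p ℓ) (ZMod p) := by
  letI := lAct p ℓ
  haveI : ContinuousConstVAdd (ZMod p) (Sp k) := ⟨fun a => la_cont ℓ a⟩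
  haveI : ProperlyDiscontinuousVAdd (ZMod p) (Sp k) := ⟨fun _ _ => Set.toFinite _⟩
  haveI : IsCancelVAdd (ZMod p) (Sp k) :=
    isCancelVAdd_iff_eq_zero_of_vadd_eq.2 fun a x h => la_free ℓ hℓ a x h
  refine (mkL_quot ℓ).isAddQuotientCoveringMap_of_properlyDiscontinuousVAdd ?_
  intro x y
  rw [eq_comm, mkL_eq_iff]
  exact ⟨fun ⟨a, ha⟩ => ⟨a, ha.symm⟩, fun ⟨a, ha⟩ => ⟨a, ha.symm⟩⟩

lemma mkL_cov (hℓ : ∀ j, IsCoprime (ℓ j) (p : ℤ)) : IsCoveringMap (mkL p ℓ) :=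
  letI := lAct p ℓ
  (mkL_cov' ℓ hℓ).isCoveringMap

lemma mkL_open (hℓ : ∀ j, IsCoprime (ℓ j) (p : ℤ)) : IsOpenMap (mkL p ℓ) :=
  (mkL_cov ℓ hℓ).isLocalHomeomorph.isOpenMap

lemma mkL_la (a : ZMod p) (x : Sp k) : mkL p ℓ (la ℓ a x) = mkL p ℓ x :=
  ((mkL_eq_iff ℓ _ _).2 ⟨a, rfl⟩).symm

lemma mkL_surj : Function.Surjective (mkL p ℓ) := Quot.mk_surjective

end act
end LS


namespace LS
open Topology unitInterval

section lift
variable {p k : ℕ} [NeZero p] (ℓ : Fin k → ℤ)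

/-- lifting of homotopies, with equivariance -/
lemma lift_one {W X : Type*} [TopologicalSpace W] (hℓ : ∀ j, IsCoprime (ℓ j) (p : ℤ))
    (H : C(I × W, LensSpace p k ℓ)) (x : C(W, Sp k)) (h0 : ∀ w, H (0, w) = mkL p ℓ (x w))
    (c : W → X) (hc : ∀ w w', c w = c w' → ∀ t, H (t, w) = H (t, w')) :
    ∃ F : C(I × W, Sp k), (∀ t w, mkL p ℓ (F (t, w)) = H (t, w)) ∧ (∀ w, F (0, w) = x w) ∧
      ∀ w w' (a : ZMod p), c w = c w' → x w' = la ℓ a (x w) → ∀ t, F (t, w') = la ℓ a (F (t, w)) := by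
  have cov := mkL_cov ℓ hℓ
  let F := cov.liftHomotopy H x h0
  have hF : ∀ t w, mkL p ℓ (F (t, w)) = H (t, w) := fun t w =>
    congrFun (cov.liftHomotopy_lifts H x h0) (t, w)
  have hF0 : ∀ w, F (0, w) = x w := cov.liftHomotopy_zero H x h0
  refine ⟨F, hF, hF0, fun w w' a hw hx t => ?_⟩
  have := cov.eq_of_comp_eq (g₁ := fun t => F (t, w')) (g₂ := fun t => la ℓ a (F (t, w)))
    (by fun_prop) ((la_cont ℓ a).comp (by fun_prop)) (by
      funext t
      simp only [Function.comp]
      rw [hF, mkL_la, hF, hc w w' hw]) 0 (by simp only [hF0]; exact hx)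
  exact congrFun this t

lemma lift_null {q : ℕ} [NeZero q] (ℓ' : Fin k → ℤ) (hℓ : ∀ j, IsCoprime (ℓ j) (p : ℤ))
    (hℓ' : ∀ j, IsCoprime (ℓ' j) (q : ℤ)) (U : Set (LensSpace p k ℓ × LensSpace q k ℓ'))
    (hU : ContinuousMap.Nullhomotopic (⟨Subtype.val, continuous_subtype_val⟩ : C(U, _)))
    {W : Type*} [TopologicalSpace W] (f : C(W, Sp k × Sp k))
    (hf : ∀ w, (mkL p ℓ (f w).1, mkL q ℓ' (f w).2) ∈ U) :
    ∃ (F G : C(I × W, Sp k)) (e e' : Sp k), (∀ w, F (0, w) = (f w).1) ∧ (∀ w, G (0, w) = (f w).2) ∧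
      (∀ w, ∃ a : ZMod p, F (1, w) = la ℓ a e) ∧ (∀ w, ∃ b : ZMod q, G (1, w) = la ℓ' b e') ∧
      ∀ w w' (a : ZMod p), (f w').1 = la ℓ a (f w).1 → (f w').2 = (f w).2 →
        ∀ t, F (t, w') = la ℓ a (F (t, w)) ∧ G (t, w') = G (t, w) := by
  obtain ⟨y, ⟨N⟩⟩ := hU
  let i : W → U := fun w => ⟨(mkL p ℓ (f w).1, mkL q ℓ' (f w).2), hf w⟩
  have hi : Continuous i := by
    refine Continuous.subtype_mk ?_ _
    exact ((mkL_quot ℓ).continuous.comp (by fun_prop)).prodMk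
      ((mkL_quot ℓ').continuous.comp (by fun_prop))
  let H1 : C(I × W, LensSpace p k ℓ) := ⟨fun s => (N (s.1, i s.2)).1, by fun_prop⟩
  let H2 : C(I × W, LensSpace q k ℓ') := ⟨fun s => (N (s.1, i s.2)).2, by fun_prop⟩
  obtain ⟨F, hF, hF0, hFe⟩ := lift_one ℓ hℓ H1 ⟨fun w => (f w).1, by fun_prop⟩
    (fun w => by simp [H1, i]) i (fun w w' h t => by simp [H1, h])
  obtain ⟨G, hG, hG0, hGe⟩ := lift_one ℓ' hℓ' H2 ⟨fun w => (f w).2, by fun_prop⟩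
    (fun w => by simp [H2, i]) i (fun w w' h t => by simp [H2, h])
  obtain ⟨e, he⟩ := mkL_surj (p := p) ℓ y.1
  obtain ⟨e', he'⟩ := mkL_surj (p := q) ℓ' y.2
  refine ⟨F, G, e, e', hF0, hG0, fun w => ?_, fun w => ?_, fun w w' a h1 h2 t => ?_⟩
  · rw [← mkL_eq_iff, he, hF]; simp [H1]
  · rw [← mkL_eq_iff, he', hG]; simp [H2]
  · have hw : i w = i w' := by
      apply Subtype.ext
      simp only [i]
      rw [h1, h2, mkL_la]
    refine ⟨hFe w w' a hw h1 t, ?_⟩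
    have := hGe w w' 0 hw (by simp only [ContinuousMap.coe_mk]; rw [h2, la_zero]) t
    rw [this, la_zero]

end lift

section norml
variable {k : ℕ}

/-- normalization -/
noncomputable def nz (z : EuclideanSpace ℂ (Fin k)) (h : z ≠ 0) : Sp k :=
  ⟨(‖z‖⁻¹ : ℝ) • z, by
    rw [mem_sphere_zero_iff_norm, norm_smul, norm_inv, Real.norm_eq_abs, abs_norm,
      inv_mul_cancel₀ (norm_ne_zero_iff.2 h)]⟩

/-- real coordinates to complex coordinates -/
noncomputable def tc (y : Fin (2 * k) → ℝ) : EuclideanSpace ℂ (Fin k) :=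
  WithLp.toLp 2 fun j => (⟨y ⟨2 * j.1, by omega⟩, y ⟨2 * j.1 + 1, by omega⟩⟩ : ℂ)

noncomputable def fc (z : EuclideanSpace ℂ (Fin k)) : Fin (2 * k) → ℝ :=
  fun i => if i.1 % 2 = 0 then (z ⟨i.1 / 2, by omega⟩).re else (z ⟨i.1 / 2, by omega⟩).im

lemma fc_tc (y : Fin (2 * k) → ℝ) : fc (tc y) = y := by
  funext i
  simp only [fc, tc]
  split_ifs with h
  · congr 1; apply Fin.ext; simp only; omega
  · congr 1; apply Fin.ext; simp only; omega

lemma fc_smul (a : ℝ) (z : EuclideanSpace ℂ (Fin k)) : fc (a • z) = a • fc z := by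
  funext i; simp only [fc, Pi.smul_apply, PiLp.smul_apply]; split_ifs <;> simp

lemma fc_zero {z : EuclideanSpace ℂ (Fin k)} (h : fc z = 0) : z = 0 := by
  ext j
  apply Complex.ext
  · have := congrFun h ⟨2 * j.1, by omega⟩
    simpa [fc] using this
  · have := congrFun h ⟨2 * j.1 + 1, by omega⟩
    simp only [fc] at this
    rw [if_neg (by omega)] at this
    have h2 : (⟨(2 * j.1 + 1) / 2, by omega⟩ : Fin k) = j := Fin.ext (by simp only; omega)
    rw [h2] at this
    simpa using this

lemma tc_cont : Continuous (tc (k := k)) := by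
  unfold tc
  refine (PiLp.continuous_toLp 2 _).comp (continuous_pi fun j => ?_)
  have : (fun y : Fin (2 * k) → ℝ => (⟨y ⟨2 * j.1, by omega⟩, y ⟨2 * j.1 + 1, by omega⟩⟩ : ℂ))
      = fun y => (y ⟨2 * j.1, by omega⟩ : ℂ) + (y ⟨2 * j.1 + 1, by omega⟩ : ℂ) * Complex.I := by
    funext y; apply Complex.ext <;> simp
  rw [this]
  fun_prop

lemma fc_cont : Continuous (fc (k := k)) := by
  refine continuous_pi fun i => ?_
  simp only [fc]
  split_ifs <;> fun_prop

abbrev YV (k : ℕ) : Type := {v : (Fin k → ℂ) × (Fin (2 * k) → ℝ) // VV v}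

instance : CompactSpace (YV k) := by
  suffices h : IsCompact {v : (Fin k → ℂ) × (Fin (2 * k) → ℝ) | VV v} from isCompact_iff_compactSpace.1 h
  refine (isCompact_closedBall (0 : (Fin k → ℂ) × (Fin (2 * k) → ℝ)) 1).of_isClosed_subset ?_ ?_
  · apply IsClosed.inter
    · exact isClosed_eq (by fun_prop) continuous_const
    · exact isClosed_eq (by fun_prop) continuous_const
  · intro v hv
    rw [mem_closedBall_zero_iff, Prod.norm_def]
    refine max_le ((pi_norm_le_iff_of_nonneg zero_le_one).2 fun j => ?_)
      ((pi_norm_le_iff_of_nonneg zero_le_one).2 fun j => ?_)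
    · rw [← hv.1]
      exact Finset.single_le_sum (f := fun j => ‖v.1 j‖) (fun j _ => norm_nonneg _) (Finset.mem_univ j)
    · rw [← hv.2]
      exact Finset.single_le_sum (f := fun j => |v.2 j|) (fun j _ => abs_nonneg _) (Finset.mem_univ j)

lemma YV_ne1 (v : YV k) : WithLp.toLp 2 v.1.1 ≠ (0 : EuclideanSpace ℂ (Fin k)) := by
  intro h
  have h1 := v.2.1
  have : ∀ j, v.1.1 j = 0 := fun j => by
    have := congrArg (fun z : EuclideanSpace ℂ (Fin k) => z j) h
    simpa using this
  simp [this] at h1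

lemma YV_ne2 (v : YV k) : tc v.1.2 ≠ 0 := by
  intro h
  have h1 := v.2.2
  have : v.1.2 = 0 := by
    rw [← fc_tc v.1.2, h]; funext i; simp [fc]
  simp [this] at h1

lemma nz_cont {W : Type*} [TopologicalSpace W] (f : W → EuclideanSpace ℂ (Fin k)) (h : ∀ w, f w ≠ 0)
    (hf : Continuous f) : Continuous fun w => nz (f w) (h w) := by
  refine Continuous.subtype_mk ?_ _
  exact (hf.norm.inv₀ fun w => norm_ne_zero_iff.2 (h w)).smul hf

noncomputable def Ph : C(YV k, Sp k × Sp k) :=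
  ⟨fun v => (nz _ (YV_ne1 v), nz _ (YV_ne2 v)), by
    refine (nz_cont _ YV_ne1 ?_).prodMk (nz_cont _ YV_ne2 ?_)
    · exact (PiLp.continuous_toLp 2 _).comp (by fun_prop)
    · exact tc_cont.comp (by fun_prop)⟩

end norml
end LS


namespace LS
open Topology unitInterval

lemma ev_const {W Z : Type*} [TopologicalSpace W] [TopologicalSpace Z] [T1Space Z] {f : W → Z}
    (hf : Continuous f) {S : Set Z} (hS : S.Finite) (h : ∀ w, f w ∈ S) (v : W) :
    ∀ᶠ w in 𝓝 v, f w = f v := by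
  have hc : IsClosed (S \ {f v}) := (hS.subset Set.diff_subset).isClosed
  have : (S \ {f v})ᶜ ∈ 𝓝 (f v) := hc.isOpen_compl.mem_nhds (by simp)
  filter_upwards [hf.continuousAt.eventually this] with w hw
  by_contra hne
  exact hw ⟨h w, hne⟩

/-- Lebesgue number packaging. -/
lemma leb {Y A : Type*} [MetricSpace Y] [CompactSpace Y] {N : ℕ} (hN : 0 < N) (W : ℕ → Set Y)
    (E : ℕ → Y → A) (hcov : ∀ v, ∃ i < N, v ∈ W i)
    (hW : ∀ i, IsOpen (W i)) (hE : ∀ i, ∀ v ∈ W i, ∀ᶠ w in 𝓝 v, E i w = E i v) :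
    ∃ δ > 0, ∀ l : List Y, (∀ a ∈ l, ∀ b ∈ l, dist a b < δ) →
      ∃ i < N, ∀ a ∈ l, ∃ e, ∀ w, dist w a < δ → w ∈ W i ∧ E i w = e := by
  let c : ℕ × A → Set Y := fun x => {v | x.1 < N ∧ v ∈ W x.1 ∧ E x.1 v = x.2}
  have hc : ∀ x, IsOpen (c x) := by
    intro x
    rw [isOpen_iff_mem_nhds]
    rintro v ⟨h1, h2, h3⟩
    filter_upwards [(hW x.1).mem_nhds h2, hE x.1 v h2] with w hw hw'
    exact ⟨h1, hw, hw'.trans h3⟩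
  obtain ⟨δ, hδ, h⟩ := lebesgue_number_lemma_of_metric (s := Set.univ) isCompact_univ hc (by
    intro v _
    obtain ⟨i, hi, hv⟩ := hcov v
    exact Set.mem_iUnion.2 ⟨(i, E i v), hi, hv, rfl⟩)
  refine ⟨δ / 2, by positivity, fun l hl => ?_⟩
  cases l with
  | nil => exact ⟨0, hN, by simp⟩
  | cons a l =>
    obtain ⟨⟨i, e⟩, hie⟩ := h a trivial
    refine ⟨i, (hie (Metric.mem_ball_self hδ)).1, fun b hb => ⟨e, fun w hw => ?_⟩⟩
    have : w ∈ Metric.ball a δ := by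
      rw [Metric.mem_ball]
      have := hl b hb a (by simp)
      linarith [dist_triangle w b a]
    exact (hie this).2

section
variable {k : ℕ}

lemma gP_dist (θ : ℕ → ℝ) (v w : (Fin k → ℂ) × (Fin (2 * k) → ℝ)) :
    dist (Prod.map (gA θ) id v) (Prod.map (gA θ) id w) = dist v w := by
  simp only [Prod.dist_eq, Prod.map_fst, Prod.map_snd, id]
  congr 1
  simp only [dist_pi_def]
  congr 1
  apply congrArg
  funext j
  apply NNReal.eq
  simp only [coe_nndist, gA, dist_eq_norm, ← mul_sub, norm_mul, Complex.norm_exp_ofReal_mul_I, one_mul]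

lemma gA_VV (θ : ℕ → ℝ) {v : (Fin k → ℂ) × (Fin (2 * k) → ℝ)} (h : VV v) :
    VV (Prod.map (gA θ) id v) := by
  refine ⟨?_, h.2⟩
  simpa [gA, Complex.norm_exp_ofReal_mul_I] using h.1

lemma gA_inv (θ : ℕ → ℝ) (v : (Fin k → ℂ) × (Fin (2 * k) → ℝ)) :
    Prod.map (gA θ) id (Prod.map (gA fun j => - θ j) id v) = v := by
  refine Prod.ext ?_ rfl
  funext j
  simp [gA, ← mul_assoc, ← Complex.exp_add]

noncomputable def gY (θ : ℕ → ℝ) (v : YV k) : YV k := ⟨_, gA_VV θ v.2⟩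

noncomputable def thL (p : ℕ) (ℓ : Fin k → ℤ) (j : ℕ) : ℝ :=
  if h : j < k then 2 * Real.pi * ℓ ⟨j, h⟩ / p else 0

lemma thL_exp (p : ℕ) [NeZero p] (ℓ : Fin k → ℤ) (j : Fin k) :
    Complex.exp (thL p ℓ j * Complex.I) = (ZMod.toCircle ((ℓ j : ℤ) : ZMod p) : ℂ) := by
  rw [ZMod.toCircle_intCast]
  congr 1
  simp [thL]
  ring

lemma thL_pow (p : ℕ) [NeZero p] (ℓ : Fin k → ℤ) (j : ℕ) :
    Complex.exp (thL p ℓ j * Complex.I) ^ p = 1 := by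
  by_cases h : j < k
  · have := thL_exp p ℓ ⟨j, h⟩
    simp only at this
    rw [this, ← Circle.coe_pow, ← AddChar.map_nsmul_eq_pow]
    simp
  · simp [thL, h]

lemma Ph_gY1 (p : ℕ) [NeZero p] (ℓ : Fin k → ℤ) (v : YV k) :
    (Ph (gY (thL p ℓ) v)).1 = la ℓ (1 : ZMod p) (Ph v).1 := by
  apply Sp.ext'
  intro j
  have hn : ‖(WithLp.toLp 2 (gY (thL p ℓ) v).1.1 : EuclideanSpace ℂ (Fin k))‖
      = ‖(WithLp.toLp 2 v.1.1 : EuclideanSpace ℂ (Fin k))‖ := by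
    rw [EuclideanSpace.norm_eq, EuclideanSpace.norm_eq]
    simp [gY, gA, Complex.norm_exp_ofReal_mul_I]
  have h1 : (Ph (gY (thL p ℓ) v)).1.1 j = (‖(WithLp.toLp 2 (gY (thL p ℓ) v).1.1 : EuclideanSpace ℂ (Fin k))‖⁻¹ : ℝ) •
     (Complex.exp (thL p ℓ j * Complex.I) * v.1.1 j) := rfl
  have h2 : (Ph v).1.1 j = (‖(WithLp.toLp 2 v.1.1 : EuclideanSpace ℂ (Fin k))‖⁻¹ : ℝ) • v.1.1 j := rfl
  rw [h1, la_apply, h2, hn, thL_exp, one_mul, mul_smul_comm]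

lemma Ph_gY2 (θ : ℕ → ℝ) (v : YV k) : (Ph (gY θ v)).2 = (Ph v).2 := rfl

end
end LS


namespace LS
open Topology unitInterval

section
variable {k : ℕ}

theorem low_contra (hk : 1 ≤ k) (p q : ℕ) (hp : 1 < p) (hq : 1 < q) (ℓ ℓ' : Fin k → ℤ)
    (hℓ : ∀ j, IsCoprime (ℓ j) (p : ℤ)) (hℓ' : ∀ j, IsCoprime (ℓ' j) (q : ℤ))
    (U : ℕ → Set (LensSpace p k ℓ × LensSpace q k ℓ')) (hUo : ∀ i, IsOpen (U i))
    (hcov : ∀ x, ∃ i < 2 * k, x ∈ U i)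
    (hU : ∀ i, ContinuousMap.Nullhomotopic (⟨Subtype.val, continuous_subtype_val⟩ : C(U i, _))) :
    False := by
  classical
  haveI : NeZero p := ⟨by omega⟩
  haveI : NeZero q := ⟨by omega⟩
  let θ := thL p ℓ
  let Φ : YV k → LensSpace p k ℓ × LensSpace q k ℓ' := fun v => (mkL p ℓ (Ph v).1, mkL q ℓ' (Ph v).2)
  have hΦ : Continuous Φ := ((mkL_quot ℓ).continuous.comp (continuous_fst.comp Ph.continuous)).prodMk
      ((mkL_quot ℓ').continuous.comp (continuous_snd.comp Ph.continuous))
  have hΦg : ∀ v, Φ (gY θ v) = Φ v := fun v => by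
    simp only [Φ]; rw [Ph_gY1, Ph_gY2, mkL_la]
  let W : ℕ → Set (YV k) := fun i => Φ ⁻¹' U i
  have hWo : ∀ i, IsOpen (W i) := fun i => (hUo i).preimage hΦ
  have hWg : ∀ i v, gY θ v ∈ W i ↔ v ∈ W i := fun i v => by
    simp only [W, Set.mem_preimage, hΦg]
  have key : ∀ i, ∃ (F G : C(I × W i, Sp k)) (e e' : Sp k), _ := fun i =>
    lift_null ℓ ℓ' hℓ hℓ' (U i) (hU i) (W := W i)
    ⟨fun w => Ph w.1, by fun_prop⟩ (fun w => w.2)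
  choose F G e e' hF0 hG0 hFe hGe heq using key
  simp only [ContinuousMap.coe_mk] at hF0 hG0 heq
  choose a ha using hFe
  let E : ℕ → YV k → ZMod p × Sp k := fun i v =>
    if h : v ∈ W i then (a i ⟨v, h⟩, G i (1, ⟨v, h⟩)) else (0, e i)
  have hE : ∀ i v (h : v ∈ W i), E i v = (a i ⟨v, h⟩, G i (1, ⟨v, h⟩)) := fun i v h => by
    simp only [E, dif_pos h]
  have ainj : ∀ i v (h : v ∈ W i) v' (h' : v' ∈ W i) (b : ZMod p), F i (1, ⟨v', h'⟩) = la ℓ b (F i (1, ⟨v, h⟩)) →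
      a i ⟨v', h'⟩ = b + a i ⟨v, h⟩ := by
    intro i v h v' h' b hb
    rw [ha, ha, ← la_add] at hb
    have : la ℓ (a i ⟨v', h'⟩ - (b + a i ⟨v, h⟩)) (la ℓ (b + a i ⟨v, h⟩) (e i)) = la ℓ (b + a i ⟨v, h⟩) (e i) := by
      rw [← la_add, sub_add_cancel, hb]
    exact sub_eq_zero.1 (la_free ℓ hℓ _ _ this)
  have hEloc : ∀ i, ∀ v ∈ W i, ∀ᶠ w in 𝓝 v, E i w = E i v := by
    intro i v hv
    have h1 := ev_const (f := fun w : W i => F i (1, w)) (by fun_prop)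
      (S := Set.range fun b : ZMod p => la ℓ b (e i)) (Set.finite_range _) (fun w => ⟨_, (ha i w).symm⟩) ⟨v, hv⟩
    have h2 := ev_const (f := fun w : W i => G i (1, w)) (by fun_prop)
      (S := Set.range fun b : ZMod q => la ℓ' b (e' i)) (Set.finite_range _)
      (fun w => by obtain ⟨b, hb⟩ := hGe i w; exact ⟨b, hb.symm⟩) ⟨v, hv⟩
    have h3 := h1.and h2
    rw [nhds_subtype_eq_comap, Filter.eventually_comap] at h3
    filter_upwards [h3, (hWo i).mem_nhds hv] with w hw hwi
    obtain ⟨h4, h5⟩ := hw ⟨w, hwi⟩ rfl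
    rw [hE i w hwi, hE i v hv]
    refine Prod.ext ?_ h5
    have := ainj i v hv w hwi 0 (by rw [la_zero]; exact h4)
    simpa using this
  have hEg : ∀ i v (h : v ∈ W i), E i (gY θ v) = (E i v).map (fun b => b + 1) id := by
    intro i v h
    have h' := (hWg i v).2 h
    have := fun t => heq i ⟨v, h⟩ ⟨_, h'⟩ 1 (Ph_gY1 p ℓ v) (Ph_gY2 _ v) t
    rw [hE i _ h', hE i v h]
    refine Prod.ext ?_ (this 1).2
    rw [ainj i v h _ h' 1 (this 1).1]
    simp [add_comm]
  have hkk : 0 < 2 * k := by omega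
  obtain ⟨δ, hδ, hleb⟩ := leb hkk W E (fun v => hcov (Φ v)) hWo hEloc
  let n := 2 * k - 1
  -- the homotopy
  let Hc : I × W n → (Fin (2 * k) → ℝ) := fun s =>
    ((1 - s.1.1) * ‖tc s.2.1.1.2‖ + s.1.1) • fc (G n (s.1, s.2)).1
  have hHc : Continuous Hc := by
    have h2 : Continuous fun s : I × W n => fc (G n (s.1, s.2)).1 :=
      fc_cont.comp (continuous_subtype_val.comp (G n).continuous)
    have := tc_cont (k := k)
    have h1 : Continuous fun s : I × W n => ((1 - s.1.1) * ‖tc s.2.1.1.2‖ + s.1.1) := by fun_prop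
    exact h1.smul h2
  have hHne : ∀ s, Hc s ≠ 0 := by
    intro s h
    rcases smul_eq_zero.1 h with h | h
    · have h1 := norm_pos_iff.2 (YV_ne2 s.2.1)
      have h2 := s.1.2.1
      have h3 := s.1.2.2
      rcases h2.eq_or_lt with h4 | h4
      · rw [← h4] at h; simp at h; rw [h] at h1; simp at h1
      · have : 0 ≤ (1 - s.1.1) * ‖tc s.2.1.1.2‖ := mul_nonneg (by linarith) h1.le
        linarith
    · have := fc_zero h
      have h2 := (G n (s.1, s.2)).2
      rw [this] at h2; simp at h2
  let C : Set (YV k) := {v | ∀ w, dist w v < δ → w ∈ W n}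
  have hC : IsClosed C := by
    have : C = ⋂ w ∈ (W n)ᶜ, {v | δ ≤ dist w v} := by
      ext v
      simp only [C, Set.mem_setOf_eq, Set.mem_iInter, Set.mem_compl_iff]
      exact ⟨fun h w hw => by by_contra hh; exact hw (h w (not_le.1 hh)),
        fun h w hw => by by_contra hh; exact absurd (h w hh) (not_le.2 hw)⟩
    rw [this]
    exact isClosed_biInter fun w _ => isClosed_le continuous_const (by fun_prop)
  haveI : CompactSpace C := isCompact_iff_compactSpace.1 hC.isCompact
  have hCW : ∀ v ∈ C, v ∈ W n := fun v hv => hv v (by simpa using hδ)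
  let Hd : I × C → (Fin (2 * k) → ℝ) := fun s => Hc (s.1, ⟨s.2.1, hCW _ s.2.2⟩)
  have hHd : Continuous Hd := hHc.comp (by fun_prop)
  obtain ⟨c, hc0, hc⟩ : ∃ c > 0, ∀ s, c ≤ ‖Hd s‖ := by
    rcases isEmpty_or_nonempty (I × C) with h | h
    · exact ⟨1, one_pos, fun s => h.elim s⟩
    · obtain ⟨s, _, hs⟩ := isCompact_univ.exists_isMinOn Set.univ_nonempty hHd.norm.continuousOn
      exact ⟨‖Hd s‖, norm_pos_iff.2 (hHne _), fun t => hs (Set.mem_univ t)⟩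
  have hu : UniformContinuous Hd := CompactSpace.uniformContinuous_of_continuous hHd
  obtain ⟨ε', hε', hu⟩ := Metric.uniformContinuous_iff.1 hu c hc0
  obtain ⟨M0, hM0⟩ := exists_nat_gt (1 / ε')
  let M := M0 + 1
  have hM : (1 : ℝ) / M < ε' := by
    rw [div_lt_iff₀ (by simp [M]; positivity)]
    rw [div_lt_iff₀ hε'] at hM0
    simp only [M]; push_cast; nlinarith
  let ε := min (min (δ / 2) (ε' / 2)) (1 / (4 * k : ℝ))
  have hkr : (0 : ℝ) < k := by exact_mod_cast hk
  have hε : 0 < ε := by simp only [ε]; positivity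
  have hεδ : ε < δ := lt_of_le_of_lt ((min_le_left _ _).trans (min_le_left _ _)) (by linarith)
  have hεε : ε < ε' := lt_of_le_of_lt ((min_le_left _ _).trans (min_le_right _ _)) (by linarith)
  have hεk : ε < 1 / (2 * k) := lt_of_le_of_lt (min_le_right _ _) (by
    apply one_div_lt_one_div_of_lt <;> linarith)
  let KY : ℕ → YV k → Prop := fun i v => ∃ e, ∀ w, dist w v < δ → w ∈ W i ∧ E i w = e
  have hKW : ∀ i v, KY i v → v ∈ W i := fun i v ⟨e, h⟩ => (h v (by simpa using hδ)).1
  have hKC : ∀ v, KY n v → v ∈ C := fun v ⟨e, h⟩ w hw => (h w hw).1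
  have hKE : ∀ i v w, KY i v → dist v w ≤ ε → E i v = E i w := by
    rintro i v w ⟨e, h⟩ hd
    rw [(h v (by simpa using hδ)).2, (h w (by rw [dist_comm]; linarith)).2]
  have hgd : ∀ v w : YV k, dist (gY θ v) (gY θ w) = dist v w := fun v w => gP_dist θ v.1 w.1
  have hKg : ∀ i v, KY i (gY θ v) ↔ KY i v := by
    intro i v
    constructor
    · rintro ⟨e, h⟩
      refine ⟨e.map (fun b => b - 1) id, fun w hw => ?_⟩
      have h1 := h (gY θ w) (by rwa [hgd])
      have h2 := (hWg i w).1 h1.1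
      refine ⟨h2, ?_⟩
      rw [← h1.2, hEg i w h2]
      simp [Prod.map]
    · rintro ⟨e, h⟩
      refine ⟨e.map (fun b => b + 1) id, fun w hw => ?_⟩
      have h0 : gY θ (gY (fun j => - θ j) w) = w := Subtype.ext (gA_inv θ w.1)
      rw [← h0, hgd] at hw
      have h1 := h _ hw
      rw [← h0]
      refine ⟨(hWg i _).2 h1.1, ?_⟩
      rw [hEg i _ h1.1, h1.2]
  let T := (Fin k → ℂ) × (Fin (2 * k) → ℝ)
  let K : ℕ → T → Prop := fun i v => ∃ h : VV v, KY i ⟨v, h⟩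
  let u : ℕ → T → ZMod p := fun i v => if h : VV v then (E i ⟨v, h⟩).1 else 0
  have hI : ∀ j : ℕ, j ≤ M → ((j : ℝ) / M) ∈ I := fun j hj => by
    have : (0 : ℝ) < M := by simp [M]; positivity
    refine ⟨by positivity, (div_le_one this).2 (by exact_mod_cast hj)⟩
  let H : ℕ → T → (Fin (2 * k) → ℝ) := fun j v =>
    if h : ∃ h : VV v, (⟨v, h⟩ : YV k) ∈ C then Hd (Set.projIcc 0 1 zero_le_one ((j : ℝ) / M), ⟨⟨v, h.1⟩, h.2⟩) else 0
  have hH : ∀ j v (h : K n v), H j v = Hd (Set.projIcc 0 1 zero_le_one ((j : ℝ) / M), ⟨⟨v, h.1⟩, hKC _ h.2⟩) := by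
    intro j v h
    have : ∃ h : VV v, (⟨v, h⟩ : YV k) ∈ C := ⟨h.1, hKC _ h.2⟩
    simp only [H, dif_pos this]
  have hdd : ∀ j j' : ℕ, |(j : ℝ) / M - j' / M| < ε' → ∀ v w, K n v → K n w → dist v w ≤ ε → 
      dist (H j v) (H j' w) < c := by
    intro j j' hj v w hv hw hvw
    rw [hH j v hv, hH j' w hw]
    apply hu
    rw [Prod.dist_eq]
    refine max_lt ?_ (lt_of_le_of_lt hvw hεε)
    refine lt_of_le_of_lt ?_ hj
    rw [Subtype.dist_eq, Real.dist_eq]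
    exact Set.abs_projIcc_sub_projIcc zero_le_one
  have hM1 : (0 : ℝ) < M := by simp only [M]; push_cast; positivity
  refine geo_contra hk p hp θ (thL_pow p ℓ) ε hε hεk K u ?_ ?_ ?_ ?_ H M c ?_ ?_ ?_ ?_ ?_
  · intro i v hv
    have := hKg i ⟨v, hv⟩
    exact ⟨fun ⟨_, h⟩ => ⟨hv, this.1 h⟩, fun ⟨_, h⟩ => ⟨gA_VV θ hv, this.2 h⟩⟩
  · rintro i v hv ⟨_, h⟩
    have h1 := hEg i ⟨v, hv⟩ (hKW _ _ h)
    simp only [u]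
    rw [dif_pos hv, dif_pos (gA_VV θ hv)]
    exact congrArg Prod.fst h1
  · rintro i v w hv hw ⟨_, h1⟩ _ hd
    simp only [u]
    rw [dif_pos hv, dif_pos hw, hKE i _ ⟨w, hw⟩ h1 hd]
  · intro l hl hd
    obtain ⟨i, hi, h⟩ := hleb (l.pmap (fun v h => ⟨v, h⟩) hl) (by
      intro a ha b hb
      obtain ⟨a', ha', rfl⟩ := List.mem_pmap.1 ha
      obtain ⟨b', hb', rfl⟩ := List.mem_pmap.1 hb
      exact lt_of_le_of_lt (hd _ ha' _ hb') hεδ)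
    refine ⟨i, hi, fun v hv => ⟨hl v hv, h _ (List.mem_pmap.2 ⟨v, hv, rfl⟩)⟩⟩
  · intro v hv hK
    rw [hH 0 v hK]
    have h0 : Set.projIcc (0:ℝ) 1 zero_le_one (((0 : ℕ) : ℝ) / M) = 0 := by simp
    rw [h0]
    simp only [Hd, Hc]
    rw [hG0]
    have : (Ph ⟨v, hv⟩).2.1 = (‖tc v.2‖⁻¹ : ℝ) • tc v.2 := rfl
    rw [this, fc_smul, fc_tc]
    have := norm_ne_zero_iff.2 (YV_ne2 ⟨v, hv⟩)
    simp only [Set.Icc.coe_zero, sub_zero, one_mul, add_zero]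
    rw [smul_smul, mul_inv_cancel₀ this, one_smul]
  · intro j hj v hv hK
    have hK' : K n (Prod.map (gA θ) id v) := ⟨gA_VV θ hv, (hKg n ⟨v, hv⟩).2 hK.2⟩
    rw [hH j v hK, hH j _ hK']
    simp only [Hd, Hc]
    have := (heq n ⟨⟨v, hv⟩, hKW _ _ hK.2⟩ ⟨gY θ ⟨v, hv⟩, hKW _ _ hK'.2⟩ 1 (Ph_gY1 p ℓ _) (Ph_gY2 _ _)
      (Set.projIcc 0 1 zero_le_one ((j : ℝ) / M))).2
    simp only [gY] at this
    rw [this]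
    rfl
  · intro j hj v hv hK
    rw [hH j v hK]
    by_contra hh
    push Not at hh
    have h1 := hc (Set.projIcc 0 1 zero_le_one ((j : ℝ) / M), ⟨⟨v, hK.1⟩, hKC _ hK.2⟩)
    exact absurd h1 (not_le.2 ((pi_norm_lt_iff hc0).2 hh))
  · intro j hj v w hv hw hKv hKw hd
    refine ⟨hdd _ _ (by simpa using hε') _ _ hKv hKw hd, hdd _ _ ?_ _ _ hKv hKw hd,
      hdd _ _ (by simpa using hε') _ _ hKv hKw hd⟩
    rw [← sub_div]; push_cast
    rw [abs_div, abs_of_pos hM1]; simpa using hM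
  · intro v w hv hw hKv hKw hd
    rw [hH _ v hKv, hH _ w hKw]
    have h0 : Set.projIcc (0:ℝ) 1 zero_le_one ((M : ℝ) / M) = 1 := by
      rw [div_self hM1.ne']; simp
    rw [h0]
    have h1 := hKE n ⟨v, hv⟩ ⟨w, hw⟩ hKv.2 hd
    rw [hE _ _ (hKW _ _ hKv.2), hE _ _ (hKW _ _ hKw.2)] at h1
    have h2 := congrArg Prod.snd h1
    simp only at h2
    simp only [Hd, Hc]
    rw [h2]
    simp
    rfl

end
end LS


namespace LS.Up
set_option linter.all false
open Topology unitInterval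

section Hm
variable {X Y Z W : Type*} [TopologicalSpace X] [TopologicalSpace Y] [TopologicalSpace Z] [TopologicalSpace W]

/-- homotopy of plain functions relative to a set -/
def Hm (A : Set X) (f g : X → Y) : Prop :=
  ∃ H : I × X → Y, Continuous H ∧ (∀ x, H (0, x) = f x) ∧ (∀ x, H (1, x) = g x) ∧
    ∀ t, ∀ x ∈ A, H (t, x) = f x

lemma Hm.left {A : Set X} {f g : X → Y} (h : Hm A f g) : Continuous f := by
  obtain ⟨H, hc, h0, -, -⟩ := h
  have : f = fun x => H (0, x) := funext fun x => (h0 x).symm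
  rw [this]; fun_prop

lemma Hm.right {A : Set X} {f g : X → Y} (h : Hm A f g) : Continuous g := by
  obtain ⟨H, hc, -, h0, -⟩ := h
  have : g = fun x => H (1, x) := funext fun x => (h0 x).symm
  rw [this]; fun_prop

lemma Hm.eq_on {A : Set X} {f g : X → Y} (h : Hm A f g) {x : X} (hx : x ∈ A) : f x = g x := by
  obtain ⟨H, hc, -, h1, h⟩ := h
  rw [← h1, h 1 x hx]

lemma Hm.iff {A : Set X} {f g : X → Y} (hf : Continuous f) (hg : Continuous g) :
    Hm A f g ↔ ContinuousMap.HomotopicRel ⟨f, hf⟩ ⟨g, hg⟩ A := by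
  constructor
  · rintro ⟨H, hc, h0, h1, h⟩
    exact ⟨⟨⟨⟨H, hc⟩, h0, h1⟩, fun t x hx => h t x hx⟩⟩
  · rintro ⟨H⟩
    exact ⟨H, H.continuous, fun x => H.apply_zero x, fun x => H.apply_one x,
      fun t x hx => H.prop t x hx⟩

lemma Hm.refl (A : Set X) {f : X → Y} (hf : Continuous f) : Hm A f f :=
  (Hm.iff hf hf).2 (.refl _)

lemma Hm.of_eq (A : Set X) {f g : X → Y} (hf : Continuous f) (h : ∀ x, f x = g x) : Hm A f g := by
  have : f = g := funext h
  rw [← this]; exact .refl A hf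

lemma Hm.symm {A : Set X} {f g : X → Y} (h : Hm A f g) : Hm A g f :=
  (Hm.iff h.right h.left).2 ((Hm.iff h.left h.right).1 h).symm

lemma Hm.trans {A : Set X} {f g h : X → Y} (h1 : Hm A f g) (h2 : Hm A g h) : Hm A f h :=
  (Hm.iff h1.left h2.right).2
    (((Hm.iff h1.left h1.right).1 h1).trans ((Hm.iff h2.left h2.right).1 h2))

lemma Hm.mono {A B : Set X} {f g : X → Y} (h : Hm A f g) (hB : B ⊆ A) : Hm B f g := by
  obtain ⟨H, hc, h0, h1, h⟩ := h
  exact ⟨H, hc, h0, h1, fun t x hx => h t x (hB hx)⟩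

/-- post-composition -/
lemma Hm.post {A : Set X} {f g : X → Y} (h : Hm A f g) {φ : Y → Z} (hφ : Continuous φ) :
    Hm A (fun x => φ (f x)) (fun x => φ (g x)) := by
  obtain ⟨H, hc, h0, h1, h⟩ := h
  exact ⟨fun p => φ (H p), hφ.comp hc, fun x => by simp only [h0], fun x => by simp only [h1],
    fun t x hx => by simp only [h t x hx]⟩

/-- pre-composition -/
lemma Hm.pre {A : Set X} {B : Set W} {f g : X → Y} (h : Hm A f g) {φ : W → X} (hφ : Continuous φ)
    (hB : ∀ x ∈ B, φ x ∈ A) : Hm B (fun x => f (φ x)) (fun x => g (φ x)) := by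
  obtain ⟨H, hc, h0, h1, h⟩ := h
  exact ⟨fun p => H (p.1, φ p.2), by fun_prop, fun x => by simp only [h0], fun x => by simp only [h1],
    fun t x hx => h t _ (hB x hx)⟩

lemma Hm.prod {A : Set X} {f g : X → Y} {f' g' : X → Z} (h : Hm A f g) (h' : Hm A f' g') :
    Hm A (fun x => (f x, f' x)) (fun x => (g x, g' x)) := by
  obtain ⟨H, hc, h0, h1, h⟩ := h
  obtain ⟨H', hc', h0', h1', h'⟩ := h'
  exact ⟨fun p => (H p, H' p), by fun_prop, fun x => by simp only [h0, h0'],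
    fun x => by simp only [h1, h1'], fun t x hx => by simp only [h t x hx, h' t x hx]⟩

lemma Hm.map2 {A : Set X} {f g : X → Y} {f' g' : X → Z} (h : Hm A f g) (h' : Hm A f' g')
    {R : Y → Z → W} (hR : Continuous fun p : Y × Z => R p.1 p.2) :
    Hm A (fun x => R (f x) (f' x)) (fun x => R (g x) (g' x)) :=
  (h.prod h').post hR

end Hm

/-! radial maps -/

lemma cont_rad {X : Type*} [TopologicalSpace X] {r : X → ℝ} {u : X → ℂ} (hr : Continuous r)
    (hu : ∀ x, ‖u x‖ ≤ 1) (hc : ∀ x, r x ≠ 0 → ContinuousAt u x) :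
    Continuous fun x => (r x : ℂ) * u x := by
  rw [continuous_iff_continuousAt]
  intro x
  by_cases h : r x = 0
  · rw [ContinuousAt, h, Complex.ofReal_zero, zero_mul, tendsto_zero_iff_norm_tendsto_zero]
    have h2 : Filter.Tendsto (fun x => |r x|) (𝓝 x) (𝓝 0) := by
      have := (continuous_abs.comp hr).continuousAt (x := x)
      rw [ContinuousAt] at this
      simp only [Function.comp_def, h, abs_zero] at this
      exact this
    refine squeeze_zero (fun _ => norm_nonneg _) (fun y => ?_) h2
    rw [norm_mul, Complex.norm_real, Real.norm_eq_abs]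
    nlinarith [abs_nonneg (r y), hu y]
  · exact (Complex.continuous_ofReal.comp hr).continuousAt.mul (hc x h)

/-- radial power -/
noncomputable def pw (m : ℤ) (z : ℂ) : ℂ := (‖z‖ : ℂ) * ((if z = 0 then 1 else z / ‖z‖) ^ m)

lemma dir_norm (z : ℂ) : ‖(if z = 0 then 1 else z / ‖z‖ : ℂ)‖ = 1 := by
  split_ifs with h
  · simp
  · simp [norm_ne_zero_iff.2 h]

lemma dir_eq (z : ℂ) : z = (‖z‖ : ℂ) * (if z = 0 then 1 else z / ‖z‖ : ℂ) := by
  split_ifs with h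
  · simp [h]
  · have : (‖z‖ : ℂ) ≠ 0 := by simpa using h
    field_simp

lemma exists_polar (z : ℂ) : ∃ (r : ℝ) (c : ℂ), 0 ≤ r ∧ ‖c‖ = 1 ∧ z = r * c :=
  ⟨‖z‖, _, norm_nonneg _, dir_norm z, dir_eq z⟩

lemma pw_polar (m : ℤ) {r : ℝ} {c : ℂ} (hr : 0 ≤ r) (hc : ‖c‖ = 1) : pw m (r * c) = r * c ^ m := by
  have hc0 : c ≠ 0 := by intro h; simp [h] at hc
  have h1 : ‖(r * c : ℂ)‖ = r := by rw [norm_mul, hc, mul_one, Complex.norm_real, Real.norm_eq_abs, abs_of_nonneg hr]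
  rw [pw, h1]
  rcases hr.eq_or_lt with h | h
  · simp [← h]
  · have : (r : ℂ) ≠ 0 := by exact_mod_cast h.ne'
    rw [if_neg (by simp [this, hc0]), mul_comm (r : ℂ) c, mul_div_assoc, div_self this, mul_one]

@[simp] lemma norm_pw (m : ℤ) (z : ℂ) : ‖pw m z‖ = ‖z‖ := by
  rw [pw, norm_mul, norm_zpow, dir_norm]; simp

lemma pw_cont (m : ℤ) : Continuous (pw m) := by
  refine cont_rad continuous_norm (fun z => by rw [norm_zpow, dir_norm, one_zpow]) fun z hz => ?_
  have hz0 : z ≠ 0 := norm_ne_zero_iff.1 hz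
  have hd : ContinuousAt (fun z : ℂ => (z / ‖z‖) ^ m) z := by
    have h1 : ContinuousAt (fun z : ℂ => z / (‖z‖ : ℂ)) z :=
      continuousAt_id.div (by fun_prop) (by simpa using hz)
    exact h1.zpow₀ m (Or.inl (by simp [hz0]))
  refine hd.congr ?_
  filter_upwards [isOpen_ne.mem_nhds hz0] with w hw
  rw [if_neg hw]

lemma pw_pw (a b : ℤ) (z : ℂ) : pw a (pw b z) = pw (a * b) z := by
  obtain ⟨r, c, hr, hc, rfl⟩ := exists_polar z
  rw [pw_polar b hr hc, pw_polar a hr (by rw [norm_zpow, hc, one_zpow]), pw_polar _ hr hc, ← zpow_mul, mul_comm b a]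

@[simp] lemma pw_one (z : ℂ) : pw 1 z = z := by
  obtain ⟨r, c, hr, hc, rfl⟩ := exists_polar z
  rw [pw_polar _ hr hc, zpow_one]

lemma pw_zero' (z : ℂ) : pw 0 z = ‖z‖ := by
  simp [pw]

lemma pw_real (m : ℤ) {r : ℝ} (hr : 0 ≤ r) : pw m r = r := by
  have := pw_polar m hr (c := 1) (by simp)
  simpa using this

lemma pw_mul (m : ℤ) {u : ℂ} (hu : ‖u‖ = 1) (z : ℂ) : pw m (u * z) = u ^ m * pw m z := by
  obtain ⟨r, c, hr, hc, rfl⟩ := exists_polar z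
  rw [pw_polar _ hr hc, mul_left_comm, pw_polar _ hr (by rw [norm_mul, hu, hc, mul_one]), mul_zpow]
  ring

section sphere
variable {k : ℕ}

/-- coordinatewise maps -/
noncomputable def cw (h : Fin k → ℂ → ℂ) (hn : ∀ j z, ‖h j z‖ = ‖z‖) (x : Sp k) : Sp k :=
  ⟨WithLp.toLp 2 fun j => h j (x.1 j), (Sp.mem_iff _).2 (by simpa [hn] using x.sq)⟩

@[simp] lemma cw_apply (h : Fin k → ℂ → ℂ) (hn : ∀ j z, ‖h j z‖ = ‖z‖) (x : Sp k) (j : Fin k) :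
    (cw h hn x).1 j = h j (x.1 j) := rfl

lemma cw_cont {T : Type*} [TopologicalSpace T] (h : T → Fin k → ℂ → ℂ) (hn : ∀ t j z, ‖h t j z‖ = ‖z‖)
    (hc : ∀ j, Continuous fun p : T × ℂ => h p.1 j p.2) :
    Continuous fun p : T × Sp k => cw (h p.1) (hn p.1) p.2 :=
  continuous_Sp fun j => by
    simp only [cw_apply]
    exact (hc j).comp (continuous_fst.prodMk ((continuous_coord j).comp continuous_snd))

noncomputable def Pg (m : Fin k → ℤ) : Sp k → Sp k := cw (fun j => pw (m j)) fun j z => norm_pw _ _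

@[simp] lemma Pg_apply (m : Fin k → ℤ) (x : Sp k) (j : Fin k) : (Pg m x).1 j = pw (m j) (x.1 j) := rfl

lemma Pg_cont (m : Fin k → ℤ) : Continuous (Pg m) :=
  continuous_Sp fun j => (pw_cont _).comp (continuous_coord j)

lemma Pg_Pg (m m' : Fin k → ℤ) (x : Sp k) : Pg m (Pg m' x) = Pg (fun j => m j * m' j) x :=
  Sp.ext' fun j => by simp [pw_pw]

variable [NeZero k]

/-- base point -/
noncomputable def ee : Sp k := ⟨WithLp.toLp 2 fun _ => ((√k)⁻¹ : ℝ), (Sp.mem_iff _).2 (by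
  have : (k : ℝ) ≠ 0 := by exact_mod_cast NeZero.ne k
  simp [this])⟩

@[simp] lemma ee_apply (j : Fin k) : (ee : Sp k).1 j = ((√k)⁻¹ : ℝ) := rfl

lemma sk_pos : 0 < (√k)⁻¹ := by
  have := Nat.pos_of_ne_zero (NeZero.ne k)
  positivity

/-- the map acting by radial power `a` on coordinate `i` -/
noncomputable def dli (i : Fin k) (a : ℤ) : Sp k → Sp k := Pg (fun j => if j = i then a else 1)
noncomputable abbrev dl (a : ℤ) : Sp k → Sp k := dli 0 a

lemma dli_cont (i : Fin k) (a : ℤ) : Continuous (dli i a) := Pg_cont _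
lemma dl_cont (a : ℤ) : Continuous (dl a : Sp k → Sp k) := Pg_cont _

lemma dli_dli (i : Fin k) (a b : ℤ) (x : Sp k) : dli i a (dli i b x) = dli i (a * b) x := by
  unfold dli
  rw [Pg_Pg]; congr 1; funext j; split_ifs <;> simp

lemma dli_one (i : Fin k) (x : Sp k) : dli i 1 x = x := Sp.ext' fun j => by simp [dli]

@[simp] lemma Pg_ee (m : Fin k → ℤ) : Pg m ee = ee := Sp.ext' fun j => by
  rw [Pg_apply, ee_apply, pw_real _ sk_pos.le]
@[simp] lemma dli_ee (i : Fin k) (m : ℤ) : dli i m ee = ee := Pg_ee _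

/-- half-slice -/
def H0 (k : ℕ) [NeZero k] : Set (Sp k) := {z | z.1 0 = ‖z.1 0‖}

lemma ee_H0 : (ee : Sp k) ∈ H0 k := by
  show (ee : Sp k).1 0 = ‖(ee : Sp k).1 0‖
  rw [ee_apply, Complex.norm_real, Real.norm_eq_abs, abs_of_pos sk_pos]

lemma dl_H0 (a : ℤ) {z : Sp k} (hz : z ∈ H0 k) : dl a z = z := Sp.ext' fun j => by
  rw [dl, dli, Pg_apply]
  split_ifs with h
  · subst h
    have hz : z.1 0 = ‖z.1 0‖ := hz
    rw [hz, pw_real _ (norm_nonneg _)]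
  · simp

lemma dl0_mem (z : Sp k) : dl 0 z ∈ H0 k := by
  show (dl 0 z).1 0 = ‖(dl 0 z).1 0‖
  simp [dl, dli, pw_zero']

lemma dl2_mem {z : Sp k} (hz : (z.1 0).im = 0) : dl 2 z ∈ H0 k := by
  show (dl 2 z).1 0 = ‖(dl 2 z).1 0‖
  rw [dl, dli, Pg_apply, if_pos rfl, norm_pw]
  have : z.1 0 = ((z.1 0).re : ℂ) := Complex.ext rfl (by simp [hz])
  rw [this]
  rcases le_total 0 (z.1 0).re with h | h
  · rw [pw_real _ h, Complex.norm_real, Real.norm_eq_abs, abs_of_nonneg h]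
  · have : (((z.1 0).re : ℝ) : ℂ) = ((-(z.1 0).re : ℝ) : ℂ) * (-1) := by push_cast; ring
    rw [this, pw_polar _ (by linarith) (by simp)]
    simp [abs_of_nonpos h]

variable {Y : Type*} [TopologicalSpace Y]

open Classical in
noncomputable def hsh (f g : Sp k → Y) (z : Sp k) : Y :=
  if 0 ≤ (z.1 0).im then f (dl 2 z) else g (dl 2 z)

lemma hsh_cont {T : Type*} [TopologicalSpace T] (F G : T × Sp k → Y) (hF : Continuous F) (hG : Continuous G)
    (h : ∀ t, ∀ z ∈ H0 k, F (t, z) = G (t, z)) :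
    Continuous fun p : T × Sp k => hsh (fun z => F (p.1, z)) (fun z => G (p.1, z)) p.2 := by
  unfold hsh
  have hd := dl_cont (k := k) 2
  have h0 := continuous_coord (k := k) 0
  refine Continuous.if_le (by fun_prop) (by fun_prop) continuous_const (by fun_prop) fun p hp => ?_
  exact h _ _ (dl2_mem hp.symm)

lemma hsh_ee (f g : Sp k → Y) : hsh f g ee = f ee := by
  simp [hsh]

lemma hsh_fam (F G : I × Sp k → Y) (hF : Continuous F) (hG : Continuous G)
    (h : ∀ t, ∀ z ∈ H0 k, F (t, z) = G (t, z)) (he : ∀ t, F (t, ee) = F (0, ee)) :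
    Hm {ee} (hsh (fun z => F (0, z)) fun z => G (0, z)) (hsh (fun z => F (1, z)) fun z => G (1, z)) :=
  ⟨_, hsh_cont F G hF hG h, fun _ => rfl, fun _ => rfl, by
    rintro t _ rfl
    simp only [hsh_ee, he t]⟩

lemma hsh_Hm {f f' g g' : Sp k → Y} (hf : Hm (H0 k) f f') (hg : Hm (H0 k) g g')
    (h : ∀ z ∈ H0 k, f z = g z) : Hm {ee} (hsh f g) (hsh f' g') := by
  obtain ⟨F, hF, F0, F1, Fr⟩ := hf
  obtain ⟨G, hG, G0, G1, Gr⟩ := hg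
  have := hsh_fam F G hF hG (fun t z hz => by rw [Fr t z hz, Gr t z hz, h z hz]) (fun t => by
    rw [Fr t _ ee_H0, F0])
  simpa only [F0, F1, G0, G1] using this

lemma hsh_map2 {Y' W : Type*} (R : Y → Y' → W) (f g : Sp k → Y) (f' g' : Sp k → Y') (z : Sp k) :
    R (hsh f g z) (hsh f' g' z) = hsh (fun z => R (f z) (f' z)) (fun z => R (g z) (g' z)) z := by
  unfold hsh; split_ifs <;> rfl

end sphere
end LS.Up


namespace LS.Up
set_option linter.all false
open Topology unitInterval

noncomputable def aexp (m : ℝ) (z : ℂ) : ℂ := (‖z‖ : ℂ) * Complex.exp ((m * Real.arccos (z.re / ‖z‖) : ℝ) * Complex.I)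

lemma aexp_norm (m : ℝ) (z : ℂ) : ‖aexp m z‖ = ‖z‖ := by
  rw [aexp, norm_mul, Complex.norm_exp_ofReal_mul_I, mul_one, Complex.norm_real, norm_norm]

lemma aexp_cont {X : Type*} [TopologicalSpace X] {m : X → ℝ} {z : X → ℂ} (hm : Continuous m) (hz : Continuous z) :
    Continuous fun x => aexp (m x) (z x) := by
  refine cont_rad (by fun_prop) (fun x => (Complex.norm_exp_ofReal_mul_I _).le) fun x hx => ?_
  have : ContinuousAt (fun x => (z x).re / ‖z x‖) x :=
    ContinuousAt.div (by fun_prop) (by fun_prop) hx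
  have h2 := Real.continuous_arccos.continuousAt.comp this
  refine Complex.continuous_exp.continuousAt.comp ?_
  refine ContinuousAt.mul ?_ continuousAt_const
  exact Complex.continuous_ofReal.continuousAt.comp (hm.continuousAt.mul h2)

lemma pw_exp (m : ℤ) {r : ℝ} (hr : 0 ≤ r) (θ : ℝ) : pw m (r * Complex.exp (θ * Complex.I)) =
    r * Complex.exp ((m * θ : ℝ) * Complex.I) := by
  rw [pw_polar m hr (Complex.norm_exp_ofReal_mul_I _), ← Complex.exp_int_mul]
  push_cast
  ring_nf

lemma aexp_pos (m : ℤ) {z : ℂ} (hz : 0 ≤ z.im) : aexp m z = pw m z := by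
  rcases eq_or_ne z 0 with rfl | h
  · simp [aexp, pw]
  conv_rhs => rw [← Complex.norm_mul_exp_arg_mul_I z, pw_exp _ (norm_nonneg _),
    Complex.arg_of_im_nonneg_of_ne_zero hz h]
  rfl

lemma aexp_neg (m : ℤ) {z : ℂ} (hz : z.im < 0) : aexp (-m) z = pw m z := by
  conv_rhs => rw [← Complex.norm_mul_exp_arg_mul_I z, pw_exp _ (norm_nonneg _),
    Complex.arg_of_im_neg hz]
  rw [aexp]; push_cast; ring_nf

open Classical in
noncomputable def hh (a b : ℤ) (s : ℝ) (z : ℂ) : ℂ :=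
  if 0 ≤ z.im then aexp ((1 - s) * (2 * a) + s * (a + b)) z else aexp (-((1 - s) * (2 * b) + s * (a + b))) z

lemma hh_norm (a b : ℤ) (s : ℝ) (z : ℂ) : ‖hh a b s z‖ = ‖z‖ := by
  unfold hh; split_ifs <;> exact aexp_norm _ _

lemma hh_cont (a b : ℤ) : Continuous fun p : I × ℂ => hh a b p.1 p.2 := by
  unfold hh
  refine Continuous.if_le (aexp_cont (by fun_prop) (by fun_prop)) (aexp_cont (by fun_prop) (by fun_prop))
    (by fun_prop) (by fun_prop) ?_
  rintro ⟨s, z⟩ h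
  have hz : z = (z.re : ℂ) := Complex.ext rfl (by simpa using h.symm)
  simp only
  unfold aexp
  rcases eq_or_ne z.re 0 with h0 | h0
  · rw [hz, h0]; simp
  congr 1
  have hn : ‖z‖ = |z.re| := by conv_lhs => rw [hz, Complex.norm_real, Real.norm_eq_abs]
  rw [hn]
  rcases h0.lt_or_gt with h1 | h1
  · rw [abs_of_neg h1, div_neg, div_self h0, Real.arccos_neg_one]
    rw [Complex.exp_eq_exp_iff_exists_int]
    refine ⟨a + b, ?_⟩
    push_cast
    ring
  · rw [abs_of_pos h1, div_self h0, Real.arccos_one]; simp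

section
variable {k : ℕ} [NeZero k]

lemma hsh_dl (a b : ℤ) : Hm {(ee : Sp k)} (hsh (dl a) (dl b)) (dl (a + b)) := by
  have hn : ∀ (t : I) (j : Fin k) (z : ℂ), ‖(if j = 0 then hh a b t z else z)‖ = ‖z‖ := by
    intro t j z; split_ifs
    · exact hh_norm _ _ _ _
    · rfl
  refine ⟨_, cw_cont (fun (t : I) j z => if j = 0 then hh a b t z else z) hn ?_, ?_, ?_, ?_⟩
  · intro j
    split_ifs
    · exact hh_cont a b
    · fun_prop
  · intro z
    refine Sp.ext' fun j => ?_
    simp only [cw_apply, hsh, dl]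
    by_cases hj : j = 0
    · subst hj
      simp only [if_true]
      by_cases h : 0 ≤ (z.1 0).im
      · rw [if_pos h, hh, if_pos h, dli_dli, dli, Pg_apply, if_pos rfl, ← aexp_pos _ h]
        congr 1; push_cast; simp; ring
      · rw [if_neg h, hh, if_neg h, dli_dli, dli, Pg_apply, if_pos rfl, ← aexp_neg _ (not_le.1 h)]
        congr 1; push_cast; simp; ring
    · split_ifs <;> simp [dli, hj]
  · intro z
    refine Sp.ext' fun j => ?_
    simp only [cw_apply, dl, dli, Pg_apply]
    by_cases hj : j = 0
    · subst hj
      simp only [if_true]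
      by_cases h : 0 ≤ (z.1 0).im
      · rw [hh, if_pos h, ← aexp_pos _ h]
        congr 1; push_cast; simp
      · rw [hh, if_neg h, ← aexp_neg _ (not_le.1 h)]
        congr 1; push_cast; simp
    · simp [hj]
  · rintro t _ rfl
    rw [hsh_ee, dl, dli_ee]
    refine Sp.ext' fun j => ?_
    simp only [cw_apply, ee_apply]
    split_ifs with h
    · rw [hh, if_pos (by simp), aexp]
      have := sk_pos (k := k)
      simp only [Complex.norm_real, Real.norm_eq_abs, abs_of_pos this, Complex.ofReal_re]
      rw [div_self this.ne', Real.arccos_one]; simp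
    · rfl

/-- total normalization -/
noncomputable def nr (z : EuclideanSpace ℂ (Fin k)) : Sp k :=
  open Classical in if h : z = 0 then ee else nz z h

lemma nr_cont {W : Type*} [TopologicalSpace W] {f : W → EuclideanSpace ℂ (Fin k)} (hf : Continuous f) (h : ∀ w, f w ≠ 0) :
    Continuous fun w => nr (f w) := by
  have : (fun w => nr (f w)) = fun w => nz (f w) (h w) := by
    funext w; rw [nr, dif_neg (h w)]
  rw [this]; exact nz_cont f h hf

lemma nr_val {z : EuclideanSpace ℂ (Fin k)} (h : z ≠ 0) : (nr z).1 = (‖z‖⁻¹ : ℝ) • z := by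
  rw [nr, dif_neg h]; rfl

lemma nr_of_sp (z : Sp k) : nr z.1 = z := by
  have h := z.2
  rw [mem_sphere_zero_iff_norm] at h
  refine Subtype.ext ?_
  rw [nr_val (by intro h0; simp [h0] at h), h]; simp

lemma nr_smul {c : ℝ} (hc : 0 < c) (z : EuclideanSpace ℂ (Fin k)) : nr (c • z) = nr z := by
  by_cases h : z = 0
  · simp [h]
  · refine Subtype.ext ?_
    rw [nr_val h, nr_val (by simp [h, hc.ne']), norm_smul, smul_smul, Real.norm_eq_abs, abs_of_pos hc]
    congr 1
    have := norm_ne_zero_iff.2 h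
    field_simp

lemma Sp.norm (x : Sp k) : ‖x.1‖ = 1 := mem_sphere_zero_iff_norm.1 x.2

lemma seg_ne {x y : Sp k} (h : x.1 ≠ -y.1) (t : ℝ) (h0 : 0 ≤ t) (h1 : t ≤ 1) :
    (1 - t) • x.1 + t • y.1 ≠ 0 := by
  intro hz
  have e1 : (1 - t) • x.1 = -(t • y.1) := eq_neg_of_add_eq_zero_left hz
  have e2 := congrArg (‖·‖) e1
  simp only [norm_smul, norm_neg, Sp.norm, Real.norm_eq_abs, abs_of_nonneg h0, abs_of_nonneg (sub_nonneg.2 h1)] at e2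
  have : t = 1/2 := by linarith
  subst this
  apply h
  have h3 := congrArg (fun v => (2:ℝ) • v) e1
  simp only [smul_smul, smul_neg] at h3
  norm_num at h3
  exact h3

/-- straight line homotopy -/
lemma seg_Hm {X : Type*} [TopologicalSpace X] {f g : X → Sp k} (hf : Continuous f) (hg : Continuous g) (A : Set X)
    (h : ∀ x, (f x).1 ≠ -(g x).1) (hA : ∀ x ∈ A, f x = g x) : Hm A f g := by
  refine ⟨fun p => nr ((1 - (p.1 : ℝ)) • (f p.2).1 + (p.1 : ℝ) • (g p.2).1), nr_cont (by fun_prop) ?_, ?_, ?_, ?_⟩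
  · exact fun p => seg_ne (h _) _ p.1.2.1 p.1.2.2
  · intro x; simp [nr_of_sp]
  · intro x; simp [nr_of_sp]
  · intro t x hx
    simp only [hA x hx, ← add_smul]; simp [nr_of_sp]

lemma dl0_null : Hm ∅ (dl 0 : Sp k → Sp k) (fun _ => ee) := by
  refine seg_Hm (dl_cont 0) continuous_const _ (fun x hx => ?_) (by simp)
  have h1 := congrArg (fun v : EuclideanSpace ℂ (Fin k) => (v 0).re) hx
  have h2 : (dl 0 x).1 0 = ‖(dl 0 x).1 0‖ := dl0_mem x
  simp only [PiLp.neg_apply, Complex.neg_re, ee_apply, Complex.ofReal_re] at h1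
  rw [h2, Complex.ofReal_re] at h1
  have := norm_nonneg ((dl 0 x).1 0)
  have := sk_pos (k := k)
  linarith

/-- collapse -/
noncomputable def cmu (z : Sp k) : ℝ := 1 - min 1 (√k * (‖z.1 0‖ - (z.1 0).re))

lemma cmu_mem (z : Sp k) : 0 ≤ cmu z ∧ cmu z ≤ 1 := by
  have : 0 ≤ √k * (‖z.1 0‖ - (z.1 0).re) :=
    mul_nonneg (Real.sqrt_nonneg _) (sub_nonneg.2 (Complex.re_le_norm _))
  unfold cmu
  constructor
  · linarith [min_le_left 1 (√k * (‖z.1 0‖ - (z.1 0).re))]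
  · have := le_min zero_le_one this; linarith

lemma cmu_H0 {z : Sp k} (hz : z ∈ H0 k) : cmu z = 1 := by
  have h1 := congrArg Complex.re (hz : z.1 0 = ‖z.1 0‖)
  rw [Complex.ofReal_re] at h1
  simp [cmu, h1]

lemma cmu_cont : Continuous (cmu : Sp k → ℝ) := by unfold cmu; fun_prop

noncomputable def coll (s : ℝ) (z : Sp k) : Sp k := nr ((1 - s * cmu z) • z.1 + (s * cmu z) • (ee : Sp k).1)

lemma coll_ne (s : I) (z : Sp k) : (1 - s * cmu z) • z.1 + (s * cmu z) • (ee : Sp k).1 ≠ 0 := by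
  by_cases h : z.1 = -(ee : Sp k).1
  · have h0 : cmu z = 0 := by
      have hs := sk_pos (k := k)
      unfold cmu
      rw [h]
      simp only [PiLp.neg_apply, Complex.neg_re, ee_apply, Complex.ofReal_re, norm_neg, Complex.norm_real,
        Real.norm_eq_abs, abs_of_pos hs]
      rw [min_eq_left, sub_self]
      have : √k ≠ 0 := by intro h; simp [h] at hs
      field_simp; norm_num
    rw [h0, h]
    intro h3
    have := congrArg (‖·‖) h3
    simp [Sp.norm] at this
  · exact seg_ne h _ (mul_nonneg s.2.1 (cmu_mem z).1) (mul_le_one₀ s.2.2 (cmu_mem z).1 (cmu_mem z).2)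

lemma coll_cont : Continuous fun p : I × Sp k => coll p.1 p.2 := by
  have := cmu_cont (k := k)
  exact nr_cont (by fun_prop) fun p => coll_ne p.1 p.2

lemma coll_zero (z : Sp k) : coll 0 z = z := by simp [coll, nr_of_sp]

lemma coll_ee (s : ℝ) : coll s (ee : Sp k) = ee := by
  rw [coll, ← add_smul]; simp [nr_of_sp]

lemma coll_H0 {z : Sp k} (hz : z ∈ H0 k) : coll 1 z = ee := by
  simp [coll, cmu_H0 hz, nr_of_sp]

lemma coll_mem (s : I) {z : Sp k} (hz : z ∈ H0 k) : coll s z ∈ H0 k := by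
  have h1 : z.1 0 = ‖z.1 0‖ := hz
  have h2 : ∃ r : ℝ, 0 ≤ r ∧ (coll s z).1 0 = r := by
    rw [coll, nr_val (coll_ne s z), cmu_H0 hz]
    set N := ‖(1 - (s:ℝ) * 1) • z.1 + ((s:ℝ) * 1) • (ee : Sp k).1‖
    refine ⟨N⁻¹ * ((1 - s) * ‖z.1 0‖ + s * (√k)⁻¹), ?_, ?_⟩
    · have := s.2.1
      have := sub_nonneg.2 s.2.2
      positivity
    · simp only [PiLp.smul_apply, PiLp.add_apply, ee_apply]
      rw [h1]
      simp
      ring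
  obtain ⟨r, hr, h3⟩ := h2
  show _ = _
  rw [h3, Complex.norm_real, Real.norm_eq_abs, abs_of_nonneg hr]

lemma coll_Hm : Hm {ee} (fun z : Sp k => z) (coll 1) :=
  ⟨fun p => coll p.1 p.2, coll_cont, fun x => coll_zero x, fun x => rfl, by
    rintro t _ rfl; exact coll_ee _⟩

lemma coll_one_cont : Continuous (coll 1 : Sp k → Sp k) := coll_Hm.right

/-- pointed degree -/
def PDeg (f : Sp k → Sp k) (a : ℤ) : Prop := Hm {ee} f (dl a)

lemma PDeg.base {f : Sp k → Sp k} {a : ℤ} (h : PDeg f a) : f ee = ee := by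
  rw [Hm.eq_on h rfl, dl, dli_ee]

lemma PDeg.comp {f g : Sp k → Sp k} {a b : ℤ} (hf : PDeg f a) (hg : PDeg g b) :
    PDeg (fun z => f (g z)) (a * b) := by
  have h1 : Hm {ee} (fun z => f (g z)) (fun z => dl a (g z)) := hf.pre hg.left (by rintro _ rfl; exact hg.base)
  refine (h1.trans (hg.post (dl_cont a))).trans (.of_eq _ ((dl_cont a).comp (dl_cont b)) fun x => dli_dli _ _ _ _)

lemma PDeg_id : PDeg (fun z : Sp k => z) 1 := .of_eq _ continuous_id fun x => (dli_one _ _).symm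

lemma PDeg_dl (a : ℤ) : PDeg (dl a : Sp k → Sp k) a := .refl _ (dl_cont a)

lemma hsh_undo (α β a b : ℤ) : Hm {(ee : Sp k)}
    (hsh (fun z => dl α (coll 1 (dl a z))) (fun z => dl β (coll 1 (dl b z)))) (dl (α * a + β * b)) := by
  have hc := coll_cont (k := k)
  have hcc : ∀ α a : ℤ, Continuous fun p : I × Sp k => dl α (coll p.1 (dl a p.2)) := by
    intro α a
    have h1 : Continuous fun p : I × Sp k => (p.1, dl a p.2) :=
      continuous_fst.prodMk ((dl_cont a).comp continuous_snd)
    have h2 : Continuous fun p : I × Sp k => coll p.1 (dl a p.2) := by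
      have h3 := hc.comp h1
      simpa only [Function.comp_def] using h3
    have h4 := (dl_cont α).comp h2
    simpa only [Function.comp_def] using h4
  have key := hsh_fam (k := k) (fun p : I × Sp k => dl α (coll p.1 (dl a p.2))) (fun p => dl β (coll p.1 (dl b p.2)))
    (hcc α a) (hcc β b)
    (fun t z hz => by
      simp only
      rw [dl_H0 a hz, dl_H0 b hz, dl_H0 _ (coll_mem t hz), dl_H0 _ (coll_mem t hz)])
    (fun t => by simp only [dl, dli_ee, coll_ee])
  refine key.symm.trans ?_
  have e1 : (fun z : Sp k => dl α (coll ((0 : I) : ℝ) (dl a z))) = dl (α * a) := by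
    funext z; rw [Set.Icc.coe_zero, coll_zero, dl, dli_dli]
  have e2 : (fun z : Sp k => dl β (coll ((0 : I) : ℝ) (dl b z))) = dl (β * b) := by
    funext z; rw [Set.Icc.coe_zero, coll_zero, dl, dli_dli]
  simp only [e1, e2]
  exact hsh_dl _ _

/-- product law -/
lemma PDeg.map2 {R : Sp k → Sp k → Sp k} (hR : Continuous fun p : Sp k × Sp k => R p.1 p.2) {α β a b : ℤ}
    (hα : PDeg (fun x => R x ee) α) (hβ : PDeg (fun x => R ee x) β) {f g : Sp k → Sp k} (hf : PDeg f a)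
    (hg : PDeg g b) : PDeg (fun z => R (f z) (g z)) (α * a + β * b) := by
  have h1 : Hm {(ee : Sp k)} f (fun z => coll 1 (hsh (dl a) (dl 0) z)) := by
    have h := (hsh_dl (k := k) a 0).symm
    rw [add_zero] at h
    exact (Hm.trans hf h).trans (coll_Hm.pre h.right (by rintro _ rfl; simp [hsh_ee]))
  have h2 : Hm {(ee : Sp k)} g (fun z => coll 1 (hsh (dl 0) (dl b) z)) := by
    have h := (hsh_dl (k := k) 0 b).symm
    rw [zero_add] at h
    exact (Hm.trans hg h).trans (coll_Hm.pre h.right (by rintro _ rfl; simp [hsh_ee]))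
  have h3 := h1.map2 h2 hR
  refine h3.trans ?_
  have h4 : (fun z : Sp k => R (coll 1 (hsh (dl a) (dl 0) z)) (coll 1 (hsh (dl 0) (dl b) z))) =
      hsh (fun z => R (coll 1 (dl a z)) ee) (fun z => R ee (coll 1 (dl b z))) := by
    funext z
    rw [hsh_map2 (fun x y => R (coll 1 x) (coll 1 y))]
    congr 1 <;> funext z <;> rw [coll_H0 (dl0_mem z)]
  rw [h4]
  refine (hsh_Hm (hα.pre (B := H0 k) (coll_one_cont.comp (dl_cont a)) ?_)
    (hβ.pre (B := H0 k) (coll_one_cont.comp (dl_cont b)) ?_) ?_).trans (hsh_undo α β a b)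
  · intro x hx; simp only [Function.comp]; rw [dl_H0 a hx, coll_H0 hx]; rfl
  · intro x hx; simp only [Function.comp]; rw [dl_H0 b hx, coll_H0 hx]; rfl
  · intro x hx; simp only [Function.comp]; rw [dl_H0 a hx, dl_H0 b hx, coll_H0 hx]

end
end LS.Up


namespace LS.Up
set_option linter.all false
open Topology unitInterval

section
variable {k : ℕ} [NeZero k]

/-! ### unitary paths -/

lemma sum_two {f g : Fin k → ℝ} {i : Fin k} (hi : i ≠ 0) (h : f 0 + f i = g 0 + g i)
    (h' : ∀ j, j ≠ 0 → j ≠ i → f j = g j) : ∑ j, f j = ∑ j, g j := by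
  have := Fintype.sum_eq_add (f := fun j => f j - g j) 0 i hi.symm (fun j hj => by simp [h' j hj.1 hj.2])
  rw [Finset.sum_sub_distrib] at this
  linarith

noncomputable def vt (i : Fin k) (hi : i ≠ 0) (c : Circle) (z : Sp k) : Sp k :=
  ⟨WithLp.toLp 2 fun j => if j = 0 then (z.1 0 + z.1 i) / 2 + (c : ℂ) * ((z.1 0 - z.1 i) / 2) else
      if j = i then (z.1 0 + z.1 i) / 2 - (c : ℂ) * ((z.1 0 - z.1 i) / 2) else z.1 j, by
    rw [Sp.mem_iff]
    refine (sum_two hi ?_ fun j h0 hi => by simp [h0, hi]).trans z.sq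
    simp only [if_true, if_neg hi]
    have h1 := parallelogram_law_with_norm ℝ ((z.1 0 + z.1 i) / 2) ((c : ℂ) * ((z.1 0 - z.1 i) / 2))
    have h2 := parallelogram_law_with_norm ℝ ((z.1 0 + z.1 i) / 2) ((z.1 0 - z.1 i) / 2)
    have e1 : (z.1 0 + z.1 i) / 2 + ((z.1 0 - z.1 i) / 2) = z.1 0 := by ring
    have e2 : (z.1 0 + z.1 i) / 2 - ((z.1 0 - z.1 i) / 2) = z.1 i := by ring
    have e3 : ‖(c : ℂ) * ((z.1 0 - z.1 i) / 2)‖ = ‖(z.1 0 - z.1 i) / 2‖ := by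
      rw [norm_mul, Circle.norm_coe, one_mul]
    rw [e1, e2] at h2
    rw [e3] at h1
    nlinarith⟩

lemma vt_cont (i : Fin k) (hi : i ≠ 0) : Continuous fun p : Circle × Sp k => vt i hi p.1 p.2 := by
  refine continuous_Sp fun j => ?_
  simp only [vt]
  have h0 := continuous_coord (k := k) 0
  have h1 := continuous_coord (k := k) i
  have h2 := continuous_coord (k := k) j
  split_ifs <;> fun_prop

lemma vt_ee (i : Fin k) (hi : i ≠ 0) (c : Circle) : vt i hi c ee = ee := Sp.ext' fun j => by
  simp only [vt, ee_apply]
  split_ifs <;> ring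

lemma PDeg_dli (i : Fin k) (a : ℤ) : PDeg (dli i a) a := by
  by_cases hi : i = 0
  · subst hi; exact PDeg_dl a
  refine Hm.symm ⟨fun p => vt i hi (Circle.exp (Real.pi * p.1)) (dl a (vt i hi (Circle.exp (-(Real.pi * p.1))) p.2)), ?_, ?_, ?_, ?_⟩
  · have hv := vt_cont i hi
    have h1 : Continuous fun p : I × Sp k => ((Circle.exp (-(Real.pi * p.1)), p.2) : Circle × Sp k) := by fun_prop
    have h2 := (dl_cont a).comp (hv.comp h1)
    have h3 : Continuous fun p : I × Sp k => Circle.exp (Real.pi * p.1) := by fun_prop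
    have h4 := hv.comp (h3.prodMk h2)
    simpa only [Function.comp_def] using h4
  · intro z
    have : ∀ z : Sp k, vt i hi 1 z = z := fun z => Sp.ext' fun j => by
      simp only [vt, Circle.coe_one]
      split_ifs with h1 h2
      · rw [h1]; ring
      · rw [h2]; ring
      · rfl
    simp [this]
  · intro z
    refine Sp.ext' fun j => ?_
    have e1 : ((Circle.exp Real.pi : Circle) : ℂ) = -1 := by simp [Circle.coe_exp]
    have e2 : ((Circle.exp (-Real.pi) : Circle) : ℂ) = -1 := by simp [Circle.coe_exp, Complex.exp_neg]
    simp only [vt, dl, dli, Pg_apply, Set.Icc.coe_one, mul_one, e1, e2]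
    by_cases h0 : j = 0
    · subst h0
      simp [hi, Ne.symm hi]; ring_nf
    · by_cases h1 : j = i
      · subst h1
        simp [h0]; ring_nf
      · simp [h0, h1]
  · rintro t _ rfl
    simp [vt_ee]

lemma PDeg_Pg (m : ℤ) : PDeg (Pg (fun _ : Fin k => m)) (m ^ k) := by
  classical
  have key : ∀ s : Finset (Fin k), PDeg (Pg (fun j => if j ∈ s then m else 1)) (m ^ s.card) := by
    intro s
    induction s using Finset.induction_on with
    | empty =>
      have h := PDeg_id (k := k)
      have e : (fun z : Sp k => z) = Pg (fun j => if j ∈ (∅ : Finset (Fin k)) then m else 1) := by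
        funext z; exact Sp.ext' fun j => by simp
      rw [e] at h
      simpa using h
    | insert i s hi ih =>
      have h := (PDeg_dli i m).comp ih
      rw [Finset.card_insert_of_notMem hi, pow_succ, mul_comm]
      have e : (fun z : Sp k => dli i m (Pg (fun j => if j ∈ s then m else 1) z)) =
          Pg (fun j => if j ∈ insert i s then m else 1) := by
        funext z
        rw [dli, Pg_Pg]
        congr 1
        funext j
        by_cases h1 : j = i
        · subst h1; simp [hi]
        · simp [h1]
      rw [e] at h
      exact h
  have := key Finset.univ
  simpa using this

/-- degree in the first variable from idempotency -/
lemma PDeg.first {R : Sp k → Sp k → Sp k} (hR : Continuous fun p : Sp k × Sp k => R p.1 p.2) {N : ℤ}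
    (hd : ∀ x, R x x = x) (hN : PDeg (fun x => R ee x) N) : PDeg (fun x => R x ee) (1 - N) := by
  have h1 : Hm {(ee : Sp k)} (fun z => z) (fun z => coll 1 (hsh (dl 1) (dl 0) z)) := by
    have h := (hsh_dl (k := k) 1 0).symm
    rw [add_zero] at h
    exact (Hm.trans PDeg_id h).trans (coll_Hm.pre h.right (by rintro _ rfl; simp [hsh_ee]))
  have h2 : Hm {(ee : Sp k)} (fun _ => ee) (fun z => coll 1 (hsh (dl 1) (dl (-1)) z)) := by
    have h := (hsh_dl (k := k) 1 (-1)).symm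
    rw [add_neg_cancel] at h
    have h' := h.post coll_one_cont
    have e : (fun z : Sp k => coll 1 (dl 0 z)) = fun _ => ee := by
      funext z; exact coll_H0 (dl0_mem z)
    rw [e] at h'
    exact h'
  refine (h1.map2 h2 hR).trans ?_
  have h4 : (fun z : Sp k => R (coll 1 (hsh (dl 1) (dl 0) z)) (coll 1 (hsh (dl 1) (dl (-1)) z))) =
      hsh (fun z => dl 1 (coll 1 (dl 1 z))) (fun z => R ee (coll 1 (dl (-1) z))) := by
    funext z
    rw [hsh_map2 (fun x y => R (coll 1 x) (coll 1 y))]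
    congr 1 <;> funext z
    · rw [hd, dl, dli_one, dli_one]
    · rw [coll_H0 (dl0_mem z)]
  rw [h4]
  have h5 := hsh_undo (k := k) 1 N 1 (-1)
  rw [show (1 : ℤ) * 1 + N * -1 = 1 - N by ring] at h5
  refine (hsh_Hm (.refl _ ((dl_cont 1).comp (coll_one_cont.comp (dl_cont 1))))
    (hN.pre (B := H0 k) (coll_one_cont.comp (dl_cont (-1))) ?_) ?_).trans h5
  · intro x hx; simp only [Function.comp]; rw [dl_H0 _ hx, coll_H0 hx]; rfl
  · intro x hx
    have : R (ee : Sp k) ee = ee := hd _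
    simp only [Function.comp]; rw [dl_H0 1 hx, dl_H0 (-1) hx, coll_H0 hx, this, dl_H0 1 ee_H0]

/-! ### the kernel -/

noncomputable def bf (ε : ℝ) (x v : EuclideanSpace ℂ (Fin k)) : ℝ := max (ε ^ 2 - ‖x - v‖ ^ 2) 0

lemma bf_zero {ε : ℝ} {x v : EuclideanSpace ℂ (Fin k)} (hε : 0 < ε) (h : ε ≤ ‖x - v‖) : bf ε x v = 0 :=
  max_eq_right (by nlinarith)

variable {ι : Type*} [Fintype ι]

noncomputable def Kf (ε : ℝ) (x : EuclideanSpace ℂ (Fin k)) (v : ι → EuclideanSpace ℂ (Fin k)) :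
    EuclideanSpace ℂ (Fin k) :=
  (ε ^ 2 - ∑ j, bf ε x (v j)) • x - ∑ j, bf ε x (v j) • v j

lemma Kf_zero {ε : ℝ} {x : EuclideanSpace ℂ (Fin k)} {v : ι → EuclideanSpace ℂ (Fin k)} (hε : 0 < ε)
    (h : ∀ j, ε ≤ ‖x - v j‖) : Kf ε x v = ε ^ 2 • x := by
  simp [Kf, fun j => bf_zero hε (h j)]

lemma Kf_one {ε : ℝ} {x : EuclideanSpace ℂ (Fin k)} {v : ι → EuclideanSpace ℂ (Fin k)} (hε : 0 < ε) {j : ι}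
    (hj : ‖x - v j‖ < ε) (h : ∀ i, i ≠ j → ε ≤ ‖x - v i‖) :
    Kf ε x v = ‖x - v j‖ ^ 2 • x - (ε ^ 2 - ‖x - v j‖ ^ 2) • v j := by
  have hb : bf ε x (v j) = ε ^ 2 - ‖x - v j‖ ^ 2 :=
    max_eq_left (by nlinarith [norm_nonneg (x - v j)])
  rw [Kf, Finset.sum_eq_single j (fun i _ hi => bf_zero hε (h i hi)) (by simp),
    Finset.sum_eq_single j (fun i _ hi => by rw [bf_zero hε (h i hi), zero_smul]) (by simp), hb]
  congr 2
  ring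

lemma Kf_ne {ε : ℝ} {x : EuclideanSpace ℂ (Fin k)} {v : ι → EuclideanSpace ℂ (Fin k)} (hε : 0 < ε)
    (hx : ‖x‖ = 1) (hv : ∀ j, ‖v j‖ = 1)
    (h : ∀ i j, ‖x - v i‖ < ε → ‖x - v j‖ < ε → i = j) : Kf ε x v ≠ 0 := by
  by_cases h0 : ∀ j, ε ≤ ‖x - v j‖
  · rw [Kf_zero hε h0, ← norm_ne_zero_iff, norm_smul, hx]
    simp [hε.ne']
  · push Not at h0
    obtain ⟨j, hj⟩ := h0
    rw [Kf_one hε hj fun i hi => by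
      by_contra hc
      exact hi (h i j (not_le.1 hc) hj)]
    intro h1
    set d := ‖x - v j‖ ^ 2 with hd
    have hd2 : d < ε ^ 2 := by nlinarith [norm_nonneg (x - v j)]
    have e1 := sub_eq_zero.1 h1
    have e2 := congrArg (‖·‖) e1
    simp only [norm_smul, hx, hv, mul_one, Real.norm_eq_abs] at e2
    rw [abs_of_nonneg (by positivity), abs_of_pos (by linarith)] at e2
    rw [← e2, ← sub_eq_zero, ← smul_sub] at e1
    have hd0 : 0 < d := by nlinarith [sq_pos_of_pos hε]
    have := (smul_eq_zero.1 e1).resolve_left hd0.ne'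
    rw [this] at hd
    simp at hd
    linarith

lemma Kf_cont {T : Type*} [TopologicalSpace T] (ε : ℝ) {x : T → EuclideanSpace ℂ (Fin k)}
    {v : T → ι → EuclideanSpace ℂ (Fin k)} (hx : Continuous x) (hv : ∀ j, Continuous fun t => v t j) :
    Continuous fun t => Kf ε (x t) (v t) := by
  unfold Kf bf
  have := hv
  have hb : ∀ j, Continuous fun t => max (ε ^ 2 - ‖x t - v t j‖ ^ 2) 0 := fun j => by
    have := hv j
    fun_prop
  exact ((continuous_const.sub (continuous_finsetSum _ fun j _ => hb j)).smul hx).sub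
    (continuous_finsetSum _ fun j _ => (hb j).smul (hv j))

end
end LS.Up


namespace LS.Up
set_option linter.all false
open Topology unitInterval

section
variable {k : ℕ} [NeZero k]

noncomputable def eta (N : ℕ) : Circle := Circle.exp (Real.pi / N)

variable {N : ℕ} [NeZero N]

lemma eta_pow : ((eta N : Circle) : ℂ) ^ N = -1 := by
  rw [eta, Circle.coe_exp, ← Complex.exp_nat_mul]
  have : (N : ℂ) ≠ 0 := by exact_mod_cast NeZero.ne N
  rw [show (N : ℂ) * (((Real.pi / N : ℝ) : ℂ) * Complex.I) = Real.pi * Complex.I by push_cast; field_simp]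
  exact Complex.exp_pi_mul_I

lemma tC_pow (j : ZMod N) : ((ZMod.toCircle j : Circle) : ℂ) ^ N = 1 := by
  rw [← Circle.coe_pow, ← AddChar.map_nsmul_eq_pow]
  simp

lemma tC_surj {c : ℂ} (hc : c ^ N = 1) : ∃ m : ZMod N, ((ZMod.toCircle m : Circle) : ℂ) = c := by
  have hc0 : c ≠ 0 := by rintro rfl; simp [NeZero.ne N] at hc
  have := (Complex.mem_rootsOfUnity N (Units.mk0 c hc0)).1 (by
    rw [mem_rootsOfUnity]; ext; simpa using hc)
  obtain ⟨i, hi, h⟩ := this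
  refine ⟨(i : ℤ), ?_⟩
  rw [ZMod.toCircle_intCast, ← Units.val_mk0 hc0, ← h]
  push_cast
  ring_nf

lemma tC_ne (j : ZMod N) : ((ZMod.toCircle j : Circle) : ℂ) * eta N - 1 ≠ 0 := by
  intro h
  have h1 := congrArg (· ^ N) (sub_eq_zero.1 h)
  simp only [mul_pow, tC_pow, eta_pow, one_pow] at h1
  norm_num at h1

/-- admissible radius -/
structure Ge (k N : ℕ) [NeZero N] (ε : ℝ) : Prop where
  pos : 0 < ε
  s1 : ∀ m : ZMod N, m ≠ 0 → ∀ z : ℂ, (√k)⁻¹ - ε ≤ ‖z‖ → 2 * ε ≤ ‖(ZMod.toCircle m : ℂ) * z - z‖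
  s2 : ∀ m : ZMod N, ε ≤ ‖(ZMod.toCircle m : ℂ) * eta N - 1‖ * (√k)⁻¹
  s3 : ∀ v : ℂ, ‖v - ((√k)⁻¹ : ℝ)‖ < ε → |Complex.arg v| < Real.pi / N
  s4 : ε < (√k)⁻¹

lemma Ge.ex (k N : ℕ) [NeZero k] [NeZero N] : ∃ ε, Ge k N ε := by
  have hk := sk_pos (k := k)
  have h0 : ∀ᶠ ε : ℝ in 𝓝[>] 0, 0 < ε := self_mem_nhdsWithin
  have lt : ∀ a : ℝ, 0 < a → ∀ᶠ ε : ℝ in 𝓝[>] 0, ε < a := fun a ha =>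
    mem_nhdsWithin_of_mem_nhds (Iio_mem_nhds ha)
  have h1 : ∀ᶠ ε : ℝ in 𝓝[>] 0, ∀ m : ZMod N, m ≠ 0 → 2 * ε ≤ ‖(ZMod.toCircle m : ℂ) - 1‖ * ((√k)⁻¹ - ε) := by
    rw [Filter.eventually_all]
    intro m
    by_cases hm : m = 0
    · simp [hm]
    have hδ : 0 < ‖(ZMod.toCircle m : ℂ) - 1‖ := by
      rw [norm_pos_iff, sub_ne_zero]
      intro h
      apply hm
      apply ZMod.injective_toCircle
      rw [AddChar.map_zero_eq_one]
      exact Circle.ext h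
    set δ := ‖(ZMod.toCircle m : ℂ) - 1‖
    filter_upwards [lt (δ * (√k)⁻¹ / (2 + δ)) (by positivity)] with ε hε _
    rw [lt_div_iff₀ (by positivity)] at hε
    linarith
  have h2 : ∀ᶠ ε : ℝ in 𝓝[>] 0, ∀ m : ZMod N, ε ≤ ‖(ZMod.toCircle m : ℂ) * eta N - 1‖ * (√k)⁻¹ := by
    rw [Filter.eventually_all]
    intro m
    filter_upwards [lt (‖(ZMod.toCircle m : ℂ) * eta N - 1‖ * (√k)⁻¹) (mul_pos (norm_pos_iff.2 (tC_ne m)) hk)] with ε h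
    exact h.le
  have h3 : ∀ᶠ ε : ℝ in 𝓝[>] 0, ∀ v : ℂ, ‖v - ((√k)⁻¹ : ℝ)‖ < ε → |Complex.arg v| < Real.pi / N := by
    have hc : ContinuousAt (fun v => |Complex.arg v|) (((√k)⁻¹ : ℝ) : ℂ) :=
      (Complex.continuousAt_arg (by left; rw [Complex.ofReal_re]; exact hk)).abs
    have : ∀ᶠ v in 𝓝 (((√k)⁻¹ : ℝ) : ℂ), |Complex.arg v| < Real.pi / N := by
      refine hc.eventually_lt continuousAt_const ?_
      rw [Complex.arg_ofReal_of_nonneg hk.le, abs_zero]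
      have : (0 : ℝ) < N := by exact_mod_cast Nat.pos_of_ne_zero (NeZero.ne N)
      have := Real.pi_pos
      positivity
    obtain ⟨r, hr, h⟩ := Metric.eventually_nhds_iff.1 this
    filter_upwards [lt r hr] with ε hε v hv
    exact h (by rw [dist_eq_norm]; linarith)
  obtain ⟨ε, a, b, c, d, f⟩ := (h0.and (h1.and (h2.and (h3.and (lt _ hk))))).exists
  refine ⟨ε, a, fun m hm z hz => ?_, c, d, f⟩
  have := b m hm
  rw [show (ZMod.toCircle m : ℂ) * z - z = ((ZMod.toCircle m : ℂ) - 1) * z by ring, norm_mul]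
  exact this.trans (mul_le_mul_of_nonneg_left hz (norm_nonneg _))

lemma sk_le : (√k)⁻¹ ≤ 1 := by
  have : 1 ≤ √(k:ℝ) := by
    rw [Real.one_le_sqrt]; exact_mod_cast Nat.pos_of_ne_zero (NeZero.ne k)
  exact inv_le_one_of_one_le₀ this

lemma Ge.s1' {ε : ℝ} (h : Ge k N ε) (m : ZMod N) (hm : m ≠ 0) : 2 * ε ≤ ‖(ZMod.toCircle m : ℂ) - 1‖ := by
  have := h.s1 m hm 1 (by
    have := sk_le (k := k)
    have := h.pos
    simp; linarith)
  simpa using this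

lemma Ge.s2' {ε : ℝ} (h : Ge k N ε) (m : ZMod N) : ε ≤ ‖(ZMod.toCircle m : ℂ) * eta N - 1‖ := by
  refine (h.s2 m).trans ?_
  have := sk_le (k := k)
  nlinarith [norm_nonneg ((ZMod.toCircle m : ℂ) * eta N - 1)]

lemma cdist {a b : Fin k → Circle} {r : ℝ} (hr : 0 ≤ r) (h : ∀ l, r ≤ ‖(a l : ℂ) - b l‖) (w : Sp k) :
    r ≤ ‖(cmul a w).1 - (cmul b w).1‖ := by
  refine le_of_sq_le_sq ?_ (norm_nonneg _)
  rw [EuclideanSpace.norm_sq_eq]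
  calc r ^ 2 = ∑ l, r ^ 2 * ‖w.1 l‖ ^ 2 := by rw [← Finset.mul_sum, w.sq, mul_one]
    _ ≤ _ := by
      refine Finset.sum_le_sum fun l _ => ?_
      rw [PiLp.sub_apply, cmul_apply, cmul_apply, ← sub_mul, norm_mul, mul_pow]
      exact mul_le_mul_of_nonneg_right (pow_le_pow_left₀ hr (h l) 2) (by positivity)

lemma cmul_one' (w : Sp k) : cmul (fun _ => 1) w = w := Sp.ext' fun j => by simp

noncomputable def gg (cz : Fin k → ZMod N) (j : ZMod N) : Fin k → Circle :=
  fun i => ZMod.toCircle (-(j * cz i)) * eta N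

noncomputable def RN (ε : ℝ) (cz : Fin k → ZMod N) (x w : Sp k) : Sp k :=
  nr (Kf ε x.1 fun j : ZMod N => (cmul (gg cz j) w).1)

variable {ε : ℝ} (hε : Ge k N ε) {cz : Fin k → ZMod N} (hu : ∀ i, IsUnit (cz i))

include hε hu in
lemma RN_ne (x w : Sp k) : Kf ε x.1 (fun j : ZMod N => (cmul (gg cz j) w).1) ≠ 0 := by
  refine Kf_ne hε.pos (Sp.norm x) (fun j => Sp.norm _) fun i j hi hj => ?_
  by_contra hij
  have h1 : 2 * ε ≤ ‖(cmul (gg cz i) w).1 - (cmul (gg cz j) w).1‖ := by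
    refine cdist (by have := hε.pos; positivity) (fun l => ?_) w
    have h2 := hε.s1' ((j - i) * cz l) (by
      rw [Ne, (hu l).mul_left_eq_zero]
      exact fun h => hij (sub_eq_zero.1 h).symm)
    have e : ((ZMod.toCircle ((j - i) * cz l) : Circle) : ℂ) - 1 =
        (ZMod.toCircle (j * cz l) : ℂ) * ((ZMod.toCircle (-(i * cz l)) : ℂ) - ZMod.toCircle (-(j * cz l))) := by
      rw [mul_sub, ← Circle.coe_mul, ← Circle.coe_mul, ← AddChar.map_add_eq_mul, ← AddChar.map_add_eq_mul,
        add_neg_cancel, AddChar.map_zero_eq_one, sub_mul, sub_eq_add_neg (j * cz l)]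
      simp
    rw [e, norm_mul, Circle.norm_coe, one_mul] at h2
    simp only [gg, Circle.coe_mul]
    rw [← sub_mul, norm_mul, Circle.norm_coe, mul_one]
    exact h2
  have h2 : ‖(cmul (gg cz i) w).1 - (cmul (gg cz j) w).1‖ ≤ ‖x.1 - (cmul (gg cz i) w).1‖ + ‖x.1 - (cmul (gg cz j) w).1‖ := by
    rw [show (cmul (gg cz i) w).1 - (cmul (gg cz j) w).1 = (x.1 - (cmul (gg cz j) w).1) - (x.1 - (cmul (gg cz i) w).1) by abel]
    exact (norm_sub_le _ _).trans (by linarith)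
  linarith

lemma cmul_cont' {T : Type*} [TopologicalSpace T] {c : T → Fin k → Circle} {x : T → Sp k}
    (hc : ∀ i, Continuous fun t => c t i) (hx : Continuous x) : Continuous fun t => cmul (c t) (x t) :=
  continuous_Sp fun j => by
    simp only [cmul_apply]
    have := hc j
    have h2 := continuous_coord (k := k) j
    have h3 : Continuous fun t => (x t).1 j := h2.comp hx
    fun_prop

include hε hu in
lemma RN_cont : Continuous fun p : Sp k × Sp k => RN ε cz p.1 p.2 := by
  refine nr_cont (Kf_cont ε (by fun_prop) fun j => ?_) fun p => RN_ne hε hu p.1 p.2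
  have : Continuous fun p : Sp k × Sp k => cmul (gg cz j) p.2 := cmul_cont' (by fun_prop) continuous_snd
  fun_prop

include hε in
lemma RN_self (x : Sp k) : RN ε cz x x = x := by
  rw [RN, Kf_zero hε.pos, nr_smul (by have := hε.pos; positivity), nr_of_sp]
  intro j
  nth_rw 1 [← cmul_one' x]
  refine cdist hε.pos.le (fun l => ?_) x
  rw [norm_sub_rev]
  simpa [gg] using hε.s2' (-(j * cz l))

lemma Kf_dg (u : Fin k → Circle) (x : Sp k) (v : ZMod N → Sp k)
    (h : Kf ε x.1 (fun j => (v j).1) ≠ 0) :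
    nr (Kf ε (cmul u x).1 fun j => (cmul u (v j)).1) = cmul u (nr (Kf ε x.1 fun j => (v j).1)) := by
  let D : EuclideanSpace ℂ (Fin k) →ₗ[ℝ] EuclideanSpace ℂ (Fin k) :=
    { toFun := fun z => WithLp.toLp 2 fun j => (u j : ℂ) * z j
      map_add' := fun x y => PiLp.ext fun j => by simp [mul_add]
      map_smul' := fun c x => PiLp.ext fun j => by simp; ring }
  have hn : ∀ z, ‖D z‖ = ‖z‖ := fun z => by
    have : ‖D z‖ ^ 2 = ‖z‖ ^ 2 := by
      rw [EuclideanSpace.norm_sq_eq, EuclideanSpace.norm_sq_eq]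
      refine Finset.sum_congr rfl fun j _ => ?_
      show ‖(u j : ℂ) * z j‖ ^ 2 = _
      rw [norm_mul, Circle.norm_coe, one_mul]
    exact (pow_left_inj₀ (norm_nonneg _) (norm_nonneg _) two_ne_zero).1 this
  have hD : ∀ x : Sp k, (cmul u x).1 = D x.1 := fun x => rfl
  have hK : Kf ε (cmul u x).1 (fun j => (cmul u (v j)).1) = D (Kf ε x.1 fun j => (v j).1) := by
    simp only [Kf, bf, hD, ← map_sub, hn]
    simp [map_sub, map_sum, map_smul]
  rw [hK]
  have h2 : D (Kf ε x.1 fun j => (v j).1) ≠ 0 := by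
      rw [← norm_ne_zero_iff, hn, norm_ne_zero_iff]; exact h
  refine Subtype.ext ?_
  rw [nr_val h2, hD, nr_val h, hn, map_smul]


lemma Kf_reindex (g : ZMod N ≃ ZMod N) (x : EuclideanSpace ℂ (Fin k)) (v : ZMod N → EuclideanSpace ℂ (Fin k)) :
    Kf ε x (fun j => v (g j)) = Kf ε x v := by
  unfold Kf
  rw [Equiv.sum_comp g fun j => bf ε x (v j), Equiv.sum_comp g fun j => bf ε x (v j) • v j]

include hε hu in
lemma RN_equi (m : ZMod N) (x w : Sp k) : RN ε cz (cmul (fun i => ZMod.toCircle (m * cz i)) x) w =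
    cmul (fun i => ZMod.toCircle (m * cz i)) (RN ε cz x w) := by
  unfold RN
  rw [← Kf_dg _ x _ (RN_ne hε hu x w), ← Kf_reindex (Equiv.subRight m)]
  congr 2
  funext j
  congr 1
  refine Sp.ext' fun i => ?_
  simp only [cmul_apply, gg, Equiv.subRight_apply, ← mul_assoc, ← Circle.coe_mul, ← AddChar.map_add_eq_mul]
  congr 4
  ring

/-- the family used to compute the degree -/
noncomputable def FT (ε : ℝ) (u : ZMod N → Fin k → Circle) (w : Sp k) : Sp k :=
  nr (Kf ε (ee : Sp k).1 fun j : ZMod N => (cmul (u j) w).1)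

lemma coord_le (x y : Sp k) (i : Fin k) : ‖x.1 i - y.1 i‖ ≤ ‖x.1 - y.1‖ := by
  rw [← PiLp.sub_apply]; exact PiLp.norm_apply_le _ i

section FT
variable {u : ZMod N → Fin k → Circle} (h0 : ∀ j, u j 0 = ZMod.toCircle (-j) * eta N)

include hε h0 in
lemma FT_sep (w : Sp k) (i j : ZMod N) (hi : ‖(ee : Sp k).1 - (cmul (u i) w).1‖ < ε)
    (hj : ‖(ee : Sp k).1 - (cmul (u j) w).1‖ < ε) : i = j := by
  have hi := (coord_le _ _ 0).trans_lt hi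
  have hj := (coord_le _ _ 0).trans_lt hj
  rw [ee_apply, cmul_apply, h0] at hi hj
  by_contra hij
  set z := ((ZMod.toCircle (-j) * eta N : Circle) : ℂ) * w.1 0 with hz
  have e : ((ZMod.toCircle (-i) * eta N : Circle) : ℂ) * w.1 0 = (ZMod.toCircle (j - i) : ℂ) * z := by
    rw [hz, ← mul_assoc, ← Circle.coe_mul, ← mul_assoc, ← AddChar.map_add_eq_mul]
    congr 4; ring
  rw [e] at hi
  have h1 := hε.s1 (j - i) (fun h => hij (sub_eq_zero.1 h).symm) z (by
    have h2 := norm_sub_norm_le (((√k)⁻¹ : ℝ) : ℂ) z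
    rw [Complex.norm_real, Real.norm_eq_abs, abs_of_pos sk_pos] at h2
    linarith)
  have h2 := norm_sub_le (((√k)⁻¹ : ℝ) - z) (((√k)⁻¹ : ℝ) - (ZMod.toCircle (j - i) : ℂ) * z)
  rw [show (((√k)⁻¹ : ℝ) - z) - (((√k)⁻¹ : ℝ) - (ZMod.toCircle (j - i) : ℂ) * z) = (ZMod.toCircle (j - i) : ℂ) * z - z by ring] at h2
  linarith

include hε h0 in
lemma FT_ne (w : Sp k) : Kf ε (ee : Sp k).1 (fun j : ZMod N => (cmul (u j) w).1) ≠ 0 :=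
  Kf_ne hε.pos (Sp.norm _) (fun j => Sp.norm _) (FT_sep hε h0 w)

include hε h0 in
lemma FT_ee : FT ε u ee = ee := by
  rw [FT, Kf_zero hε.pos, nr_smul (by have := hε.pos; positivity), nr_of_sp]
  intro j
  refine le_trans ?_ (coord_le _ _ 0)
  rw [cmul_apply, h0, ee_apply, norm_sub_rev, show ∀ a b : ℂ, a * b - b = (a - 1) * b by intros; ring, norm_mul,
    Complex.norm_real, Real.norm_eq_abs, abs_of_pos sk_pos]
  simpa using hε.s2 (-j)

include hε h0 in
lemma FT_final (h1 : ∀ j i, i ≠ 0 → ((u j i : Circle) : ℂ) = -1) (w : Sp k) : (FT ε u w).1 ≠ -(dl N w).1 := by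
  intro hw
  have hsk := sk_pos (k := k)
  have hNpos : (0 : ℝ) < N := by exact_mod_cast Nat.pos_of_ne_zero (NeZero.ne N)
  have hK := FT_ne hε h0 w
  rw [FT, nr_val hK] at hw
  set K := Kf ε (ee : Sp k).1 (fun j : ZMod N => (cmul (u j) w).1) with hKdef
  have hs : 0 < ‖K‖ := norm_pos_iff.2 hK
  set s := ‖K‖
  have hK2 : ∀ i, K i = -((s : ℂ) * (dl N w).1 i) := by
    intro i
    have := congrArg (fun v : EuclideanSpace ℂ (Fin k) => (s : ℂ) * v i) hw
    simp only [PiLp.smul_apply, PiLp.neg_apply, Complex.real_smul] at this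
    rw [← mul_assoc, ← Complex.ofReal_mul, mul_inv_cancel₀ hs.ne'] at this
    simpa using this
  have hd0 : (dl N w).1 0 = pw N (w.1 0) := by simp [dl, dli]
  have hdi : ∀ i : Fin k, i ≠ 0 → (dl N w).1 i = w.1 i := fun i hi => by simp [dl, dli, hi]
  by_cases hb : ∀ j, ε ≤ ‖(ee : Sp k).1 - (cmul (u j) w).1‖
  · have hKe : K = ε ^ 2 • (ee : Sp k).1 := Kf_zero hε.pos hb
    have hsε : s = ε ^ 2 := by
      show ‖K‖ = _
      rw [hKe, norm_smul, Sp.norm, mul_one, Real.norm_eq_abs, abs_of_nonneg (by positivity)]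
    have hse : (s : ℂ) ≠ 0 := by exact_mod_cast hs.ne'
    have e : ∀ i, (dl N w).1 i = -((√k)⁻¹ : ℝ) := by
      intro i
      have := hK2 i
      rw [hKe, PiLp.smul_apply, ee_apply, ← hsε, Complex.real_smul, ← mul_neg] at this
      have h9 := mul_left_cancel₀ hse this
      rw [h9, neg_neg]
    obtain ⟨r, c, hr, hc, hwc⟩ := exists_polar (w.1 0)
    have e0 := e 0
    rw [hd0, hwc, pw_polar _ hr hc] at e0
    have hrk : r = (√k)⁻¹ := by
      have := congrArg (‖·‖) e0
      simp only [norm_mul, norm_zpow, hc, one_zpow, mul_one, norm_neg, Complex.norm_real, Real.norm_eq_abs,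
        abs_of_nonneg hr, abs_of_pos hsk] at this
      exact this
    have hcN : c ^ N = -1 := by
      rw [hrk, zpow_natCast] at e0
      have : (((√k)⁻¹ : ℝ) : ℂ) ≠ 0 := by exact_mod_cast hsk.ne'
      apply mul_left_cancel₀ this
      rw [e0]; ring
    obtain ⟨m, hm⟩ := tC_surj (N := N) (c := c * eta N) (by rw [mul_pow, hcN, eta_pow]; norm_num)
    have := hb m
    have e3 : cmul (u m) w = ee := by
      refine Sp.ext' fun i => ?_
      rw [cmul_apply, ee_apply]
      by_cases hi : i = 0
      · subst hi
        rw [h0, hwc, hrk, Circle.coe_mul]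
        have : ((ZMod.toCircle (-m) : Circle) : ℂ) * (c * eta N) = 1 := by
          rw [← hm, ← Circle.coe_mul, ← AddChar.map_add_eq_mul]; simp
        linear_combination (((√k)⁻¹ : ℝ) : ℂ) * this
      · rw [h1 _ _ hi, ← hdi i hi, e i]; ring
    rw [e3, sub_self, norm_zero] at this
    exact absurd this (not_le.2 hε.pos)
  · push Not at hb
    obtain ⟨j, hj⟩ := hb
    have hK1 := Kf_one (v := fun j : ZMod N => (cmul (u j) w).1) hε.pos hj fun i hi => by
      by_contra hc
      exact hi (FT_sep hε h0 w i j (not_le.1 hc) hj)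
    rw [← hKdef] at hK1
    set v := cmul (u j) w with hv
    set d := ‖(ee : Sp k).1 - v.1‖ ^ 2 with hd
    have hb : 0 < ε ^ 2 - d := by
      have : d < ε ^ 2 := by rw [hd]; exact pow_lt_pow_left₀ hj (norm_nonneg _) two_ne_zero
      linarith
    set b := ε ^ 2 - d
    have hK3 : ∀ i, (d : ℂ) * ((√k)⁻¹ : ℝ) - b * v.1 i = -((s : ℂ) * (dl N w).1 i) := by
      intro i
      rw [← hK2 i, hK1]
      simp
    have hsb : (s + b : ℂ) ≠ 0 := by
      have : s + b ≠ 0 := by positivity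
      exact_mod_cast this
    have hvi : ∀ i, v.1 i = (d / (s + b)) * ((√k)⁻¹ : ℝ) := by
      intro i
      by_cases hi : i = 0
      · subst hi
        have hv0 : ((u j 0 : Circle) : ℂ) ^ N = -1 := by
          rw [h0, Circle.coe_mul, mul_pow, tC_pow, eta_pow, one_mul]
        have hp : pw N (w.1 0) = -pw N (v.1 0) := by
          rw [hv, cmul_apply, pw_mul _ (Circle.norm_coe _), zpow_natCast, hv0]; ring
        have h3 := hK3 0
        rw [hd0, hp] at h3
        have harg : |(v.1 0).arg| < Real.pi / N := by
          apply hε.s3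
          rw [norm_sub_rev]
          have := (coord_le ee v 0).trans_lt hj
          rwa [ee_apply] at this
        set φ := (v.1 0).arg
        set r := ‖v.1 0‖
        have hr : 0 < r := by
          have := (coord_le ee v 0).trans_lt hj
          rw [ee_apply] at this
          have h2 := norm_sub_norm_le (((√k)⁻¹ : ℝ) : ℂ) (v.1 0)
          rw [Complex.norm_real, Real.norm_eq_abs, abs_of_pos sk_pos] at h2
          have := hε.s4
          show 0 < ‖v.1 0‖
          linarith
        have hpol : v.1 0 = r * Complex.exp (φ * Complex.I) := (Complex.norm_mul_exp_arg_mul_I _).symm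
        rw [hpol, pw_exp _ hr.le] at h3
        have him := congrArg Complex.im h3
        have hφ : φ = 0 := by
          simp only [Complex.sub_im, Complex.mul_im, Complex.ofReal_im, Complex.ofReal_re, Complex.neg_im,
            Complex.exp_ofReal_mul_I_im, Complex.exp_ofReal_mul_I_re, zero_mul, mul_zero, add_zero, Int.cast_natCast] at him
          by_contra hne
          have hNφ : |N * φ| < Real.pi := by
            rw [abs_mul, Nat.abs_cast, mul_comm]
            rwa [lt_div_iff₀ hNpos] at harg
          have hφ1 : |φ| < Real.pi := by
            refine harg.trans_le (div_le_self Real.pi_pos.le ?_)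
            exact_mod_cast Nat.pos_of_ne_zero (NeZero.ne N)
          rw [abs_lt] at hNφ hφ1
          rcases lt_or_gt_of_ne hne with h | h
          · have a1 := Real.sin_neg_of_neg_of_neg_pi_lt h hφ1.1
            have a2 := Real.sin_neg_of_neg_of_neg_pi_lt (mul_neg_of_pos_of_neg hNpos h) hNφ.1
            have : b * (r * Real.sin φ) < 0 := mul_neg_of_pos_of_neg hb (mul_neg_of_pos_of_neg hr a1)
            have : s * (r * Real.sin (N * φ)) < 0 := mul_neg_of_pos_of_neg hs (mul_neg_of_pos_of_neg hr a2)
            linarith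
          · have a1 := Real.sin_pos_of_pos_of_lt_pi h hφ1.2
            have a2 := Real.sin_pos_of_pos_of_lt_pi (mul_pos hNpos h) hNφ.2
            have : 0 < b * (r * Real.sin φ) := mul_pos hb (mul_pos hr a1)
            have : 0 < s * (r * Real.sin (N * φ)) := mul_pos hs (mul_pos hr a2)
            linarith
        rw [hφ] at h3 hpol
        simp only [Complex.ofReal_zero, zero_mul, Complex.exp_zero, mul_one, mul_zero] at h3 hpol
        rw [hpol]
        field_simp
        field_simp at h3
        linear_combination -h3
      · have h3 := hK3 i
        have h4 : v.1 i = -w.1 i := by rw [hv, cmul_apply, h1 _ _ hi]; ring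
        rw [hdi i hi, show w.1 i = -v.1 i by rw [h4]; ring] at h3
        field_simp
        field_simp at h3
        linear_combination -h3
    have hve : v.1 = (d / (s + b)) • (ee : Sp k).1 := PiLp.ext fun i => by
      rw [hvi]; simp
    have hd0 : 0 ≤ d := by positivity
    have hκ : d / (s + b) = 1 := by
      have := congrArg (‖·‖) hve
      simp only [norm_smul, Sp.norm, mul_one, Real.norm_eq_abs] at this
      rw [abs_of_nonneg (by positivity)] at this
      exact this.symm
    have hd1 : d = 0 := by rw [hd, hve, hκ]; simp
    rw [hd1] at hκ
    simp at hκ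

end FT

include hε hu in
lemma RN_deg2 (h0 : cz 0 = 1) : PDeg (fun w => RN ε cz ee w) N := by
  let u : I → ZMod N → Fin k → Circle := fun t j i => if i = 0 then ZMod.toCircle (-j) * eta N else
    Circle.exp ((1 - t) * Complex.arg (gg cz j i) + t * Real.pi)
  have hu0 : ∀ t j, u t j 0 = ZMod.toCircle (-j) * eta N := fun t j => by simp [u]
  have huc : ∀ j i, Continuous fun t => u t j i := fun j i => by
    simp only [u]; split_ifs <;> fun_prop
  have hF : Continuous fun p : I × Sp k => FT ε (u p.1) p.2 := by
    refine nr_cont (Kf_cont ε continuous_const fun j => ?_) fun p => FT_ne hε (hu0 p.1) p.2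
    have := cmul_cont' (c := fun p : I × Sp k => u p.1 j) (x := fun p => p.2)
      (fun i => (huc j i).comp continuous_fst) continuous_snd
    exact continuous_subtype_val.comp this
  have H1 : Hm {ee} (FT (k := k) ε (u 0)) (FT ε (u 1)) :=
    ⟨_, hF, fun _ => rfl, fun _ => rfl, by rintro t _ rfl; simp only [FT_ee hε (hu0 _)]⟩
  have e : FT ε (u 0) = fun w => RN ε cz ee w := by
    have : u 0 = gg cz := by
      funext j i
      simp only [u, gg]
      split_ifs with h
      · rw [h, h0, mul_one]
      · simpa using Circle.exp_arg (ZMod.toCircle (-(j*cz i)) * eta N)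
    rw [this]; rfl
  rw [e] at H1
  refine H1.trans (seg_Hm H1.right (dl_cont _) _ (FT_final hε (hu0 1) fun j i hi => ?_) ?_)
  · simp [u, hi, Circle.coe_exp]
  · rintro _ rfl
    rw [FT_ee hε (hu0 1), dl, dli_ee]

include hε hu in
lemma RN_deg1 (h0 : cz 0 = 1) : PDeg (fun x => RN ε cz x ee) (1 - N) :=
  PDeg.first (RN_cont hε hu) (RN_self hε) (RN_deg2 hε hu h0)

end
end LS.Up


namespace LS.Up
set_option linter.all false
open Topology unitInterval

section HE
variable {X Y Z : Type*} [TopologicalSpace X] [TopologicalSpace Y] [TopologicalSpace Z]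

/-- homotopy equivalences -/
def HE (f : X → Y) : Prop := Continuous f ∧ ∃ g : Y → X, Continuous g ∧ Hm ∅ (fun x => g (f x)) (fun x => x) ∧
  Hm ∅ (fun y => f (g y)) (fun y => y)

lemma Hm.pre' {f g : X → Y} (h : Hm ∅ f g) {φ : Z → X} (hφ : Continuous φ) :
    Hm ∅ (fun x => f (φ x)) (fun x => g (φ x)) := h.pre hφ (by simp)

lemma HE.of_lr {f : X → Y} (hf : Continuous f) {l r : Y → X} (hl : Continuous l) (hr : Continuous r)
    (h1 : Hm ∅ (fun x => l (f x)) (fun x => x)) (h2 : Hm ∅ (fun y => f (r y)) (fun y => y)) : HE f := by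
  refine ⟨hf, l, hl, h1, ?_⟩
  have a1 : Hm ∅ (fun y => f (l (f (r y)))) (fun y => f (l y)) := h2.post (hf.comp hl)
  have a2 : Hm ∅ (fun y => f (l (f (r y)))) (fun y => f (r y)) := (h1.pre' hr).post hf
  exact (a1.symm.trans a2).trans h2

lemma HE.comp {f : X → Y} {g : Y → Z} (hg : HE g) (hf : HE f) : HE (fun x => g (f x)) := by
  obtain ⟨cf, f', cf', hf1, hf2⟩ := hf
  obtain ⟨cg, g', cg', hg1, hg2⟩ := hg
  refine ⟨cg.comp cf, fun z => f' (g' z), cf'.comp cg', ?_, ?_⟩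
  · exact ((hg1.pre' cf).post cf').trans hf1
  · exact ((hf2.pre' cg').post cg).trans hg2

lemma HE.congr {f g : X → Y} (hf : HE f) (h : Hm ∅ f g) : HE g := by
  obtain ⟨cf, f', cf', hf1, hf2⟩ := hf
  refine ⟨h.right, f', cf', ?_, ?_⟩
  · exact (h.symm.post cf').trans hf1
  · exact (h.symm.pre' cf').trans hf2

lemma HE.two {f : X → Y} {g : Y → Z} (hg : Continuous g) (hf : HE f) (h : HE fun x => g (f x)) : HE g := by
  obtain ⟨cf, f', cf', hf1, hf2⟩ := hf
  have h1 : HE (fun y => g (f (f' y))) := HE.comp (g := fun x => g (f x)) (f := f') h ⟨cf', f, cf, hf2, hf1⟩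
  exact h1.congr (hf2.post hg)

lemma HE_swap : HE (Prod.swap : X × Y → Y × X) :=
  ⟨continuous_swap, Prod.swap, continuous_swap, .of_eq _ (by fun_prop) fun _ => by simp, .of_eq _ (by fun_prop) fun _ => by simp⟩

end HE

section LF
variable {k : ℕ} [NeZero k]

noncomputable def pole (c : ℂ) (hc : ‖c‖ = 1) : Sp k := ⟨WithLp.toLp 2 fun j => if j = 0 then c else 0,
  (Sp.mem_iff _).2 (by simp [apply_ite, hc])⟩

noncomputable def polp : Sp k := pole Complex.I (by simp)
noncomputable def polm : Sp k := pole (-Complex.I) (by simp)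

lemma polp_0 : (polp : Sp k).1 0 = Complex.I := by simp [polp, pole]
lemma polm_0 : (polm : Sp k).1 0 = -Complex.I := by simp [polm, pole]

lemma polm_eq : (polm : Sp k).1 = -(polp : Sp k).1 := by
  refine PiLp.ext fun j => ?_
  simp only [polm, polp, pole, PiLp.neg_apply]
  split_ifs <;> simp

noncomputable def lv (z : Sp k) : ℝ := (z.1 0).im

lemma lv_cont : Continuous (lv : Sp k → ℝ) := by unfold lv; fun_prop

lemma lv_le (z : Sp k) : lv z ≤ 1 := by
  have h2 : ‖z.1 0‖ ≤ ‖z.1‖ := PiLp.norm_apply_le _ _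
  have h3 := Sp.norm z
  have h1 := (Complex.abs_im_le_norm (z.1 0))
  have := le_abs_self (z.1 0).im
  unfold lv; linarith

lemma hcj (j : Fin k) (z : ℂ) : ‖(if j = 0 then (starRingEnd ℂ) z else z)‖ = ‖z‖ := by
  split_ifs <;> simp

lemma hfj (j : Fin k) (z : ℂ) : ‖(if j = 0 then (⟨z.re, |z.im|⟩ : ℂ) else z)‖ = ‖z‖ := by
  split_ifs
  · rw [Complex.norm_def, Complex.norm_def, Complex.normSq_mk, Complex.normSq_apply, abs_mul_abs_self]
  · rfl

noncomputable def ref : Sp k → Sp k := cw (fun j z => if j = 0 then (starRingEnd ℂ) z else z) hcj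
noncomputable def fold : Sp k → Sp k := cw (fun j z => if j = 0 then (⟨z.re, |z.im|⟩ : ℂ) else z) hfj

lemma ref_cont : Continuous (ref : Sp k → Sp k) := continuous_Sp fun j => by
  simp only [ref, cw_apply]
  split_ifs <;> fun_prop

lemma fold_cont : Continuous (fold : Sp k → Sp k) := continuous_Sp fun j => by
  simp only [fold, cw_apply]
  split_ifs
  · have : (fun y : Sp k => (⟨(y.1 j).re, |(y.1 j).im|⟩ : ℂ)) = fun y => (((y.1 j).re : ℝ) : ℂ) + ((|(y.1 j).im| : ℝ) : ℂ) * Complex.I := by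
      funext y; rw [← Complex.mk_eq_add_mul_I]
    rw [this]; fun_prop
  · fun_prop

lemma lv_ref (z : Sp k) : lv (ref z) = - lv z := by simp [lv, ref]
lemma ref_ref (z : Sp k) : ref (ref z) = z := Sp.ext' fun j => by
  simp only [ref, cw_apply]; split_ifs <;> simp
lemma lv_ee : lv (ee : Sp k) = 0 := by rw [lv, ee_apply]; exact Complex.ofReal_im _
lemma fold_pos {z : Sp k} (h : 0 ≤ lv z) : fold z = z := Sp.ext' fun j => by
  simp only [fold, cw_apply]; split_ifs with hj
  · subst hj; apply Complex.ext; · rfl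
    · exact abs_of_nonneg h
  · rfl
lemma fold_neg {z : Sp k} (h : lv z ≤ 0) : fold z = ref z := Sp.ext' fun j => by
  simp only [fold, ref, cw_apply]; split_ifs with hj
  · subst hj; apply Complex.ext; · simp
    · simpa [lv] using abs_of_nonpos h
  · rfl
lemma ref_ee : ref (ee : Sp k) = ee := by
  rw [← fold_neg lv_ee.le, fold_pos lv_ee.ge]

lemma fold_null : Hm ∅ (fold : Sp k → Sp k) (fun _ => ee) := by
  have h1 : Hm ∅ (fold : Sp k → Sp k) (fun _ => polp) := by
    refine seg_Hm fold_cont continuous_const _ (fun z hz => ?_) (by simp)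
    have := congrArg (fun v : EuclideanSpace ℂ (Fin k) => (v 0).im) hz
    simp only [PiLp.neg_apply, polp_0, fold, cw_apply, if_true, Complex.neg_im, Complex.I_im] at this
    have := abs_nonneg (z.1 0).im
    linarith
  refine h1.trans (seg_Hm continuous_const continuous_const _ (fun z hz => ?_) (by simp))
  have := congrArg (fun v : EuclideanSpace ℂ (Fin k) => (v 0).im) hz
  simp only [PiLp.neg_apply, polp_0, Complex.neg_im, Complex.I_im] at this
  have h2 : ((ee : Sp k).1 0).im = 0 := lv_ee
  rw [h2] at this; norm_num at this

lemma polm_ee {X : Type*} [TopologicalSpace X] : Hm (∅ : Set X) (fun _ => (polm : Sp k)) (fun _ => ee) := by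
  refine seg_Hm continuous_const continuous_const _ (fun z hz => ?_) (by simp)
  have := congrArg (fun v : EuclideanSpace ℂ (Fin k) => (v 0).im) hz
  simp only [PiLp.neg_apply, polm_0, Complex.neg_im, Complex.I_im] at this
  have h2 : ((ee : Sp k).1 0).im = 0 := lv_ee
  rw [h2] at this; norm_num at this

/-- collapse of a neighbourhood of the lower hemisphere -/
noncomputable def lmu (z : Sp k) : ℝ := min 1 (2 * (1 - lv z))

lemma lmu_mem (z : Sp k) : 0 ≤ lmu z ∧ lmu z ≤ 1 := by
  have := lv_le z
  exact ⟨le_min zero_le_one (by linarith), min_le_left _ _⟩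

lemma lc_ne (s : I) (z : Sp k) : (1 - s * lmu z) • z.1 + (s * lmu z) • (polm : Sp k).1 ≠ 0 := by
  by_cases h : z.1 = -(polm : Sp k).1
  · have h0 : lmu z = 0 := by
      have : lv z = 1 := by rw [lv, h, PiLp.neg_apply, polm_0]; simp
      simp [lmu, this]
    rw [h0]
    simp only [mul_zero, sub_zero, one_smul, zero_smul, add_zero]
    intro h; have := Sp.norm z; rw [h, norm_zero] at this; norm_num at this
  · have := lmu_mem z
    exact seg_ne h _ (mul_nonneg s.2.1 this.1) (mul_le_one₀ s.2.2 this.1 this.2)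

noncomputable def lc (s : ℝ) (z : Sp k) : Sp k := nr ((1 - s * lmu z) • z.1 + (s * lmu z) • (polm : Sp k).1)

lemma lc_cont : Continuous fun p : I × Sp k => lc p.1 p.2 := by
  have : Continuous (lmu : Sp k → ℝ) := by have := lv_cont (k := k); unfold lmu; fun_prop
  exact nr_cont (by fun_prop) fun p => lc_ne p.1 p.2

lemma lc_low {z : Sp k} (h : lv z ≤ 1 / 2) : lc 1 z = polm := by
  have : lmu z = 1 := min_eq_left (by linarith)
  simp [lc, this, nr_of_sp]

lemma lc_Hm : Hm ∅ (fun z : Sp k => z) (lc 1) :=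
  ⟨fun p => lc p.1 p.2, lc_cont, fun x => by simp [lc, nr_of_sp], fun x => rfl, by simp⟩

lemma normalize {R : Sp k → Sp k → Sp k} (hR : Continuous fun p : Sp k × Sp k => R p.1 p.2)
    (h : Hm ∅ (fun w => R ee w) (fun w => w)) :
    ∃ R' : Sp k → Sp k → Sp k, Hm ∅ (fun p : Sp k × Sp k => R p.1 p.2) (fun p => R' p.1 p.2) ∧
      ∀ z w, lv z ≤ 0 → R' z w = w := by
  have h2 : Hm ∅ (fun w => R polm w) (fun w => w) := by
    refine Hm.trans ?_ h
    exact Hm.map2 (polm_ee (X := Sp k)) (.refl ∅ continuous_id) hR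
  obtain ⟨H, hH, H0, H1, -⟩ := h2
  simp only at H0 H1
  have h1 : Hm ∅ (fun p : Sp k × Sp k => R p.1 p.2) (fun p => R (lc 1 p.1) p.2) :=
    Hm.map2 (lc_Hm.pre' continuous_fst) (.refl ∅ continuous_snd) hR
  have hlc := h1.right
  have hlv := lv_cont (k := k)
  let cl : ℝ → I := Set.projIcc 0 1 zero_le_one
  have hcl : Continuous cl := continuous_projIcc
  let Q : I × (Sp k × Sp k) → Sp k := fun p => if lv p.2.1 ≤ 1 / 2 then H (cl (p.1 * (1 - 2 * max (lv p.2.1) 0)), p.2.2)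
    else R (lc 1 p.2.1) p.2.2
  have hQ : Continuous Q := by
    refine Continuous.if_le ?_ ?_ (by fun_prop) (by fun_prop) ?_
    · fun_prop
    · exact hlc.comp continuous_snd
    · intro p hp
      rw [lc_low hp.le, hp, ← H0]
      congr 2
      simp [cl]
  refine ⟨fun z w => Q (1, z, w), h1.trans ⟨Q, hQ, ?_, fun x => rfl, by simp⟩, fun z w hz => ?_⟩
  · intro x
    simp only [Q]
    split_ifs with hx
    · rw [lc_low hx, ← H0]; congr 2; simp [cl]
    · rfl
  · simp only [Q]
    rw [if_pos (by linarith), max_eq_right hz]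
    refine Eq.trans ?_ (H1 w)
    congr 2; simp [cl]

/-- Lemma F -/
lemma lemF {R : Sp k → Sp k → Sp k} (hR : Continuous fun p : Sp k × Sp k => R p.1 p.2)
    (h : Hm ∅ (fun w => R ee w) (fun w => w)) :
    ∃ G : Sp k → Sp k → Sp k, Continuous (fun p : Sp k × Sp k => G p.1 p.2) ∧
      Hm ∅ (fun p : Sp k × Sp k => (p.1, G p.1 (R p.1 p.2))) (fun p => p) ∧
      Hm ∅ (fun p : Sp k × Sp k => R p.1 (G p.1 p.2)) (fun p => p.2) ∧
      Hm ∅ (fun p : Sp k × Sp k => (p.1, R p.1 (G p.1 p.2))) (fun p => p) ∧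
      (Hm ∅ (fun z => R z ee) (fun _ => ee) → Hm ∅ (fun z => G z ee) (fun _ => ee)) := by
  obtain ⟨R', hRR, hR'⟩ := normalize hR h
  have cR' := hRR.right
  have cG : Continuous (fun p : Sp k × Sp k => R' (ref p.1) p.2) := by
    have h1 : Continuous fun p : Sp k × Sp k => (ref p.1, p.2) := by have := ref_cont (k := k); fun_prop
    have h3 := cR'.comp h1; simpa only [Function.comp_def] using h3
  have key : Hm ∅ (fun p : Sp k × Sp k => R' (fold p.1) p.2) (fun p => p.2) := by
    have h1 := Hm.map2 (fold_null.pre' (φ := fun p : Sp k × Sp k => p.1) continuous_fst) (.refl ∅ continuous_snd) cR'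
    exact h1.trans (.of_eq _ h1.right fun p => hR' _ _ lv_ee.le)
  have e1 : ∀ p : Sp k × Sp k, R' (ref p.1) (R' p.1 p.2) = R' (fold p.1) p.2 := by
    rintro ⟨z, w⟩
    rcases le_total (lv z) 0 with hz | hz
    · rw [hR' z w hz, fold_neg hz]
    · rw [hR' (ref z) _ (by rw [lv_ref]; linarith), fold_pos hz]
  have e2 : ∀ p : Sp k × Sp k, R' p.1 (R' (ref p.1) p.2) = R' (fold p.1) p.2 := by
    rintro ⟨z, w⟩
    rcases le_total (lv z) 0 with hz | hz
    · rw [hR' z _ hz, fold_neg hz]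
    · rw [hR' (ref z) _ (by rw [lv_ref]; linarith), fold_pos hz]
  have k1 : Hm ∅ (fun p : Sp k × Sp k => R' (ref p.1) (R p.1 p.2)) (fun p => p.2) := by
    have h1 : Hm ∅ (fun p : Sp k × Sp k => R' (ref p.1) (R p.1 p.2)) (fun p => R' (ref p.1) (R' p.1 p.2)) :=
      Hm.map2 (.refl ∅ (ref_cont.comp continuous_fst)) hRR cR'
    exact (h1.trans (.of_eq _ h1.right e1)).trans key
  have k2 : Hm ∅ (fun p : Sp k × Sp k => R p.1 (R' (ref p.1) p.2)) (fun p => p.2) := by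
    have h1 : Hm ∅ (fun p : Sp k × Sp k => R p.1 (R' (ref p.1) p.2)) (fun p => R' p.1 (R' (ref p.1) p.2)) :=
      hRR.pre' (continuous_fst.prodMk cG)
    exact (h1.trans (.of_eq _ h1.right e2)).trans key
  refine ⟨fun z w => R' (ref z) w, cG, ?_, k2, ?_, fun hn => ?_⟩
  · exact (Hm.refl ∅ continuous_fst).prod k1
  · exact (Hm.refl ∅ continuous_fst).prod k2
  · have h1 := hRR.symm.pre' (φ := fun z : Sp k => (ref z, (ee : Sp k))) (by have := ref_cont (k := k); fun_prop)
    exact h1.trans (hn.pre' ref_cont)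

lemma PDeg.one {f : Sp k → Sp k} (h : PDeg f 1) : Hm ∅ f (fun x => x) :=
  (h.trans PDeg_id.symm).mono (by simp)

lemma PDeg.zero {f : Sp k → Sp k} (h : PDeg f 0) : Hm ∅ f (fun x => ee) :=
  (h.mono (by simp)).trans dl0_null

lemma wedge_HE {T1 T2 : Sp k → Sp k → Sp k} (c1 : Continuous fun p : Sp k × Sp k => T1 p.1 p.2)
    (c2 : Continuous fun p : Sp k × Sp k => T2 p.1 p.2)
    (h11 : Hm ∅ (fun z => T1 z ee) (fun z => z))
    (h21 : Hm ∅ (fun z => T2 z ee) (fun z => ee)) (h22 : Hm ∅ (fun w => T2 ee w) (fun w => w)) :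
    HE (fun p : Sp k × Sp k => (T1 p.1 p.2, T2 p.1 p.2)) := by
  obtain ⟨G, cG, g1, g2, g3, g4⟩ := lemF c2 h22
  have cFG : Continuous fun p : Sp k × Sp k => (p.1, G p.1 p.2) := continuous_fst.prodMk cG
  have hFG : HE (fun p : Sp k × Sp k => (p.1, G p.1 p.2)) :=
    ⟨cFG, fun p => (p.1, T2 p.1 p.2), continuous_fst.prodMk c2, g3, g1⟩
  have cQ : Continuous fun p : Sp k × Sp k => T1 p.1 (G p.1 p.2) := by
    have h3 := c1.comp cFG; simpa only [Function.comp_def] using h3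
  have hQ : Hm ∅ (fun z => T1 z (G z ee)) (fun z => z) := by
    refine Hm.trans ?_ h11
    exact Hm.map2 (.refl ∅ continuous_id) (g4 h21) c1
  refine HE.two (c1.prodMk c2) hFG ?_
  obtain ⟨G', cG', g1', g2', g3', g4'⟩ := lemF (R := fun w z => T1 z (G z w)) (by
    have h3 := cQ.comp continuous_swap; simpa only [Function.comp_def, Prod.fst_swap, Prod.snd_swap] using h3) hQ
  have hQ' : HE (fun p : Sp k × Sp k => (p.1, T1 p.2 (G p.2 p.1))) :=
    ⟨continuous_fst.prodMk (by
      have h3 := cQ.comp continuous_swap; simpa only [Function.comp_def, Prod.fst_swap, Prod.snd_swap] using h3), fun p => (p.1, G' p.1 p.2),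
      continuous_fst.prodMk cG', g1', g3'⟩
  have hQ2 : HE (fun p : Sp k × Sp k => (T1 p.1 (G p.1 p.2), p.2)) := HE_swap.comp (hQ'.comp HE_swap)
  exact hQ2.congr ((Hm.refl ∅ cQ).prod g2.symm)

end LF
end LS.Up


namespace LS.Up
set_option linter.all false
open Topology unitInterval

section
variable {k : ℕ} [NeZero k]

structure BD (f : Sp k → Sp k → Sp k) (a b : ℤ) : Prop where
  c : Continuous fun p : Sp k × Sp k => f p.1 p.2
  l : PDeg (fun x => f x ee) a
  r : PDeg (fun x => f ee x) b

lemma BD.map2 {R f g : Sp k → Sp k → Sp k} {α β a b c d : ℤ} (hR : BD R α β) (hf : BD f a b) (hg : BD g c d) :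
    BD (fun x y => R (f x y) (g x y)) (α * a + β * c) (α * b + β * d) := by
  refine ⟨?_, PDeg.map2 hR.c hR.l hR.r hf.l hg.l, PDeg.map2 hR.c hR.l hR.r hf.r hg.r⟩
  have h3 := hR.c.comp (hf.c.prodMk hg.c); simpa only [Function.comp_def] using h3

lemma BD.post {f : Sp k → Sp k → Sp k} {a b m : ℤ} (hf : BD f a b) {h : Sp k → Sp k} (hh : PDeg h m) :
    BD (fun x y => h (f x y)) (m * a) (m * b) :=
  ⟨hh.left.comp hf.c, hh.comp hf.l, hh.comp hf.r⟩

lemma PDeg_const : PDeg (fun _ : Sp k => ee) 0 := by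
  have h := PDeg.map2 (R := fun x _ : Sp k => x) continuous_fst (α := 1) (β := 0) (a := 0) (b := 0)
  have h1 := coll_Hm (k := k)
  have h2 : Hm {(ee : Sp k)} (fun z => coll 1 (dl 0 z)) (fun _ => ee) :=
    .of_eq _ (coll_one_cont.comp (dl_cont 0)) fun z => coll_H0 (dl0_mem z)
  exact h2.symm.trans (h1.symm.pre (dl_cont 0) (by rintro _ rfl; exact dli_ee _ _))

lemma BD_fst : BD (fun x _ : Sp k => x) 1 0 := ⟨continuous_fst, PDeg_id, PDeg_const⟩
lemma BD_snd : BD (fun _ x : Sp k => x) 0 1 := ⟨continuous_snd, PDeg_const, PDeg_id⟩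

lemma tC_cast (q r : ℕ) [NeZero q] [NeZero r] [NeZero (q * r)] (y : ZMod (q * r)) :
    ZMod.toCircle ((r : ZMod (q * r)) * y) = ZMod.toCircle (ZMod.castHom (Dvd.intro _ rfl : q ∣ q * r) (ZMod q) y) := by
  obtain ⟨n, rfl⟩ := ZMod.intCast_surjective y
  rw [map_intCast]
  apply Circle.ext
  rw [show ((r : ZMod (q * r)) * (n : ZMod (q * r))) = ((r * n : ℤ) : ZMod (q * r)) by push_cast; rfl,
    ZMod.toCircle_intCast, ZMod.toCircle_intCast]
  congr 1
  have h1 : (q : ℂ) ≠ 0 := by exact_mod_cast NeZero.ne q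
  have h2 : (r : ℂ) ≠ 0 := by exact_mod_cast NeZero.ne r
  push_cast
  field_simp

lemma exR (q r : ℕ) [NeZero q] [NeZero r] (ℓ : Fin k → ℤ) (hℓ : ∀ j, IsCoprime (ℓ j) (q : ℤ)) :
    ∃ R : Sp k → Sp k → Sp k, BD R (1 - (q * r : ℕ)) (q * r : ℕ) ∧
      ∀ (b : ZMod q) x w, R (la ℓ b x) w = la ℓ b (R x w) := by
  haveI : NeZero (q * r) := ⟨mul_ne_zero (NeZero.ne q) (NeZero.ne r)⟩
  have hu : ∀ j, ∃ u : (ZMod q)ˣ, (u : ZMod q) = ℓ j := by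
    intro j
    obtain ⟨u, v, huv⟩ := hℓ j
    have : ((ℓ j : ℤ) : ZMod q) * (u : ZMod q) = 1 := by
      have := congrArg (fun t : ℤ => (t : ZMod q)) huv
      simp at this
      rw [mul_comm]; exact this
    exact ⟨Units.mkOfMulEqOne _ _ this, rfl⟩
  choose u hu using hu
  choose V hV using fun j => ZMod.unitsMap_surjective (Dvd.intro _ rfl : q ∣ q * r) (u j)
  obtain ⟨ε, hε⟩ := Ge.ex k (q * r)
  let cz : Fin k → ZMod (q * r) := fun i => ((V i * (V 0)⁻¹ : (ZMod (q * r))ˣ) : ZMod (q * r))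
  have hcz : ∀ i, IsUnit (cz i) := fun i => Units.isUnit _
  have h0 : cz 0 = 1 := by simp [cz]
  refine ⟨RN ε cz, ⟨RN_cont hε hcz, RN_deg1 hε hcz h0, RN_deg2 hε hcz h0⟩, fun b x w => ?_⟩
  obtain ⟨B, hB⟩ := ZMod.castHom_surjective (Dvd.intro _ rfl : q ∣ q * r) b
  have e : ∀ i, ZMod.toCircle ((r : ZMod (q * r)) * B * (V 0 : ZMod (q * r)) * cz i) = ZMod.toCircle (b * (ℓ i : ZMod q)) := by
    intro i
    have h1 : (r : ZMod (q * r)) * B * (V 0 : ZMod (q * r)) * cz i = r * (B * (V i : ZMod (q * r))) := by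
      have : (V 0 : ZMod (q * r)) * cz i = V i := by
        simp only [cz, ← Units.val_mul]; congr 1; rw [mul_comm (V i), mul_inv_cancel_left]
      rw [← this]; ring
    rw [h1, tC_cast, map_mul, hB, ← hu, ← hV]; rfl
  have e2 : ∀ x : Sp k, la ℓ b x = cmul (fun i => ZMod.toCircle ((r : ZMod (q * r)) * B * (V 0 : ZMod (q * r)) * cz i)) x := by
    intro x; simp only [e]; rfl
  rw [e2, e2, RN_equi hε hcz]

lemma Pg_la {p : ℕ} [NeZero p] (ℓ : Fin k → ℤ) (a : ZMod p) (m : ℕ) (x : Sp k) :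
    Pg (fun _ => (m : ℤ)) (la ℓ a x) = la ℓ ((m : ZMod p) * a) (Pg (fun _ => (m : ℤ)) x) := Sp.ext' fun j => by
  rw [Pg_apply, la_apply, la_apply, Pg_apply, pw_mul _ (Circle.norm_coe _), mul_assoc, ← nsmul_eq_mul,
    AddChar.map_nsmul_eq_pow]
  simp

/-- the map `r` -/
theorem ex_r {p q : ℕ} [NeZero p] [NeZero q] (hp : p.Prime) (hq : q.Prime) (hpq : p ≠ q) (hp2 : p ≠ 2)
    (ℓ ℓ' : Fin k → ℤ) (hℓ : ∀ j, IsCoprime (ℓ j) (p : ℤ)) (hℓ' : ∀ j, IsCoprime (ℓ' j) (q : ℤ)) :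
    ∃ r : Sp k × Sp k → Sp k × Sp k, HE r ∧ ∀ (a : ZMod p) (b : ZMod q) z w,
      r (la ℓ a (la ℓ' b z), w) = (la ℓ ((q : ZMod p) * a) (r (z, w)).1, la ℓ' ((p : ZMod q) * b) (r (z, w)).2) := by
  have hodd : Odd p := hp.odd_of_ne_two hp2
  obtain ⟨s, hs⟩ := hodd
  have hs0 : s ≠ 0 := by rintro rfl; exact hp.one_lt.ne' (by simpa using hs)
  haveI : NeZero (2 * s) := ⟨by omega⟩
  obtain ⟨Rp, hRp, eRp⟩ := exR p 1 ℓ hℓ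
  obtain ⟨Rq, hRq, eRq⟩ := exR q (2 * s) ℓ' hℓ'
  obtain ⟨M, hM, -⟩ := exR (k := k) 1 2 (fun _ => 1) (fun _ => isCoprime_one_left)
  have hcop : IsCoprime (((1 - p : ℤ) * q ^ k) * (q * (2 * s))) (((1 - q * (2 * s) : ℤ) * p ^ k) * p) := by
    have c1 : IsCoprime (p : ℤ) q := by
      rw [Nat.isCoprime_iff_coprime]; exact (Nat.coprime_primes hp hq).2 hpq
    have c2 : IsCoprime (1 - p : ℤ) p := ⟨1, 1, by ring⟩
    have c3 : IsCoprime (2 * s : ℤ) (p : ℤ) := ⟨-1, 1, by rw [hs]; push_cast; ring⟩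
    have c4 : IsCoprime (2 * s : ℤ) (1 - q * (2 * s) : ℤ) := ⟨q, 1, by ring⟩
    have c5 : IsCoprime (q : ℤ) (1 - q * (2 * s) : ℤ) := ⟨2 * s, 1, by ring⟩
    have c6 : IsCoprime (1 - p : ℤ) (1 - q * (2 * s) : ℤ) := by
      have : (1 - p : ℤ) = - (2 * s) := by rw [hs]; push_cast; ring
      rw [this]; exact c4.neg_left
    have d1 : ∀ y : ℤ, IsCoprime y (1 - q * (2 * s) : ℤ) → IsCoprime y (p : ℤ) →
        IsCoprime y (((1 - q * (2 * s) : ℤ) * p ^ k) * p) := fun y h1 h2 => (h1.mul_right h2.pow_right).mul_right h2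
    have e1 := d1 _ c6 c2
    have e2 := d1 _ c5 c1.symm
    have e3 := d1 _ c4 c3
    exact ((e1.mul_left e2.pow_left).mul_left (e2.mul_left e3))
  obtain ⟨u, v, huv⟩ := hcop
  -- d' = u, c' = -v
  set d' : ℤ := u with hd'
  set c' : ℤ := -v with hc'
  let r1 : Sp k → Sp k → Sp k := fun z w => Rp (Pg (fun _ => (q : ℤ)) z) (dl c' w)
  let r2 : Sp k → Sp k → Sp k := fun z w => Rq (Pg (fun _ => (p : ℤ)) z) (dl d' w)
  set a : ℤ := (1 - p : ℤ) * q ^ k with ha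
  set b : ℤ := (1 - q * (2 * s) : ℤ) * p ^ k with hb
  set c : ℤ := p * c' with hc
  set d : ℤ := q * (2 * s) * d' with hd
  have det : a * d - b * c = 1 := by rw [← huv, hc, hd, hc']; ring
  have B1 : BD r1 a c := by
    have := hRp.map2 (BD_fst.post (PDeg_Pg (q : ℤ))) (BD_snd.post (PDeg_dl c'))
    convert this using 1 <;> push_cast <;> ring
  have B2 : BD r2 b d := by
    have := hRq.map2 (BD_fst.post (PDeg_Pg (p : ℤ))) (BD_snd.post (PDeg_dl d'))
    convert this using 1 <;> push_cast <;> ring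
  have a2 : ∃ a', a = 2 * a' := ⟨-s * q ^ k, by rw [ha, hs]; push_cast; ring⟩
  have d2 : ∃ d'', d = 2 * d'' := ⟨q * s * d', by rw [hd]; ring⟩
  obtain ⟨a', ha'⟩ := a2
  obtain ⟨d'', hd''⟩ := d2
  let m1 : Sp k → Sp k → Sp k := fun X Y => M (dl c Y) (dl d'' X)
  let m2 : Sp k → Sp k → Sp k := fun X Y => M (dl b X) (dl a' Y)
  have C1 : BD m1 d (-c) := by
    have := hM.map2 (BD_snd.post (PDeg_dl c)) (BD_fst.post (PDeg_dl d''))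
    convert this using 1
    · rw [hd'']; push_cast; ring
    · push_cast; ring
  have C2 : BD m2 (-b) a := by
    have := hM.map2 (BD_fst.post (PDeg_dl b)) (BD_snd.post (PDeg_dl a'))
    convert this using 1
    · push_cast; ring
    · rw [ha']; push_cast; ring
  have T1 : BD (fun z w => m1 (r1 z w) (r2 z w)) 1 0 := by
    have := C1.map2 B1 B2; convert this using 1
    · rw [← det]; ring
    · ring
  have T2 : BD (fun z w => m2 (r1 z w) (r2 z w)) 0 1 := by
    have := C2.map2 B1 B2; convert this using 1
    · ring
    · rw [← det]; ring
  have T1' : BD (fun z w => r1 (m1 z w) (m2 z w)) 1 0 := by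
    have := B1.map2 C1 C2; convert this using 1
    · rw [← det]; ring
    · ring
  have T2' : BD (fun z w => r2 (m1 z w) (m2 z w)) 0 1 := by
    have := B2.map2 C1 C2; convert this using 1
    · ring
    · rw [← det]; ring
  let r : Sp k × Sp k → Sp k × Sp k := fun P => (r1 P.1 P.2, r2 P.1 P.2)
  let ρ : Sp k × Sp k → Sp k × Sp k := fun P => (m1 P.1 P.2, m2 P.1 P.2)
  have cr : Continuous r := B1.c.prodMk B2.c
  have cρ : Continuous ρ := C1.c.prodMk C2.c
  have W : HE fun P => ρ (r P) := wedge_HE (T1 := fun z w => m1 (r1 z w) (r2 z w)) (T2 := fun z w => m2 (r1 z w) (r2 z w)) T1.c T2.c T1.l.one T2.l.zero T2.r.one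
  have W' : HE fun P => r (ρ P) := wedge_HE (T1 := fun z w => r1 (m1 z w) (m2 z w)) (T2 := fun z w => r2 (m1 z w) (m2 z w)) T1'.c T2'.c T1'.l.one T2'.l.zero T2'.r.one
  refine ⟨r, ?_, ?_⟩
  · obtain ⟨-, l, cl, l1, l2⟩ := W
    obtain ⟨-, l', cl', l1', l2'⟩ := W'
    exact HE.of_lr cr (cl.comp cρ) (cρ.comp cl') l1 l2'
  · intro x y z w
    simp only [r, r1, r2, Pg_la]
    have e1 : (q : ZMod q) * y = 0 := by simp
    have e2 : (p : ZMod p) * x = 0 := by simp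
    rw [e1, e2, la_zero, la_zero, eRp, eRq]

end
end LS.Up


namespace LS.Up
set_option linter.all false
open Topology unitInterval

section
variable {G : Type} [AddCommGroup G] [Fintype G]

/-- continuous actions, by explicit functions -/
structure Ac {X : Type*} [TopologicalSpace X] (a : G → X → X) : Prop where
  z : ∀ x, a 0 x = x
  add : ∀ g h x, a (g + h) x = a g (a h x)
  c : ∀ g, Continuous (a g)

variable {X : Type*} [TopologicalSpace X] {a : G → X → X}

lemma Ac.neg_l (ha : Ac a) (g : G) (x : X) : a (-g) (a g x) = x := by rw [← ha.add, neg_add_cancel, ha.z]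
lemma Ac.neg_r (ha : Ac a) (g : G) (x : X) : a g (a (-g) x) = x := by rw [← ha.add, add_neg_cancel, ha.z]

/-- slice functions -/
structure Sl (a : G → X → X) (f : X → ℝ) : Prop where
  c : Continuous f
  n : ∀ x, 0 ≤ f x
  s : ∀ x g, 0 < f x → 0 < f (a g x) → g = 0

noncomputable def sph (a : G → X → X) (f : X → ℝ) (x : X) : ℝ := ∑ g, f (a (-g) x)
noncomputable def sch (a : G → X → X) (f : X → ℝ) (x : X) : G :=
  open Classical in if h : ∃ g, 0 < f (a (-g) x) then h.choose else 0

variable {f : X → ℝ}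

lemma sph_cont (ha : Ac a) (hf : Sl a f) : Continuous (sph a f) := by
  unfold sph
  exact continuous_finset_sum _ fun g _ => hf.c.comp (ha.c _)

lemma sph_nonneg (hf : Sl a f) (x : X) : 0 ≤ sph a f x := Finset.sum_nonneg fun g _ => hf.n _

lemma sph_inv (ha : Ac a) (g : G) (x : X) : sph a f (a g x) = sph a f x := by
  unfold sph
  rw [← Equiv.sum_comp (Equiv.addRight g)]
  refine Finset.sum_congr rfl fun h _ => ?_
  rw [← ha.add]; congr 2; simp

lemma sph_pos (hf : Sl a f) {x : X} : 0 < sph a f x ↔ ∃ g, 0 < f (a (-g) x) := by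
  constructor
  · intro h
    by_contra hc
    push Not at hc
    exact absurd (Finset.sum_nonpos fun g _ => hc g) (not_le.2 h)
  · rintro ⟨g, hg⟩
    exact Finset.sum_pos' (fun g _ => hf.n _) ⟨g, Finset.mem_univ _, hg⟩

lemma sch_eq (ha : Ac a) (hf : Sl a f) {x : X} {g : G} (hg : 0 < f (a (-g) x)) : sch a f x = g := by
  have h : ∃ g, 0 < f (a (-g) x) := ⟨g, hg⟩
  have h1 : sch a f x = h.choose := by unfold sch; rw [dif_pos h]
  have h2 := h.choose_spec
  rw [h1]
  have := hf.s (a (-h.choose) x) (-g + h.choose) h2 (by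
    rw [← ha.add, add_assoc, add_neg_cancel, add_zero]; exact hg)
  rw [neg_add_eq_zero] at this; exact this.symm

lemma sch_pos (ha : Ac a) (hf : Sl a f) {x : X} (h : 0 < sph a f x) : 0 < f (a (-sch a f x) x) := by
  obtain ⟨g, hg⟩ := (sph_pos hf).1 h
  rw [sch_eq ha hf hg]; exact hg

lemma sch_equi (ha : Ac a) (hf : Sl a f) {x : X} (h : 0 < sph a f x) (g : G) :
    sch a f (a g x) = g + sch a f x := by
  apply sch_eq ha hf
  have := sch_pos ha hf h
  rw [← ha.add]
  convert this using 3
  abel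

lemma sch_loc (ha : Ac a) (hf : Sl a f) {x : X} (h : 0 < sph a f x) : ∀ᶠ y in 𝓝 x, sch a f y = sch a f x := by
  have h1 := sch_pos ha hf h
  have h2 : ∀ᶠ y in 𝓝 x, 0 < f (a (-sch a f x) y) :=
    ((hf.c.comp (ha.c _)).continuousAt.eventually (lt_mem_nhds h1))
  filter_upwards [h2] with y hy
  exact sch_eq ha hf hy

/-- Lemma D -/
theorem lemD {B P : Type*} [TopologicalSpace B] [TopologicalSpace P] {aB : G → B → B} {aP : G → P → P}
    (hB : Ac aB) (hP : Ac aP) {π : P → B} (hπ : Continuous π) (hπe : ∀ g e, π (aP g e) = aB g (π e))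
    {s : B → P} (hs : Continuous s) (hsπ : ∀ x, π (s x) = x) {Φ : I × P → P} (hΦ : Continuous Φ)
    (hΦπ : ∀ t e, π (Φ (t, e)) = π e) (hΦ0 : ∀ e, Φ (0, e) = e) (hΦ1 : ∀ e, Φ (1, e) = s (π e))
    (n : ℕ) (f : ℕ → B → ℝ) (hf : ∀ j, Sl aB (f j)) (hcov : ∀ x, ∃ j < n, ∃ g, 0 < f j (aB g x)) :
    ∃ S : B → P, Continuous S ∧ (∀ x, π (S x) = x) ∧ ∀ g x, S (aB g x) = aP g (S x) := by
  have key : ∀ m, ∃ (u : B → ℝ) (S : B → P), Continuous u ∧ (∀ x, 0 ≤ u x) ∧ (∀ g x, u (aB g x) = u x) ∧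
      (∀ x, ∀ j < m, 0 < sph aB (f j) x → 0 < u x) ∧ (∀ x, 0 < u x → ContinuousAt S x ∧ π (S x) = x ∧
        ∀ g, S (aB g x) = aP g (S x)) := by
    intro m
    induction m with
    | zero => exact ⟨fun _ => 0, s, continuous_const, fun _ => le_rfl, fun _ _ => rfl, by simp, by simp⟩
    | succ m ih =>
      classical
      obtain ⟨u, S, cu, u0, ui, hu, hS⟩ := ih
      set v := sph aB (f m) with hv
      set χ := sch aB (f m) with hχ
      have cv : Continuous v := sph_cont hB (hf m)
      have v0 : ∀ x, 0 ≤ v x := sph_nonneg (hf m)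
      have vi : ∀ g x, v (aB g x) = v x := sph_inv hB
      have χe : ∀ x, 0 < v x → ∀ g, χ (aB g x) = g + χ x := fun x hx g => sch_equi hB (hf m) hx g
      have χl : ∀ x, 0 < v x → ∀ᶠ y in 𝓝 x, χ y = χ x := fun x hx => sch_loc hB (hf m) hx
      let cl : ℝ → I := Set.projIcc 0 1 zero_le_one
      have ccl : Continuous cl := continuous_projIcc
      let t : B → I := fun x => cl ((2 * v x - u x) / (u x + v x))
      have ti : ∀ g x, t (aB g x) = t x := fun g x => by simp only [t, vi, ui]
      let sj : B → P := fun x => aP (χ x) (s (aB (-χ x) x))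
      let A : B → P := fun x => aP (χ x) (Φ (t x, aP (-χ x) (S x)))
      let S' : B → P := fun x => if v x ≤ 0 then S x else if u x ≤ 0 then sj x else A x
      have hsj : ∀ x, 0 < v x → ContinuousAt sj x ∧ π (sj x) = x ∧ ∀ g, sj (aB g x) = aP g (sj x) := by
        intro x hx
        refine ⟨?_, ?_, fun g => ?_⟩
        · have h1 : ContinuousAt (fun y => aP (χ x) (s (aB (-χ x) y))) x :=
            ((hP.c _).comp (hs.comp (hB.c _))).continuousAt
          refine h1.congr ?_
          filter_upwards [χl x hx] with y hy
          simp only [sj, hy]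
        · simp only [sj]; rw [hπe, hsπ, hB.neg_r]
        · simp only [sj]
          rw [χe x hx, hP.add, ← hB.add]
          congr 4; abel
      have hA : ∀ x, 0 < v x → 0 < u x → ContinuousAt A x ∧ π (A x) = x ∧ ∀ g, A (aB g x) = aP g (A x) := by
        intro x hx hux
        obtain ⟨s1, s2, s3⟩ := hS x hux
        refine ⟨?_, ?_, fun g => ?_⟩
        · have ct : ContinuousAt t x := by
            refine ccl.continuousAt.comp ?_
            refine ContinuousAt.div (by fun_prop) (by fun_prop) (by positivity)
          have h1 : ContinuousAt (fun y => aP (χ x) (Φ (t y, aP (-χ x) (S y)))) x := by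
            refine (hP.c _).continuousAt.comp ?_
            refine hΦ.continuousAt.comp ?_
            exact ct.prodMk ((hP.c _).continuousAt.comp s1)
          refine h1.congr ?_
          filter_upwards [χl x hx] with y hy
          simp only [A, hy]
        · simp only [A]; rw [hπe, hΦπ, hπe, s2, hB.neg_r]
        · simp only [A]
          rw [χe x hx, hP.add, ti, s3, ← hP.add (-(g + χ x))]
          congr 5; abel
      have e1 : ∀ x, 2 * v x < u x → S' x = S x := by
        intro x hx
        simp only [S']
        split_ifs with h1 h2
        · rfl
        · linarith [v0 x]
        · have h3 : t x = 0 := by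
            apply Set.projIcc_of_le_left
            exact div_nonpos_of_nonpos_of_nonneg (by linarith) (by linarith)
          simp only [A]
          rw [h3, hΦ0, hP.neg_r]
      have e2 : ∀ x, 2 * u x < v x → S' x = sj x := by
        intro x hx
        simp only [S']
        have := u0 x
        rw [if_neg (by linarith)]
        split_ifs with h2
        · rfl
        · have h3 : t x = 1 := by
            apply Set.projIcc_of_right_le
            rw [le_div_iff₀ (by linarith)]; linarith
          simp only [A, sj]
          rw [h3, hΦ1, hπe, (hS x (not_le.1 h2)).2.1]
      refine ⟨fun x => u x + v x, S', cu.add cv, fun x => add_nonneg (u0 x) (v0 x), fun g x => by simp only [ui, vi], ?_, ?_⟩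
      · intro x j hj hp
        rcases Nat.lt_succ_iff_lt_or_eq.1 hj with h | rfl
        · exact add_pos_of_pos_of_nonneg (hu x j h hp) (v0 x)
        · exact add_pos_of_nonneg_of_pos (u0 x) hp
      · intro x hx
        rcases (v0 x).eq_or_lt with h | h
        · have hux : 0 < u x := by linarith
          obtain ⟨s1, s2, s3⟩ := hS x hux
          refine ⟨s1.congr ?_, ?_, fun g => ?_⟩
          · have : ∀ᶠ y in 𝓝 x, 2 * v y < u y :=
              ((show Continuous fun y => 2 * v y by fun_prop).continuousAt.eventually_lt cu.continuousAt (show 2 * v x < u x by linarith))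
            filter_upwards [this] with y hy
            exact (e1 y hy).symm
          · rw [e1 x (by linarith), s2]
          · rw [e1 x (by linarith), e1 _ (by rw [ui, vi]; linarith), s3]
        · rcases (u0 x).eq_or_lt with h' | h'
          · obtain ⟨s1, s2, s3⟩ := hsj x h
            refine ⟨s1.congr ?_, ?_, fun g => ?_⟩
            · have : ∀ᶠ y in 𝓝 x, 2 * u y < v y :=
                ((show Continuous fun y => 2 * u y by fun_prop).continuousAt.eventually_lt cv.continuousAt (show 2 * u x < v x by linarith))
              filter_upwards [this] with y hy
              exact (e2 y hy).symm
            · rw [e2 x (by linarith), s2]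
            · rw [e2 x (by linarith), e2 _ (by rw [ui, vi]; linarith), s3]
          · obtain ⟨s1, s2, s3⟩ := hA x h h'
            have e3 : ∀ y, 0 < v y → 0 < u y → S' y = A y := fun y h1 h2 => by
              simp only [S']; rw [if_neg (not_le.2 h1), if_neg (not_le.2 h2)]
            refine ⟨s1.congr ?_, ?_, fun g => ?_⟩
            · have a1 : ∀ᶠ y in 𝓝 x, 0 < v y := cv.continuousAt.eventually (lt_mem_nhds h)
              have a2 : ∀ᶠ y in 𝓝 x, 0 < u y := cu.continuousAt.eventually (lt_mem_nhds h')
              filter_upwards [a1, a2] with y h1 h2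
              exact (e3 y h1 h2).symm
            · rw [e3 x h h', s2]
            · rw [e3 x h h', e3 _ (by rwa [vi]) (by rwa [ui]), s3]
  obtain ⟨u, S, cu, u0, ui, hu, hS⟩ := key n
  have hp : ∀ x, 0 < u x := by
    intro x
    obtain ⟨j, hj, g, hg⟩ := hcov x
    exact hu x j hj ((sph_pos (hf j)).2 ⟨-g, by rwa [neg_neg]⟩)
  exact ⟨S, continuous_iff_continuousAt.2 fun x => (hS x (hp x)).1, fun x => (hS x (hp x)).2.1,
    fun g x => (hS x (hp x)).2.2 g⟩

/-- slices exist for free actions on compact metric spaces -/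
theorem ex_slices {B : Type*} [MetricSpace B] [CompactSpace B] {aB : G → B → B}
    (hB : Ac aB) (hfree : ∀ g x, aB g x = x → g = 0) :
    ∃ (n : ℕ) (f : ℕ → B → ℝ), (∀ j, Sl aB (f j)) ∧ ∀ x, ∃ j < n, ∃ g, 0 < f j (aB g x) := by
  have h1 : ∀ x : B, ∃ δ > 0, ∀ y g, dist y x < δ → dist (aB g y) x < δ → g = 0 := by
    intro x
    have : ∀ g : G, ∀ᶠ δ in 𝓝[>] (0 : ℝ), ∀ y, dist y x < δ → dist (aB g y) x < δ → g = 0 := by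
      intro g
      by_cases hg : g = 0
      · exact Filter.Eventually.of_forall fun _ _ _ _ => hg
      have hne : 0 < dist (aB g x) x := dist_pos.2 fun h => hg (hfree g x h)
      obtain ⟨δ, hδ, hd⟩ := Metric.continuousAt_iff.1 ((hB.c g).continuousAt (x := x)) (dist (aB g x) x / 2) (half_pos hne)
      have : ∀ᶠ η in 𝓝[>] (0 : ℝ), η < min δ (dist (aB g x) x / 2) :=
        nhdsWithin_le_nhds (gt_mem_nhds (lt_min hδ (half_pos hne)))
      filter_upwards [this] with η hη y h1 h2
      have h3 := hd (h1.trans (hη.trans_le (min_le_left _ _)))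
      have h4 := h2.trans (hη.trans_le (min_le_right _ _))
      have := dist_triangle_left (aB g x) x (aB g y)
      linarith
    have h2 := (Filter.eventually_all.2 this).and (self_mem_nhdsWithin)
    obtain ⟨δ, h3, h4⟩ := h2.exists
    exact ⟨δ, h4, fun y g => h3 g y⟩
  choose δ hδ hs using h1
  obtain ⟨t, ht⟩ := isCompact_univ.elim_finite_subcover (fun x : B => Metric.ball x (δ x)) (fun _ => Metric.isOpen_ball)
    (fun x _ => Set.mem_iUnion.2 ⟨x, Metric.mem_ball_self (hδ x)⟩)
  let f : B → B → ℝ := fun x y => max 0 (δ x - dist y x)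
  have hfp : ∀ x y, 0 < f x y ↔ dist y x < δ x := fun x y => by simp [f]
  have hf : ∀ x, Sl aB (f x) := fun x => ⟨by simp only [f]; fun_prop, fun y => le_max_left _ _, fun y g h1 h2 =>
    hs x y g ((hfp _ _).1 h1) ((hfp _ _).1 h2)⟩
  let l := t.toList
  refine ⟨l.length, fun j => if h : j < l.length then f (l.get ⟨j, h⟩) else fun _ => 0, fun j => ?_, fun x => ?_⟩
  · by_cases h : j < l.length
    · simp only [h, dite_true]; exact hf _
    · simp only [h, dite_false]
      exact ⟨continuous_const, fun _ => le_rfl, fun x g h => absurd h (lt_irrefl _)⟩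
  · obtain ⟨y, hy, hxy⟩ := Set.mem_iUnion₂.1 (ht (Set.mem_univ x))
    obtain ⟨⟨j, hj⟩, e⟩ := List.get_of_mem (Finset.mem_toList.2 hy)
    refine ⟨j, hj, 0, ?_⟩
    have hj' : j < l.length := hj
    simp only [hB.z]
    rw [dif_pos hj', show l.get ⟨j, hj'⟩ = y from e]
    exact (hfp _ _).2 hxy

end
end LS.Up


namespace LS.Up
set_option linter.all false
open Topology unitInterval

section
variable {E B : Type*} [TopologicalSpace E] [TopologicalSpace B]

/-- mapping path space -/
abbrev PP (r : E → B) := {e : E × C(I, B) // e.2 0 = r e.1}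

variable {r : E → B} {T : Type*} [TopologicalSpace T]

def mkP (r : E → B) (y : T → E) (γ : C(T × I, B)) (h : ∀ t, γ (t, 0) = r (y t)) (t : T) : PP r :=
  ⟨(y t, γ.curry t), h t⟩

lemma mkP_cont {y : T → E} (hy : Continuous y) {γ : C(T × I, B)} (h : ∀ t, γ (t, 0) = r (y t)) :
    Continuous (mkP r y γ h) :=
  Continuous.subtype_mk (hy.prodMk γ.curry.continuous) _

lemma PP.ext {e e' : PP r} (h1 : e.1.1 = e'.1.1) (h2 : ∀ u, e.1.2 u = e'.1.2 u) : e = e' :=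
  Subtype.ext (Prod.ext h1 (ContinuousMap.ext h2))

def pe (e : PP r) : B := e.1.2 1

lemma ev_cont {e : T → PP r} (he : Continuous e) {u : T → I} (hu : Continuous u) :
    Continuous fun t => (e t).1.2 (u t) := by
  have h1 : Continuous fun t => (e t).1.2 := continuous_snd.comp (continuous_subtype_val.comp he)
  exact h1.eval hu

lemma pe_cont : Continuous (pe : PP r → B) := ev_cont continuous_id continuous_const

lemma lemS (hr : HE r) : ∃ (s : B → PP r) (Φ : I × PP r → PP r), Continuous s ∧ Continuous Φ ∧
    (∀ x, pe (s x) = x) ∧ (∀ t e, pe (Φ (t, e)) = pe e) ∧ (∀ e, Φ (0, e) = e) ∧ (∀ e, Φ (1, e) = s (pe e)) := by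
  obtain ⟨cr, ρ, cρ, hα, η, cη, η0, η1, -⟩ := hr
  simp only at η0 η1
  let s : B → PP r := mkP r ρ ⟨fun p : B × I => η (p.2, p.1), by fun_prop⟩ fun x => η0 x
  have cs : Continuous s := mkP_cont cρ _
  have hs : ∀ x, pe (s x) = x := fun x => η1 x
  let ι : E → PP r := mkP r (fun y => y) ⟨fun p : E × I => r p.1, by fun_prop⟩ fun x => rfl
  have cι : Continuous ι := mkP_cont continuous_id _
  have cy : Continuous fun e : PP r => e.1.1 := by fun_prop
  have H1 : Hm ∅ (fun e : PP r => e) (fun e => ι e.1.1) := by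
    refine ⟨mkP r (fun p : I × PP r => p.2.1.1) ⟨fun p : (I × PP r) × I => p.1.2.1.2 (unitInterval.symm p.1.1 * p.2), ?_⟩ ?_,
      mkP_cont (by fun_prop) _, ?_, ?_, by simp⟩
    · exact ev_cont (by fun_prop) (by fun_prop)
    · intro t; simpa using t.2.2
    · intro e; exact PP.ext rfl fun u => by simp [mkP]
    · intro e; exact PP.ext rfl fun u => by simpa [mkP, ι] using e.2
  have H2 : Hm ∅ (fun e : PP r => ι e.1.1) (fun e => ι (ρ (r e.1.1))) := (hα.symm.pre' cy).post cι
  have H3 : Hm ∅ (fun e : PP r => ι (ρ (r e.1.1))) (fun e => s (r e.1.1)) := by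
    refine ⟨mkP r (fun p : I × PP r => ρ (r p.2.1.1)) ⟨fun p : (I × PP r) × I => η (p.1.1 * p.2, r p.1.2.1.1), by fun_prop⟩ ?_,
      mkP_cont (by fun_prop) _, ?_, ?_, by simp⟩
    · intro t; simp [η0]
    · intro e; exact PP.ext rfl fun u => by simp [mkP, ι, η0]
    · intro e; exact PP.ext rfl fun u => by simp [mkP, s]
  have H4 : Hm ∅ (fun e : PP r => s (r e.1.1)) (fun e => s (pe e)) := by
    refine ⟨fun p => s (p.2.1.2 p.1), cs.comp (ev_cont continuous_snd continuous_fst), fun e => ?_, fun e => rfl, by simp⟩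
    simp only [e.2]
  obtain ⟨Ψ, cΨ, Ψ0, Ψ1, -⟩ := ((H1.trans H2).trans H3).trans H4
  simp only at Ψ0 Ψ1
  let cl : ℝ → I := Set.projIcc 0 1 zero_le_one
  have ccl : Continuous cl := continuous_projIcc
  have cl1 : cl 1 = 1 := by simp [cl]
  have cl0 : cl 0 = 0 := by simp [cl]
  have clI : ∀ u : I, cl u = u := fun u => by simp [cl]
  let m : PP r → I → B := fun e τ => pe (Ψ (τ, e))
  have cm : Continuous fun p : PP r × I => m p.1 p.2 := pe_cont.comp (cΨ.comp continuous_swap)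
  let L : I × PP r → PP r := fun p => if (p.1 : ℝ) ≤ 1 / 2 then Ψ (cl (2 * p.1), p.2) else s (m p.2 (cl (2 - 2 * p.1)))
  have cL : Continuous L := by
    refine Continuous.if_le ?_ ?_ (by fun_prop) (by fun_prop) ?_
    · fun_prop
    · refine cs.comp ?_
      have h1 : Continuous fun p : I × PP r => (p.2, cl (2 - 2 * (p.1 : ℝ))) := by fun_prop
      have h3 := cm.comp h1; simpa only [Function.comp_def] using h3
    · intro p hp
      rw [hp]
      norm_num
      rw [cl1, Ψ1]
      simp only [m]; rw [Ψ1, hs]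
  let t' : I → ℝ := fun τ => min (2 * τ) (2 - 2 * τ)
  have ct' : Continuous t' := by simp only [t']; fun_prop
  have t0 : ∀ τ, 0 ≤ t' τ := fun τ => le_min (by linarith [τ.2.1]) (by linarith [τ.2.2])
  have t1 : ∀ τ, t' τ ≤ 1 := fun τ => by
    rcases le_total (τ : ℝ) (1 / 2) with h | h
    · exact (min_le_left _ _).trans (by linarith)
    · exact (min_le_right _ _).trans (by linarith)
  have hL : ∀ τ e, pe (L (τ, e)) = m e (cl (t' τ)) := by
    intro τ e
    simp only [L]
    split_ifs with h
    · simp only [m]; rw [show t' τ = 2 * τ from min_eq_left (by linarith)]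
    · rw [hs, show t' τ = 2 - 2 * τ from min_eq_right (by linarith)]
  let g : (I × PP r) × I → B := fun p => if (p.2 : ℝ) ≤ 1 - t' p.1.1 / 2 then (L p.1).1.2 (cl (p.2 / (1 - t' p.1.1 / 2)))
    else m p.1.2 (cl (2 * (1 - p.2)))
  have cg : Continuous g := by
    refine Continuous.if_le ?_ ?_ (by fun_prop) (by fun_prop) ?_
    · refine ev_cont (by fun_prop) (ccl.comp ?_)
      refine Continuous.div (by fun_prop) (by fun_prop) fun p => ?_
      have := t1 p.1.1
      linarith
    · have h1 : Continuous fun p : (I × PP r) × I => (p.1.2, cl (2 * (1 - (p.2 : ℝ)))) := by fun_prop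
      have h3 := cm.comp h1; simpa only [Function.comp_def] using h3
    · intro p hp
      have := t1 p.1.1
      rw [hp, div_self (by linarith), cl1, show 2 * (1 - (1 - t' p.1.1 / 2)) = t' p.1.1 by ring]
      exact hL p.1.1 p.1.2
  have g0 : ∀ p, g (p, 0) = r (L p).1.1 := by
    intro p
    have := t1 p.1
    simp only [g]
    rw [if_pos (by simp; linarith)]
    simp only [Set.Icc.coe_zero, zero_div, cl0]
    exact (L p).2
  let Φ : I × PP r → PP r := mkP r (fun p => (L p).1.1) ⟨g, cg⟩ g0
  have cΦ : Continuous Φ := mkP_cont (by fun_prop) _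
  have hm0 : ∀ e, m e 0 = pe e := fun e => by simp only [m, Ψ0]
  have hΦL : ∀ τ e, t' τ = 0 → Φ (τ, e) = L (τ, e) := by
    intro τ e h
    refine PP.ext rfl fun u => ?_
    show g ((τ, e), u) = _
    simp only [g]
    rw [h, if_pos (by have := u.2.2; linarith)]
    simp [clI]
  refine ⟨s, Φ, cs, cΦ, hs, fun τ e => ?_, fun e => ?_, fun e => ?_⟩
  · show g ((τ, e), 1) = _
    simp only [g]
    split_ifs with h
    · have : t' τ = 0 := by have := t0 τ; simp at h; linarith
      rw [this]
      simp only [Set.Icc.coe_one, zero_div, sub_zero, div_one, cl1]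
      refine (hL τ e).trans ?_
      rw [this, cl0, hm0]
    · simp only [Set.Icc.coe_one, sub_self, mul_zero, cl0, hm0]
  · rw [hΦL 0 e (by simp [t'])]
    simp [L, cl0, Ψ0]
  · rw [hΦL 1 e (by simp [t'])]
    simp only [L]
    rw [if_neg (by norm_num)]
    norm_num
    rw [cl0, hm0]

/-- equivariant sections up to homotopy -/
theorem ex_sec {G : Type} [AddCommGroup G] [Fintype G] {E B : Type*} [TopologicalSpace E] [MetricSpace B] [CompactSpace B]
    {aE : G → E → E} {aB : G → B → B} (hE : Ac aE) (hB : Ac aB) (hfree : ∀ g x, aB g x = x → g = 0) {r : E → B}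
    (hr : HE r) (hre : ∀ g y, r (aE g y) = aB g (r y)) :
    ∃ S : B → E, Continuous S ∧ (∀ g x, S (aB g x) = aE g (S x)) ∧ Hm ∅ (fun x => r (S x)) (fun x => x) := by
  obtain ⟨s, Φ, cs, cΦ, h1, h2, h3, h4⟩ := lemS hr
  obtain ⟨n, f, hf, hcov⟩ := ex_slices hB hfree
  let aP : G → PP r → PP r := fun g e => ⟨(aE g e.1.1, (⟨aB g, hB.c g⟩ : C(B, B)).comp e.1.2), by
    show aB g (e.1.2 0) = _
    rw [e.2, hre]⟩
  have hP : Ac aP := by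
    refine ⟨fun e => PP.ext (hE.z _) fun u => hB.z _, fun g h e => PP.ext (hE.add _ _ _) fun u => hB.add _ _ _, fun g => ?_⟩
    refine Continuous.subtype_mk (((hE.c g).comp (by fun_prop)).prodMk ?_) _
    have : Continuous fun e : PP r => e.1.2 := by fun_prop
    exact (ContinuousMap.continuous_postcomp _).comp this
  obtain ⟨S, cS, S1, S2⟩ := lemD hB hP pe_cont (fun g e => rfl) cs h1 cΦ h2 h3 h4 n f hf hcov
  refine ⟨fun x => (S x).1.1, by fun_prop, fun g x => by simp only [S2]; rfl, fun p => (S p.2).1.2 p.1, ?_, fun x => (S x).2, fun x => S1 x, by simp⟩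
  exact ev_cont (cS.comp continuous_snd) continuous_fst

end
end LS.Up


namespace LS.Up
set_option linter.all false
open Topology unitInterval

section
variable {X : Type*} [TopologicalSpace X]

/-- null subsets, by a partially defined homotopy -/
def Nul (A : Set X) (c : X) : Prop :=
  ∃ H : I × X → X, (∀ t, ∀ x ∈ A, ContinuousAt H (t, x)) ∧ (∀ x ∈ A, H (0, x) = x) ∧ ∀ x ∈ A, H (1, x) = c

lemma Nul.to_Hm {A : Set X} {c : X} (h : Nul A c) : Hm ∅ (Subtype.val : A → X) (fun _ => c) := by
  obtain ⟨H, hc, h0, h1⟩ := h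
  refine ⟨fun p => H (p.1, p.2.1), ?_, fun x => h0 _ x.2, fun x => h1 _ x.2, by simp⟩
  rw [continuous_iff_continuousAt]
  rintro ⟨t, x⟩
  have := hc t x.1 x.2
  exact ContinuousAt.comp (g := H) (f := fun p : I × A => (p.1, p.2.1)) this (by fun_prop)

lemma Nul.of_Hm {A : Set X} (hA : IsOpen A) {c : X} (h : Hm ∅ (Subtype.val : A → X) (fun _ => c)) : Nul A c := by
  classical
  obtain ⟨H, hc, h0, h1, -⟩ := h
  refine ⟨fun p => if h : p.2 ∈ A then H (p.1, ⟨p.2, h⟩) else p.2, ?_, ?_, ?_⟩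
  · intro t x hx
    have hemb : IsOpenEmbedding (fun p : I × A => (p.1, (p.2 : X))) :=
      IsOpenEmbedding.prodMap IsOpenEmbedding.id hA.isOpenEmbedding_subtypeVal
    have := hemb.continuousAt_iff (f := fun p : I × A => (p.1, (p.2 : X))) (x := (t, ⟨x, hx⟩))
      (g := fun p => if h : p.2 ∈ A then H (p.1, ⟨p.2, h⟩) else p.2)
    refine this.1 ?_
    have e : ((fun p : I × X => if h : p.2 ∈ A then H (p.1, ⟨p.2, h⟩) else p.2) ∘ fun p : I × A => (p.1, (p.2 : X))) = H := by
      funext p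
      simp
    rw [e]; exact hc.continuousAt
  · intro x hx; simp [hx, h0]
  · intro x hx; simp [hx, h1]

lemma Nul.chg [PathConnectedSpace X] {A : Set X} (hA : IsOpen A) {c : X} (h : Nul A c) (d : X) : Nul A d := by
  refine Nul.of_Hm hA (h.to_Hm.trans ?_)
  let γ := PathConnectedSpace.somePath c d
  exact ⟨fun p => γ p.1, by fun_prop, fun x => by simp [γ], fun x => by simp [γ], by simp⟩

lemma Nul.glue {A B : Set X} {c : X} (hA : IsOpen A) (hB : IsOpen B) (hAB : Disjoint A B) (h1 : Nul A c) (h2 : Nul B c) :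
    Nul (A ∪ B) c := by
  classical
  obtain ⟨H, hc, h0, h1⟩ := h1
  obtain ⟨K, kc, k0, k1⟩ := h2
  have hd : ∀ x ∈ B, x ∉ A := fun x hx hx' => Set.disjoint_left.1 hAB hx' hx
  refine ⟨fun p => if p.2 ∈ A then H p else K p, ?_, ?_, ?_⟩
  · rintro t x (hx | hx)
    · refine (hc t x hx).congr ?_
      filter_upwards [(hA.preimage continuous_snd).mem_nhds (show (t, x) ∈ Prod.snd ⁻¹' A from hx)] with p hp
      rw [if_pos (show p.2 ∈ A from hp)]
    · refine (kc t x hx).congr ?_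
      filter_upwards [(hB.preimage continuous_snd).mem_nhds (show (t, x) ∈ Prod.snd ⁻¹' B from hx)] with p hp
      rw [if_neg (hd p.2 hp)]
  · rintro x (hx | hx)
    · simp [hx, h0]
    · simp [hd x hx, k0 x hx]
  · rintro x (hx | hx)
    · simp [hx, h1]
    · simp [hd x hx, k1 x hx]

lemma Nul.nh {A : Set X} {c : X} (h : Nul A c) :
    ContinuousMap.Nullhomotopic (⟨Subtype.val, continuous_subtype_val⟩ : C(A, X)) := by
  obtain ⟨H, hc, h0, h1, -⟩ := h.to_Hm
  exact ⟨c, ⟨⟨⟨H, hc⟩, h0, h1⟩⟩⟩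

end

section
variable {G : Type} [AddCommGroup G] [Fintype G] {B X : Type*} [TopologicalSpace B] [TopologicalSpace X]

lemma desc {a : G → B → B} (ha : Ac a) {π : B → X} (hπc : Continuous π) (hπo : IsOpenMap π) (hπs : Function.Surjective π)
    (hπi : ∀ g x, π (a g x) = π x) (hπf : ∀ x y, π x = π y → ∃ g, y = a g x) {f : B → ℝ} (hf : Sl a f) {D : Set B} {b0 : B}
    (hD : Nul D b0) {W : Set B} (hWo : IsOpen W) (hWi : ∀ g, ∀ x ∈ W, a g x ∈ W) (hW1 : ∀ x ∈ W, 0 < sph a f x)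
    (hWD : ∀ x ∈ W, 0 < f x → x ∈ D) : Nul (π '' W) (π b0) := by
  obtain ⟨K, kc, k0, k1⟩ := hD
  have hD' : ∀ x ∈ W, a (-sch a f x) x ∈ D := fun x hx => hWD _ (hWi _ _ hx) (sch_pos ha hf (hW1 x hx))
  let T : I × B → X := fun p => π (K (p.1, a (-sch a f p.2) p.2))
  let H : I × X → X := fun p => T (p.1, Function.surjInv hπs p.2)
  have hT : ∀ t, ∀ x ∈ W, ∀ g, T (t, a g x) = T (t, x) := by
    intro t x hx g
    simp only [T]
    rw [sch_equi ha hf (hW1 x hx), ← ha.add]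
    congr 4; abel
  have hH : ∀ t, ∀ x ∈ W, H (t, π x) = T (t, x) := by
    intro t x hx
    simp only [H]
    obtain ⟨g, hg⟩ := hπf x (Function.surjInv hπs (π x)) (Function.surjInv_eq hπs _).symm
    rw [hg, hT t x hx]
  have hTc : ∀ t, ∀ x ∈ W, ContinuousAt T (t, x) := by
    intro t x hx
    have h1 : ContinuousAt (fun p : I × B => π (K (p.1, a (-sch a f x) p.2))) (t, x) := by
      refine hπc.continuousAt.comp ?_
      refine ContinuousAt.comp (g := K) (f := fun p : I × B => (p.1, a (-sch a f x) p.2)) (kc t _ (hD' x hx)) ?_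
      have := ha.c (-sch a f x)
      fun_prop
    refine h1.congr ?_
    have := (continuous_snd.continuousAt (x := ((t, x) : I × B))).eventually (sch_loc ha hf (hW1 x hx))
    filter_upwards [this] with p hp
    simp only [T, hp]
  refine ⟨H, ?_, ?_, ?_⟩
  · rintro t _ ⟨x, hx, rfl⟩
    have ho : IsOpenMap (Prod.map (id : I → I) π) := IsOpenMap.id.prodMap hπo
    have h2 := ho.nhds_le (t, x)
    unfold ContinuousAt
    rw [hH t x hx]
    refine Filter.Tendsto.mono_left ?_ h2
    rw [Filter.tendsto_map'_iff]
    refine (hTc t x hx).congr' ?_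
    have := (hWo.preimage continuous_snd).mem_nhds (show (t, x) ∈ (Prod.snd : I × B → B) ⁻¹' W from hx)
    filter_upwards [this] with p hp
    exact (hH p.1 p.2 hp).symm
  · rintro _ ⟨x, hx, rfl⟩
    rw [hH _ x hx]
    simp only [T]
    rw [k0 _ (hD' x hx), hπi]
  · rintro _ ⟨x, hx, rfl⟩
    rw [hH _ x hx]
    simp only [T]
    rw [k1 _ (hD' x hx)]

variable {E : Type*} [TopologicalSpace E]

/-- the cover -/
theorem ex_cover [PathConnectedSpace X] {aE : G → E → E} {aB : G → B → B} (hE : Ac aE) (hB : Ac aB)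
    {π : B → X} (hπc : Continuous π) (hπo : IsOpenMap π) (hπs : Function.Surjective π)
    (hπi : ∀ g x, π (aB g x) = π x) (hπf : ∀ x y, π x = π y → ∃ g, y = aB g x)
    {S : B → E} (hS : Continuous S) (hSe : ∀ g x, S (aB g x) = aE g (S x)) {r : E → B} (hr : Continuous r)
    (hrS : Hm ∅ (fun x => r (S x)) (fun x => x)) (M : ℕ) (F : ℕ → E → ℝ) (hF : ∀ m, Sl aE (F m)) (hF0 : ∀ y, F 0 y = 0)
    (hcov : ∀ y, ∃ m ≤ M, 0 < sph aE (F m) y) (μ : Bool → E → ℝ) (hμc : ∀ ε, Continuous (μ ε)) (hμ0 : ∀ ε y, 0 ≤ μ ε y)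
    (hμi : ∀ ε g y, μ ε (aE g y) = μ ε y) (hμ : ∀ y, ∃ ε, 0 < μ ε y)
    (hnul : ∀ m ε, ∃ e0, Hm ∅ (Subtype.val : {y | 0 < F m y ∧ 0 < μ ε y} → E) (fun _ => e0)) :
    ∃ U : Fin (M + 1) → Set X, (∀ i, IsOpen (U i)) ∧ (⋃ i, U i) = Set.univ ∧
      ∀ i, ContinuousMap.Nullhomotopic (⟨Subtype.val, continuous_subtype_val⟩ : C(U i, X)) := by
  let f : ℕ → B → ℝ := fun m x => F m (S x)
  have hf : ∀ m, Sl aB (f m) := fun m => ⟨(hF m).c.comp hS, fun x => (hF m).n _, fun x g h1 h2 => by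
    simp only [f] at h1 h2
    rw [hSe] at h2
    exact (hF m).s _ _ h1 h2⟩
  have hfs : ∀ m x, sph aB (f m) x = sph aE (F m) (S x) := fun m x => by simp only [sph, f, hSe]
  let Λ : ℕ → B → ℝ := fun m => sph aB (f m)
  have Λc : ∀ m, Continuous (Λ m) := fun m => sph_cont hB (hf m)
  have Λ0 : ∀ m x, 0 ≤ Λ m x := fun m => sph_nonneg (hf m)
  have Λi : ∀ m g x, Λ m (aB g x) = Λ m x := fun m => sph_inv hB
  have Λz : ∀ x, Λ 0 x = 0 := fun x => by simp [Λ, sph, f, hF0]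
  let ν : Bool → B → ℝ := fun ε x => μ ε (S x)
  have νc : ∀ ε, Continuous (ν ε) := fun ε => (hμc ε).comp hS
  have νi : ∀ ε g x, ν ε (aB g x) = ν ε x := fun ε g x => by simp only [ν, hSe, hμi]
  have ν0 : ∀ ε x, 0 ≤ ν ε x := fun ε x => hμ0 _ _
  have hDo : ∀ m ε, IsOpen {x | 0 < f m x ∧ 0 < ν ε x} := fun m ε =>
    (isOpen_lt continuous_const (hf m).c).inter (isOpen_lt continuous_const (νc ε))
  have hD : ∀ m ε, ∃ b0, Nul {x | 0 < f m x ∧ 0 < ν ε x} b0 := by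
    intro m ε
    obtain ⟨e0, he⟩ := hnul m ε
    refine ⟨r e0, Nul.of_Hm (hDo m ε) ?_⟩
    have h1 : Hm ∅ (fun x : {x | 0 < f m x ∧ 0 < ν ε x} => r (S x.1)) (fun x => x.1) :=
      hrS.pre' (φ := Subtype.val) continuous_subtype_val
    refine h1.symm.trans ?_
    have h2 := (he.pre' (φ := fun x : {x | 0 < f m x ∧ 0 < ν ε x} => ⟨S x.1, x.2⟩) (by fun_prop)).post hr
    exact h2
  obtain ⟨x0⟩ : Nonempty X := inferInstance
  have key : ∀ m ε (W : Set B), IsOpen W → (∀ g, ∀ x ∈ W, aB g x ∈ W) → (∀ x ∈ W, 0 < Λ m x ∧ 0 < ν ε x) → Nul (π '' W) x0 := by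
    intro m ε W hWo hWi hW
    obtain ⟨b0, hb⟩ := hD m ε
    exact (desc hB hπc hπo hπs hπi hπf (hf m) hb hWo hWi (fun x hx => (hW x hx).1)
      fun x hx h => ⟨h, (hW x hx).2⟩).chg (hπo _ hWo) x0
  let P : ℕ → Set B := fun m => {x | Λ m x * ν false x < Λ (m + 1) x * ν true x}
  let N : ℕ → Set B := fun m => {x | Λ (m + 1) x * ν true x < Λ m x * ν false x}
  have hPo : ∀ m, IsOpen (P m) := fun m => isOpen_lt ((Λc _).mul (νc _)) ((Λc _).mul (νc _))
  have hNo : ∀ m, IsOpen (N m) := fun m => isOpen_lt ((Λc _).mul (νc _)) ((Λc _).mul (νc _))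
  have hPi : ∀ m g, ∀ x ∈ P m, aB g x ∈ P m := fun m g x hx => by
    simp only [P, Set.mem_setOf_eq, Λi, νi] at hx ⊢; exact hx
  have hNi : ∀ m g, ∀ x ∈ N m, aB g x ∈ N m := fun m g x hx => by
    simp only [N, Set.mem_setOf_eq, Λi, νi] at hx ⊢; exact hx
  have pos : ∀ u v : ℝ, 0 ≤ u → 0 ≤ v → 0 < u * v → 0 < u ∧ 0 < v := fun u v hu hv h =>
    ⟨lt_of_le_of_ne hu (by rintro rfl; simp at h), lt_of_le_of_ne hv (by rintro rfl; simp at h)⟩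
  refine ⟨fun i => π '' P i ∪ π '' N i, fun i => (hπo _ (hPo _)).union (hπo _ (hNo _)), ?_, fun i => ?_⟩
  · rw [Set.eq_univ_iff_forall]
    intro y
    obtain ⟨x, rfl⟩ := hπs y
    by_contra hc
    have hc' : ∀ m ≤ M, Λ m x * ν false x = Λ (m + 1) x * ν true x := by
      intro m hm
      by_contra hne
      apply hc
      refine Set.mem_iUnion.2 ⟨⟨m, by omega⟩, ?_⟩
      rcases lt_or_gt_of_ne hne with h | h
      · exact Or.inl ⟨x, h, rfl⟩
      · exact Or.inr ⟨x, h, rfl⟩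
    obtain ⟨m, hm, hpos⟩ := hcov (S x)
    rw [← hfs] at hpos
    rcases (ν0 true x).eq_or_lt with h | h
    · obtain ⟨ε, hε⟩ := hμ (S x)
      have hν : 0 < ν false x := by
        cases ε
        · exact hε
        · exact absurd h (ne_of_lt hε)
      have := hc' m hm
      rw [← h, mul_zero] at this
      exact absurd this (ne_of_gt (mul_pos hpos hν))
    · have : ∀ m ≤ M, Λ m x = 0 := by
        intro m
        induction m with
        | zero => exact fun _ => Λz x
        | succ m ih =>
          intro hm
          have h1 := hc' m (by omega)
          rw [ih (by omega), zero_mul] at h1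
          exact (mul_eq_zero.1 h1.symm).resolve_right (ne_of_gt h)
      exact absurd (this m hm) (ne_of_gt hpos)
  · refine (Nul.glue (hπo _ (hPo _)) (hπo _ (hNo _)) ?_ (key (i + 1) true _ (hPo _) (hPi _) fun x hx => ?_)
      (key i false _ (hNo _) (hNi _) fun x hx => ?_)).nh
    · rw [Set.disjoint_left]
      rintro _ ⟨x, hx, rfl⟩ ⟨y, hy, h⟩
      obtain ⟨g, rfl⟩ := hπf _ _ h
      have := hNi _ g _ hy
      simp only [P, N, Set.mem_setOf_eq] at hx this
      linarith
    · refine pos _ _ (Λ0 _ _) (ν0 _ _) (lt_of_le_of_lt (mul_nonneg (Λ0 _ _) (ν0 _ _)) hx)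
    · refine pos _ _ (Λ0 _ _) (ν0 _ _) (lt_of_le_of_lt (mul_nonneg (Λ0 _ _) (ν0 _ _)) hx)
end
end LS.Up


namespace LS.Up
set_option linter.all false
open Topology unitInterval

section
variable (N : ℕ)

noncomputable def sct (v : ℂ) : ℝ := max 0 (v.re - Real.cos (Real.pi / N) * ‖v‖)

lemma sct_cont : Continuous (sct N) := by unfold sct; fun_prop
lemma sct_nonneg (v : ℂ) : 0 ≤ sct N v := le_max_left _ _
lemma sct_pos {v : ℂ} : 0 < sct N v ↔ Real.cos (Real.pi / N) * ‖v‖ < v.re := by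
  unfold sct; rw [lt_max_iff]; simp

variable {N}
lemma sct_ne (hN : 2 ≤ N) {v : ℂ} (h : 0 < sct N v) : 0 < v.re := by
  rw [sct_pos] at h
  refine lt_of_le_of_lt (mul_nonneg (Real.cos_nonneg_of_neg_pi_div_two_le_of_le ?_ ?_) (norm_nonneg _)) h
  · have := Real.pi_pos
    have : 0 ≤ Real.pi / N := by positivity
    linarith
  · have : (2 : ℝ) ≤ N := by exact_mod_cast hN
    exact div_le_div_of_nonneg_left Real.pi_pos.le (by norm_num) this

lemma sct_arg (hN : 2 ≤ N) {v : ℂ} (h : 0 < sct N v) : |v.arg| < Real.pi / N := by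
  have h0 := sct_ne hN h
  rw [sct_pos] at h
  have hv : v ≠ 0 := by rintro rfl; simp at h0
  by_contra hc
  push Not at hc
  have h1 := Real.cos_le_cos_of_nonneg_of_le_pi (by positivity) (Complex.abs_arg_le_pi v) hc
  rw [Real.cos_abs, Complex.cos_arg hv, div_le_iff₀ (by positivity)] at h1
  linarith

lemma sct_uniq (hN : 2 ≤ N) {v ζ : ℂ} (hζ : ζ ^ N = 1) (h1 : 0 < sct N v) (h2 : 0 < sct N (ζ * v)) : ζ = 1 := by
  have a1 := sct_arg hN h1
  have a2 := sct_arg hN h2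
  have hv : v ≠ 0 := by rintro rfl; have := sct_ne hN h1; simp at this
  have hn : ‖ζ‖ = 1 := by
    have := congrArg norm hζ
    rw [norm_pow, norm_one] at this
    exact (pow_eq_one_iff_of_nonneg (norm_nonneg _) (by omega)).1 this
  set φ := (ζ * v).arg with hφ
  set θ := v.arg with hθ
  have e1 : (‖v‖ : ℂ) * Complex.exp (θ * Complex.I) = v := Complex.norm_mul_exp_arg_mul_I v
  have e2 : (‖ζ * v‖ : ℂ) * Complex.exp (φ * Complex.I) = ζ * v := Complex.norm_mul_exp_arg_mul_I _
  rw [norm_mul, hn, one_mul] at e2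
  have hvn : (‖v‖ : ℂ) ≠ 0 := by simpa using hv
  have e3 : ζ = Complex.exp (((φ - θ : ℝ) : ℂ) * Complex.I) := by
    push_cast
    rw [sub_mul, Complex.exp_sub, eq_div_iff (Complex.exp_ne_zero _)]
    apply mul_left_cancel₀ hvn
    rw [e2, mul_left_comm, e1]
  have hN0 : (0 : ℝ) < N := by positivity
  have e4 : Complex.exp (((N * (φ - θ) : ℝ) : ℂ) * Complex.I) = 1 := by
    rw [← hζ, e3, ← Complex.exp_nat_mul]
    push_cast; ring_nf
  rw [Complex.exp_eq_one_iff] at e4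
  obtain ⟨m, hm⟩ := e4
  have e5 : N * (φ - θ) = m * (2 * Real.pi) := by
    have : ((N * (φ - θ) : ℝ) : ℂ) = ((m * (2 * Real.pi) : ℝ) : ℂ) := by
      apply mul_right_cancel₀ Complex.I_ne_zero
      rw [hm]; push_cast; ring
    exact_mod_cast this
  have e6 : |N * (φ - θ)| < 2 * Real.pi := by
    rw [abs_mul, abs_of_pos hN0]
    have := abs_sub φ θ
    have hh : |φ - θ| < 2 * (Real.pi / N) := by
      rw [abs_lt] at *
      constructor <;> linarith
    calc N * |φ - θ| < N * (2 * (Real.pi / N)) := by gcongr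
      _ = 2 * Real.pi := by field_simp
  have m0 : m = 0 := by
    rw [e5, abs_mul, abs_of_pos Real.two_pi_pos] at e6
    have : |(m : ℝ)| < 1 := by
      by_contra hc; push Not at hc
      nlinarith [Real.pi_pos]
    have : |m| < 1 := by exact_mod_cast this
    exact Int.abs_lt_one_iff.1 this
  rw [m0, Int.cast_zero, zero_mul] at e5
  have : φ - θ = 0 := (mul_eq_zero.1 e5).resolve_left hN0.ne'
  rw [e3, this]; simp

noncomputable def xi (N : ℕ) : ℂ := Complex.exp (((-(Real.pi / N) : ℝ) : ℂ) * Complex.I)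

lemma xi_norm : ‖xi N‖ = 1 := Complex.norm_exp_ofReal_mul_I _

lemma sct_exp {R θ : ℝ} (hN : 2 ≤ N) (hR : 0 < R) (h0 : 0 ≤ θ) (h1 : θ < Real.pi / N) :
    0 < sct N ((R : ℂ) * Complex.exp ((θ : ℂ) * Complex.I)) := by
  rw [sct_pos, norm_mul, Complex.norm_exp_ofReal_mul_I, Complex.re_ofReal_mul, Complex.exp_ofReal_mul_I_re]
  simp only [Complex.norm_real, mul_one, Real.norm_eq_abs, abs_of_pos hR]
  rw [mul_comm]
  apply mul_lt_mul_of_pos_left _ hR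
  refine Real.cos_lt_cos_of_nonneg_of_le_pi h0 ?_ h1
  have : (1 : ℝ) ≤ N := by exact_mod_cast (by omega : 1 ≤ N)
  exact div_le_self Real.pi_pos.le this

lemma sct_ex (hN : 2 ≤ N) {v : ℂ} (hv : v ≠ 0) :
    ∃ ζ : ℂ, ζ ^ N = 1 ∧ (0 < sct N (ζ * v) ∨ 0 < sct N (ζ * (xi N * v))) := by
  have hN0 : (0 : ℝ) < N := by positivity
  have hpi := Real.pi_pos
  have hR : 0 < ‖v‖ := by positivity
  set d : ℝ := 2 * Real.pi / N with hd
  have hd0 : 0 < d := by positivity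
  set j := ⌊v.arg / d⌋ with hj
  have j1 : (j : ℝ) * d ≤ v.arg := by rw [← le_div_iff₀ hd0]; exact Int.floor_le _
  have j2 : v.arg < (j + 1) * d := by rw [← div_lt_iff₀ hd0]; exact Int.lt_floor_add_one _
  have e1 : (‖v‖ : ℂ) * Complex.exp (v.arg * Complex.I) = v := Complex.norm_mul_exp_arg_mul_I v
  have hd2 : d = 2 * (Real.pi / N) := by rw [hd]; ring
  refine ⟨Complex.exp (((-(j * d) : ℝ) : ℂ) * Complex.I), ?_, ?_⟩
  · rw [← Complex.exp_nat_mul, Complex.exp_eq_one_iff]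
    refine ⟨-j, ?_⟩
    rw [hd]; push_cast
    have : (N : ℂ) ≠ 0 := by exact_mod_cast hN0.ne'
    field_simp
  · rcases lt_or_ge (v.arg - j * d) (Real.pi / N) with h | h
    · left
      have := sct_exp hN hR (by linarith) h
      convert this using 2
      conv_lhs => rw [← e1]
      rw [mul_left_comm, ← Complex.exp_add]
      congr 2; push_cast; ring
    · right
      have := sct_exp hN hR (θ := v.arg - j * d - Real.pi / N) (by linarith) (by linarith)
      convert this using 2
      conv_lhs => rw [← e1]
      unfold xi
      rw [mul_left_comm (Complex.exp _) (‖v‖ : ℂ), mul_left_comm (Complex.exp _) (‖v‖ : ℂ), ← Complex.exp_add, ← Complex.exp_add]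
      congr 2; push_cast; ring
end
end LS.Up


namespace LS.Up
set_option linter.all false
open Topology unitInterval

section
variable {k : ℕ} [NeZero k] {p q : ℕ} [NeZero p] [NeZero q] (ℓ ℓ' : Fin k → ℤ)

lemma tC_mul_eq (hp : p.Prime) (hq : q.Prime) (hpq : p ≠ q) (a : ZMod p) (b : ZMod q)
    (h : ((ZMod.toCircle a : Circle) : ℂ) * ((ZMod.toCircle b : Circle) : ℂ) = 1) : a = 0 := by
  haveI : Fact p.Prime := ⟨hp⟩
  have h1 := congrArg (· ^ q) h
  simp only [mul_pow, tC_pow, mul_one, one_pow] at h1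
  rw [← Circle.coe_pow, ← AddChar.map_nsmul_eq_pow] at h1
  have h2 : ZMod.toCircle (q • a) = ZMod.toCircle (0 : ZMod p) := by
    apply Circle.ext
    rw [h1]; simp
  have h3 := ZMod.injective_toCircle h2
  rw [nsmul_eq_mul] at h3
  refine (mul_eq_zero.1 h3).resolve_left ?_
  rw [ZMod.natCast_eq_zero_iff]
  exact fun h => hpq ((Nat.prime_dvd_prime_iff_eq hp hq).1 h)

lemma unit_l (hℓ : ∀ j, IsCoprime (ℓ j) (p : ℤ)) (j : Fin k) : ∃ u : ZMod p, u * (ℓ j : ZMod p) = 1 := by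
  obtain ⟨u, v, huv⟩ := hℓ j
  refine ⟨u, ?_⟩
  have := congrArg (fun t : ℤ => (t : ZMod p)) huv
  simp at this
  exact this

lemma kap_inj (hp : p.Prime) (hq : q.Prime) (hpq : p ≠ q) (hℓ : ∀ j, IsCoprime (ℓ j) (p : ℤ)) (hℓ' : ∀ j, IsCoprime (ℓ' j) (q : ℤ))
    (j : Fin k) (a : ZMod p) (b : ZMod q)
    (h : ((ZMod.toCircle (a * (ℓ j : ZMod p)) : Circle) : ℂ) * ((ZMod.toCircle (b * (ℓ' j : ZMod q)) : Circle) : ℂ) = 1) :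
    a = 0 ∧ b = 0 := by
  have h1 := tC_mul_eq hp hq hpq _ _ h
  rw [mul_comm] at h
  have h2 := tC_mul_eq hq hp hpq.symm _ _ h
  obtain ⟨u, hu⟩ := unit_l ℓ hℓ j
  obtain ⟨u', hu'⟩ := unit_l ℓ' hℓ' j
  constructor
  · calc a = u * ℓ j * a := by rw [hu, one_mul]
      _ = u * (a * ℓ j) := by ring
      _ = 0 := by rw [h1, mul_zero]
  · calc b = u' * ℓ' j * b := by rw [hu', one_mul]
      _ = u' * (b * ℓ' j) := by ring
      _ = 0 := by rw [h2, mul_zero]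

lemma kap_surj (hp : p.Prime) (hq : q.Prime) (hpq : p ≠ q) (hℓ : ∀ j, IsCoprime (ℓ j) (p : ℤ)) (hℓ' : ∀ j, IsCoprime (ℓ' j) (q : ℤ))
    (j : Fin k) {c : ℂ} (hc : c ^ (p * q) = 1) : ∃ (a : ZMod p) (b : ZMod q),
    ((ZMod.toCircle (a * (ℓ j : ZMod p)) : Circle) : ℂ) * ((ZMod.toCircle (b * (ℓ' j : ZMod q)) : Circle) : ℂ) = c := by
  have hc0 : c ≠ 0 := by rintro rfl; simp [NeZero.ne p, NeZero.ne q] at hc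
  have hcop : IsCoprime (p : ℤ) (q : ℤ) := Nat.isCoprime_iff_coprime.2 ((Nat.coprime_primes hp hq).2 hpq)
  obtain ⟨u, v, huv⟩ := hcop
  have hz : c ^ ((p : ℤ) * q) = 1 := by exact_mod_cast hc
  have s1 : (c ^ (v * q)) ^ p = 1 := by
    rw [← zpow_natCast, ← zpow_mul, show v * q * (p : ℤ) = p * q * v by ring, zpow_mul, hz, one_zpow]
  have s2 : (c ^ (u * p)) ^ q = 1 := by
    rw [← zpow_natCast, ← zpow_mul, show u * p * (q : ℤ) = p * q * u by ring, zpow_mul, hz, one_zpow]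
  obtain ⟨a, ha⟩ := tC_surj s1
  obtain ⟨b, hb⟩ := tC_surj s2
  obtain ⟨x, hx⟩ := unit_l ℓ hℓ j
  obtain ⟨y, hy⟩ := unit_l ℓ' hℓ' j
  refine ⟨a * x, b * y, ?_⟩
  rw [mul_assoc, hx, mul_one, mul_assoc, hy, mul_one, ha, hb, ← zpow_add₀ hc0, add_comm, huv, zpow_one]

noncomputable def aE (g : ZMod p × ZMod q) (y : Sp k × Sp k) : Sp k × Sp k := (la ℓ g.1 (la ℓ' g.2 y.1), y.2)
noncomputable def aB (g : ZMod p × ZMod q) (y : Sp k × Sp k) : Sp k × Sp k :=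
  (la ℓ ((q : ZMod p) * g.1) y.1, la ℓ' ((p : ZMod q) * g.2) y.2)

lemma la_comm (a : ZMod p) (b : ZMod q) (x : Sp k) : la ℓ a (la ℓ' b x) = la ℓ' b (la ℓ a x) :=
  Sp.ext' fun j => by simp only [la_apply]; ring

lemma aE_ac : Ac (aE (p := p) (q := q) ℓ ℓ') := by
  refine ⟨fun y => ?_, fun g h y => ?_, fun g => ?_⟩
  · simp [aE, la_zero]
  · simp only [aE, Prod.fst_add, Prod.snd_add, la_add]
    rw [la_comm ℓ ℓ' h.1]
  · exact (((la_cont ℓ _).comp (la_cont ℓ' _)).comp continuous_fst).prodMk continuous_snd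

lemma aB_ac : Ac (aB (p := p) (q := q) ℓ ℓ') := by
  refine ⟨fun y => ?_, fun g h y => ?_, fun g => ?_⟩
  · simp [aB, la_zero]
  · simp only [aB, Prod.fst_add, Prod.snd_add, la_add, mul_add]
  · exact ((la_cont ℓ _).comp continuous_fst).prodMk ((la_cont ℓ' _).comp continuous_snd)

lemma cast_ne (hp : p.Prime) (hq : q.Prime) (hpq : p ≠ q) : (q : ZMod p) ≠ 0 := by
  rw [Ne, ZMod.natCast_eq_zero_iff]
  exact fun h => hpq ((Nat.prime_dvd_prime_iff_eq hp hq).1 h)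

lemma aB_free (hp : p.Prime) (hq : q.Prime) (hpq : p ≠ q) (hℓ : ∀ j, IsCoprime (ℓ j) (p : ℤ)) (hℓ' : ∀ j, IsCoprime (ℓ' j) (q : ℤ))
    (g : ZMod p × ZMod q) (x : Sp k × Sp k) (h : aB ℓ ℓ' g x = x) : g = 0 := by
  haveI : Fact p.Prime := ⟨hp⟩
  haveI : Fact q.Prime := ⟨hq⟩
  have h1 := la_free ℓ hℓ _ _ (congrArg Prod.fst h)
  have h2 := la_free ℓ' hℓ' _ _ (congrArg Prod.snd h)
  exact Prod.ext ((mul_eq_zero.1 h1).resolve_left (cast_ne hp hq hpq)) ((mul_eq_zero.1 h2).resolve_left (cast_ne hq hp hpq.symm))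

noncomputable def sg (i : Fin k) (c : ℂ) (hc : ‖c‖ = 1) : Sp k := ⟨WithLp.toLp 2 fun j => if j = i then c else 0,
  (Sp.mem_iff _).2 (by simp [apply_ite, hc])⟩

/-- half spaces are null -/
lemma half_null {Y : Type*} [TopologicalSpace Y] {f : Y → Sp k} (hf : Continuous f) (i : Fin k) (c : ℂ) (hc : ‖c‖ = 1)
    (h : ∀ y, (f y).1 i ≠ -c) : Hm ∅ f (fun _ => sg i c hc) := by
  refine seg_Hm hf continuous_const ∅ (fun x hx => h x ?_) (by simp)
  rw [hx]; simp [sg]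

instance Sp_pc : PathConnectedSpace (Sp k) := by
  rw [← isPathConnected_iff_pathConnectedSpace]
  refine isPathConnected_sphere ?_ _ zero_le_one
  have hk : 1 ≤ k := NeZero.one_le
  have h : Module.finrank ℝ (EuclideanSpace ℂ (Fin k)) = 2 * k := by
    rw [← Module.finrank_mul_finrank ℝ ℂ, Complex.finrank_real_complex, finrank_euclideanSpace_fin]
  rw [← Module.finrank_eq_rank, h]
  exact_mod_cast (by omega : 1 < 2 * k)

noncomputable def Fs (k N : ℕ) (m : ℕ) (y : Sp k × Sp k) : ℝ :=
  if h : 1 ≤ m ∧ (m - 1) / 2 < k then sct N (xi N ^ (m % 2) * y.1.1 ⟨(m - 1) / 2, h.2⟩) else 0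

noncomputable def mus (ε : Bool) (y : Sp k × Sp k) : ℝ := if ε then 1 + (y.2.1 0).re else 1 - (y.2.1 0).re

lemma aE_coord (g : ZMod p × ZMod q) (y : Sp k × Sp k) (j : Fin k) : (aE ℓ ℓ' g y).1.1 j =
    (((ZMod.toCircle (g.1 * (ℓ j : ZMod p)) : Circle) : ℂ) * ((ZMod.toCircle (g.2 * (ℓ' j : ZMod q)) : Circle) : ℂ)) * y.1.1 j := by
  simp only [aE, la_apply]; ring

lemma Fs_sl (hp : p.Prime) (hq : q.Prime) (hpq : p ≠ q) (hℓ : ∀ j, IsCoprime (ℓ j) (p : ℤ)) (hℓ' : ∀ j, IsCoprime (ℓ' j) (q : ℤ))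
    (m : ℕ) : Sl (aE (p := p) (q := q) ℓ ℓ') (Fs k (p * q) m) := by
  have hN : 2 ≤ p * q := le_trans hp.two_le (Nat.le_mul_of_pos_right _ hq.pos)
  by_cases h : 1 ≤ m ∧ (m - 1) / 2 < k
  · have e : Fs k (p * q) m = fun y => sct (p * q) (xi (p * q) ^ (m % 2) * y.1.1 ⟨(m - 1) / 2, h.2⟩) := by
      funext y; simp [Fs, h]
    rw [e]
    refine ⟨?_, fun x => sct_nonneg _ _, fun x g h1 h2 => ?_⟩
    · exact (sct_cont _).comp (continuous_const.mul ((continuous_coord _).comp continuous_fst))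
    · rw [aE_coord, mul_left_comm] at h2
      have h3 := sct_uniq hN ?_ h1 h2
      · obtain ⟨u, v⟩ := kap_inj ℓ ℓ' hp hq hpq hℓ hℓ' _ _ _ h3
        exact Prod.ext u v
      · rw [mul_pow, pow_mul, tC_pow, one_pow, mul_comm p q, pow_mul, tC_pow, one_pow, one_mul]
  · have e : Fs k (p * q) m = fun y => 0 := by
      funext y; simp only [Fs]; rw [dif_neg h]
    rw [e]
    exact ⟨continuous_const, fun _ => le_rfl, fun x g h1 => absurd h1 (lt_irrefl _)⟩

lemma Fs_cov (hp : p.Prime) (hq : q.Prime) (hpq : p ≠ q) (hℓ : ∀ j, IsCoprime (ℓ j) (p : ℤ)) (hℓ' : ∀ j, IsCoprime (ℓ' j) (q : ℤ))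
    (y : Sp k × Sp k) : ∃ m ≤ 2 * k, 0 < sph (aE (p := p) (q := q) ℓ ℓ') (Fs k (p * q) m) y := by
  have hN : 2 ≤ p * q := le_trans hp.two_le (Nat.le_mul_of_pos_right _ hq.pos)
  obtain ⟨j, hj⟩ := y.1.exists_ne
  obtain ⟨ζ, hζ, hh⟩ := sct_ex hN hj
  obtain ⟨a, b, hab⟩ := kap_surj ℓ ℓ' hp hq hpq hℓ hℓ' j hζ
  have hj2 := j.2
  rcases hh with hh | hh
  · refine ⟨2 * j + 2, by omega, (sph_pos (Fs_sl ℓ ℓ' hp hq hpq hℓ hℓ' _)).2 ⟨-(a, b), ?_⟩⟩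
    have e1 : (2 * (j : ℕ) + 2 - 1) / 2 = j := by omega
    have e2 : (2 * (j : ℕ) + 2) % 2 = 0 := by omega
    simp only [Fs, e1, e2, neg_neg]
    rw [dif_pos ⟨by omega, j.2⟩, aE_coord, pow_zero, one_mul]
    simpa only [hab] using hh
  · refine ⟨2 * j + 1, by omega, (sph_pos (Fs_sl ℓ ℓ' hp hq hpq hℓ hℓ' _)).2 ⟨-(a, b), ?_⟩⟩
    have e1 : (2 * (j : ℕ) + 1 - 1) / 2 = j := by omega
    have e2 : (2 * (j : ℕ) + 1) % 2 = 1 := by omega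
    simp only [Fs, e1, e2, neg_neg]
    rw [dif_pos ⟨by omega, j.2⟩, aE_coord, pow_one]
    rw [mul_left_comm] at hh
    simpa only [hab] using hh

lemma Fs_null {N : ℕ} (hN : 2 ≤ N) (m : ℕ) (ε : Bool) :
    ∃ e0, Hm ∅ (Subtype.val : {y : Sp k × Sp k | 0 < Fs k N m y ∧ 0 < mus ε y} → Sp k × Sp k) (fun _ => e0) := by
  by_cases h : 1 ≤ m ∧ (m - 1) / 2 < k
  · have hc : ‖(starRingEnd ℂ) (xi N ^ (m % 2))‖ = 1 := by simp [xi_norm]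
    have hd : ‖(if ε then 1 else -1 : ℂ)‖ = 1 := by split_ifs <;> simp
    refine ⟨(sg ⟨(m - 1) / 2, h.2⟩ _ hc, sg 0 _ hd), ?_⟩
    refine Hm.prod (f := fun y : {y : Sp k × Sp k | 0 < Fs k N m y ∧ 0 < mus ε y} => y.1.1) (f' := fun y => y.1.2)
      (half_null (by fun_prop) _ _ _ fun y hy => ?_) (half_null (by fun_prop) _ _ _ fun y hy => ?_)
    · have h1 := y.2.1
      simp only [Fs] at h1
      rw [dif_pos h] at h1
      have h2 := sct_ne hN h1
      rw [hy, mul_neg, Complex.mul_conj] at h2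
      rw [Complex.neg_re, Complex.ofReal_re] at h2
      linarith [Complex.normSq_nonneg (xi N ^ (m % 2))]
    · have h1 := y.2.2
      simp only [mus] at h1
      rw [hy] at h1
      cases ε <;> simp at h1
  · refine ⟨(ee, ee), ?_⟩
    have : IsEmpty {y : Sp k × Sp k | 0 < Fs k N m y ∧ 0 < mus ε y} := ⟨fun y => by
      have h1 := y.2.1
      simp only [Fs] at h1
      rw [dif_neg h] at h1
      exact lt_irrefl _ h1⟩
    exact Hm.of_eq _ continuous_subtype_val fun x => this.elim x

theorem upper (hp : p.Prime) (hq : q.Prime) (hpq : p ≠ q) (hp2 : p ≠ 2) (hℓ : ∀ j, IsCoprime (ℓ j) (p : ℤ)) (hℓ' : ∀ j, IsCoprime (ℓ' j) (q : ℤ)) :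
    ∃ U : Fin (2 * k + 1) → Set (LensSpace p k ℓ × LensSpace q k ℓ'), (∀ i, IsOpen (U i)) ∧ (⋃ i, U i) = Set.univ ∧
      ∀ i, ContinuousMap.Nullhomotopic (⟨Subtype.val, continuous_subtype_val⟩ : C(U i, LensSpace p k ℓ × LensSpace q k ℓ')) := by
  haveI : Fact p.Prime := ⟨hp⟩
  haveI : Fact q.Prime := ⟨hq⟩
  have hN : 2 ≤ p * q := le_trans hp.two_le (Nat.le_mul_of_pos_right _ hq.pos)
  obtain ⟨r, hr, hre⟩ := ex_r hp hq hpq hp2 ℓ ℓ' hℓ hℓ'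
  obtain ⟨S, cS, S1, S2⟩ := ex_sec (aE_ac (p := p) (q := q) ℓ ℓ') (aB_ac (p := p) (q := q) ℓ ℓ')
    (aB_free ℓ ℓ' hp hq hpq hℓ hℓ') hr (fun g y => hre g.1 g.2 y.1 y.2)
  let π : Sp k × Sp k → LensSpace p k ℓ × LensSpace q k ℓ' := Prod.map (mkL p ℓ) (mkL q ℓ')
  have hπc : Continuous π := (mkL_quot ℓ).continuous.prodMap (mkL_quot ℓ').continuous
  have hπs : Function.Surjective π := (mkL_surj ℓ).prodMap (mkL_surj ℓ')
  haveI : PathConnectedSpace (LensSpace p k ℓ × LensSpace q k ℓ') := hπs.pathConnectedSpace hπc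
  have hmb : ∀ y : Sp k, |(y.1 0).re| ≤ 1 := fun y => by
    refine (Complex.abs_re_le_norm _).trans ?_
    have h1 := y.sq
    have h2 : ‖y.1 0‖ ^ 2 ≤ 1 := by
      refine le_trans ?_ h1.le; exact Finset.single_le_sum (f := fun j => ‖y.1 j‖ ^ 2) (fun _ _ => by positivity) (Finset.mem_univ 0)
    exact (sq_le_one_iff₀ (norm_nonneg _)).1 h2
  refine ex_cover (aE_ac (p := p) (q := q) ℓ ℓ') (aB_ac (p := p) (q := q) ℓ ℓ') (π := π) hπc
    ((mkL_open ℓ hℓ).prodMap (mkL_open ℓ' hℓ')) hπs ?_ ?_ cS S1 hr.1 S2 (2 * k) (Fs k (p * q))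
    (Fs_sl ℓ ℓ' hp hq hpq hℓ hℓ') ?_ (Fs_cov ℓ ℓ' hp hq hpq hℓ hℓ') mus ?_ ?_ ?_ ?_ (Fs_null hN)
  · intro g x
    exact Prod.ext (mkL_la ℓ _ _) (mkL_la ℓ' _ _)
  · rintro ⟨x1, x2⟩ ⟨y1, y2⟩ h
    simp only [π, Prod.map, Prod.mk.injEq] at h
    obtain ⟨a, ha⟩ := (mkL_eq_iff ℓ _ _).1 h.1
    obtain ⟨b, hb⟩ := (mkL_eq_iff ℓ' _ _).1 h.2
    refine ⟨((q : ZMod p)⁻¹ * a, (p : ZMod q)⁻¹ * b), ?_⟩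
    simp only [aB]
    rw [mul_inv_cancel_left₀ (cast_ne hp hq hpq), mul_inv_cancel_left₀ (cast_ne hq hp hpq.symm), ← ha, ← hb]
  · intro y; simp [Fs]
  · intro ε
    have h1 : Continuous fun y : Sp k × Sp k => (y.2.1 0).re :=
      Complex.continuous_re.comp ((continuous_coord _).comp continuous_snd)
    cases ε
    · have e : mus (k := k) false = fun y => 1 - (y.2.1 0).re := by funext y; simp [mus]
      rw [e]; fun_prop
    · have e : mus (k := k) true = fun y => 1 + (y.2.1 0).re := by funext y; simp [mus]
      rw [e]; fun_prop
  · intro ε y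
    have := abs_le.1 (hmb y.2)
    cases ε <;> simp [mus] <;> linarith
  · intro ε g y; rfl
  · intro y
    by_cases h : 0 < 1 + (y.2.1 0).re
    · exact ⟨true, by simpa [mus] using h⟩
    · exact ⟨false, by simp [mus]; linarith⟩
end

/-- transport of good covers along the swap -/
lemma cov_swap {X Y : Type*} [TopologicalSpace X] [TopologicalSpace Y] {m : ℕ}
    (h : ∃ U : Fin m → Set (X × Y), (∀ i, IsOpen (U i)) ∧ (⋃ i, U i) = Set.univ ∧
      ∀ i, ContinuousMap.Nullhomotopic (⟨Subtype.val, continuous_subtype_val⟩ : C(U i, X × Y))) :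
    ∃ U : Fin m → Set (Y × X), (∀ i, IsOpen (U i)) ∧ (⋃ i, U i) = Set.univ ∧
      ∀ i, ContinuousMap.Nullhomotopic (⟨Subtype.val, continuous_subtype_val⟩ : C(U i, Y × X)) := by
  obtain ⟨U, h1, h2, h3⟩ := h
  refine ⟨fun i => Prod.swap ⁻¹' U i, fun i => (h1 i).preimage continuous_swap, ?_, fun i => ?_⟩
  · rw [← Set.preimage_iUnion, h2, Set.preimage_univ]
  · let a : C((Prod.swap ⁻¹' U i : Set (Y × X)), U i) := ⟨fun y => ⟨y.1.swap, y.2⟩, by fun_prop⟩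
    let b : C(X × Y, Y × X) := ⟨Prod.swap, continuous_swap⟩
    exact ((h3 i).comp_right b).comp_left a

end LS.Up

/-- assembly -/
theorem LS.main_thm (k : ℕ) (hk : 1 ≤ k) (n : ℕ) (hn : n = 2 * k - 1)
    (p q : ℕ) (hp : p.Prime) (hq : q.Prime) (hpq : p ≠ q)
    (ℓ : Fin k → ℤ) (hℓ : ∀ j, IsCoprime (ℓ j) (p : ℤ))
    (ℓ' : Fin k → ℤ) (hℓ' : ∀ j, IsCoprime (ℓ' j) (q : ℤ)) :
    lsCat (LensSpace p k ℓ × LensSpace q k ℓ') = n + 1 := by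
  haveI : NeZero k := ⟨by omega⟩
  haveI : NeZero p := ⟨hp.ne_zero⟩
  haveI : NeZero q := ⟨hq.ne_zero⟩
  obtain rfl : n = 2 * k - 1 := hn
  have e : 2 * k - 1 + 1 = 2 * k := by omega
  rw [e]
  unfold lsCat
  have hup : 2 * k ∈ {m : ℕ | ∃ U : Fin (m + 1) → Set (LensSpace p k ℓ × LensSpace q k ℓ'),
    (∀ i, IsOpen (U i)) ∧ (⋃ i, U i) = Set.univ ∧
    ∀ i, ContinuousMap.Nullhomotopic
      (⟨Subtype.val, continuous_subtype_val⟩ : C(U i, LensSpace p k ℓ × LensSpace q k ℓ'))} := by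
    by_cases h2 : p = 2
    · exact LS.Up.cov_swap (LS.Up.upper ℓ' ℓ hq hp hpq.symm (fun h => hpq (h2.trans h.symm)) hℓ' hℓ)
    · exact LS.Up.upper ℓ ℓ' hp hq hpq h2 hℓ hℓ'
  refine le_antisymm (Nat.sInf_le hup) (le_csInf ⟨_, hup⟩ ?_)
  rintro m ⟨U, h1, h2, h3⟩
  by_contra hm
  push Not at hm
  refine LS.low_contra hk p q hp.one_lt hq.one_lt ℓ ℓ' hℓ hℓ' (fun i => U ⟨min i m, by omega⟩) (fun i => h1 _) ?_ (fun i => h3 _)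
  intro x
  have hx : x ∈ ⋃ i, U i := by rw [h2]; trivial
  obtain ⟨i, hi⟩ := Set.mem_iUnion.1 hx
  refine ⟨i, by omega, ?_⟩
  have : (⟨min i m, by omega⟩ : Fin (m + 1)) = i := Fin.ext (by simp; omega)
  show x ∈ U ⟨min i m, _⟩
  rw [this]; exact hi


/-- For `n = 2k-1` and distinct primes `p, q ≥ k`, for all lens spaces `L^n_p` and `L^n_q`,
`cat (L^n_p × L^n_q) = n + 1`. -/
theorem lsCat_prod_lensSpace_of_prime (k : ℕ) (hk : 1 ≤ k) (n : ℕ) (hn : n = 2 * k - 1)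
    (p q : ℕ) (hp : p.Prime) (hq : q.Prime) (hpq : p ≠ q) (hpk : k ≤ p) (hqk : k ≤ q)
    (ℓ : Fin k → ℤ) (hℓ : ∀ j, IsCoprime (ℓ j) (p : ℤ))
    (ℓ' : Fin k → ℤ) (hℓ' : ∀ j, IsCoprime (ℓ' j) (q : ℤ)) :
    lsCat (LensSpace p k ℓ × LensSpace q k ℓ') = n + 1 := by
  exact LS.main_thm k hk n hn p q hp hq hpq ℓ hℓ ℓ' hℓ'
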